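/- (Backward Harnack inequality.) Let Ω ⊂ ℝⁿ be a bounded Lipschitz domain with constants m, r₀, let Q = Ω × (0,∞), and let L be a nondivergence parabolic operator on Q with ellipticity constant ν. Let u be a nonnegative solution of Lu = 0 in Q which extends continuously to cl(Q) with value 0 at every point of ∂Ω × (0,∞). Let constants δ > 0, μ > 0, λ ≥ 1 satisfy diam(Ω) ≤ λ r₀ and diam(Ω) ≤ λ δ. Then there exists N = N(n, ν, m, λ, μ) such that for every X = (x,t) ∈ Q and every r with dist(x, ∂Ω) > μr, t > δ², and 0 < r ≤ (1/2)·min(r₀, δ), one has u(x, t + r²) ≤ N · u(x, t − r²). -/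

import Mathlib

open MeasureTheory Set Metric Filter

noncomputable section

/-- Euclidean space `ℝⁿ`. -/
abbrev E (n : ℕ) : Type := EuclideanSpace ℝ (Fin n)

/-- Second spatial partial derivative `D_i D_j u` at a space-time point `X`. -/
def D2 {n : ℕ} (u : E n × ℝ → ℝ) (X : E n × ℝ) (i j : Fin n) : ℝ :=
  fderiv ℝ (fun x => fderiv ℝ (fun x' => u (x', X.2)) x (EuclideanSpace.single j 1))
    X.1 (EuclideanSpace.single i 1)

/-- Time derivative `D_t u` at a space-time point `X`. -/
def Dt {n : ℕ} (u : E n × ℝ → ℝ) (X : E n × ℝ) : ℝ :=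
  deriv (fun t => u (X.1, t)) X.2

/-- The value `Lu(X)` of the nondivergence parabolic operator with coefficients `a`. -/
def LVal {n : ℕ} (a : E n × ℝ → Fin n → Fin n → ℝ) (u : E n × ℝ → ℝ) (X : E n × ℝ) : ℝ :=
  (∑ i, ∑ j, a X i j * D2 u X i j) - Dt u X

/-- `u` is C² in `x` and C¹ in `t` at every point of `V`. -/
def ParabolicSmoothOn {n : ℕ} (u : E n × ℝ → ℝ) (V : Set (E n × ℝ)) : Prop :=
  ∀ X ∈ V, ContDiffAt ℝ 2 (fun x => u (x, X.2)) X.1 ∧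
    DifferentiableAt ℝ (fun t => u (X.1, t)) X.2

/-- `u` solves `Lu = 0` pointwise in `V` (being C² in `x`, C¹ in `t` there). -/
def SolvesL {n : ℕ} (a : E n × ℝ → Fin n → Fin n → ℝ) (u : E n × ℝ → ℝ)
    (V : Set (E n × ℝ)) : Prop :=
  ParabolicSmoothOn u V ∧ ∀ X ∈ V, LVal a u X = 0

/-- `a` is a smooth coefficient matrix on `S`, uniformly elliptic with constant `ν`
and with entries bounded by `ν⁻¹`. -/
def IsParabolicCoeff {n : ℕ} (ν : ℝ) (a : E n × ℝ → Fin n → Fin n → ℝ)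
    (S : Set (E n × ℝ)) : Prop :=
  (∀ i j, ContDiffOn ℝ (⊤ : ℕ∞) (fun X => a X i j) S) ∧
  ∀ X ∈ S, (∀ ξ : Fin n → ℝ, ν * ∑ i, ξ i ^ 2 ≤ ∑ i, ∑ j, a X i j * ξ i * ξ j) ∧
    ∀ i j, |a X i j| ≤ ν⁻¹

/-- The cylinder `Ω × (t₀, ∞)`. -/
def CylFrom {n : ℕ} (Ω : Set (E n)) (t₀ : ℝ) : Set (E n × ℝ) := Ω ×ˢ Ioi t₀

/-- The cylinder `Q = Ω × (0, ∞)`. -/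
def Cyl {n : ℕ} (Ω : Set (E n)) : Set (E n × ℝ) := CylFrom Ω 0

/-- Parabolic boundary of the cylinder `Ω × (t₀, ∞)`:
`(∂Ω × (t₀,∞)) ∪ (cl(Ω) × {t₀})`. -/
def pBFrom {n : ℕ} (Ω : Set (E n)) (t₀ : ℝ) : Set (E n × ℝ) :=
  (frontier Ω ×ˢ Ioi t₀) ∪ (closure Ω ×ˢ {t₀})

/-- Parabolic boundary of `Ω × (0, ∞)`. -/
def pB {n : ℕ} (Ω : Set (E n)) : Set (E n × ℝ) := pBFrom Ω 0

/-- The cylinder `C_{R,r}(Y) = B_R(y) × (s - r², s + r²)`. -/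
def CRr {n : ℕ} (Y : E n × ℝ) (R r : ℝ) : Set (E n × ℝ) :=
  ball Y.1 R ×ˢ Ioo (Y.2 - r ^ 2) (Y.2 + r ^ 2)

/-- The standard cylinder `C_r(Y) = B_r(y) × (s - r², s + r²)`. -/
def Cr {n : ℕ} (Y : E n × ℝ) (r : ℝ) : Set (E n × ℝ) := CRr Y r r

/-- `ω` is the `L`-caloric measure family for the cylinder `Ω × (t₀, ∞)`:
each `ω X` is a Borel probability measure on the parabolic boundary, and for every
bounded continuous `φ`, `X ↦ ∫ φ dω^X` is a (bounded) solution of `Lu = 0` in the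
cylinder extending continuously to `φ` at each point of the parabolic boundary. -/
def IsCaloricMeasureFrom {n : ℕ} (a : E n × ℝ → Fin n → Fin n → ℝ) (Ω : Set (E n))
    (t₀ : ℝ) (ω : E n × ℝ → Measure (E n × ℝ)) : Prop :=
  (∀ X ∈ CylFrom Ω t₀, IsProbabilityMeasure (ω X) ∧ ω X (pBFrom Ω t₀)ᶜ = 0) ∧
  ∀ φ : E n × ℝ → ℝ, Continuous φ → (∃ M, ∀ z, |φ z| ≤ M) →
    SolvesL a (fun X => ∫ z, φ z ∂ω X) (CylFrom Ω t₀) ∧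
    ∀ Z ∈ pBFrom Ω t₀, Tendsto (fun X => ∫ z, φ z ∂ω X)
      (nhdsWithin Z (CylFrom Ω t₀)) (nhds (φ Z))

/-- `ω` is the `L`-caloric measure family for `Q = Ω × (0, ∞)`. -/
def IsCaloricMeasure {n : ℕ} (a : E n × ℝ → Fin n → Fin n → ℝ) (Ω : Set (E n))
    (ω : E n × ℝ → Measure (E n × ℝ)) : Prop :=
  IsCaloricMeasureFrom a Ω 0 ω

/-- `Ω` is a Lipschitz domain with constants `m, r₀ > 0`: it is a nonempty open
connected set and near each boundary point, in a suitable orthonormal coordinate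
system centered at that point, it coincides with the region above the graph of a
function with `‖∇φ‖_{L^∞} ≤ m` (equivalently, `m`-Lipschitz). -/
def IsLipschitzDomain {n : ℕ} (hn : 0 < n) (Ω : Set (E n)) (m r₀ : ℝ) : Prop :=
  IsOpen Ω ∧ Ω.Nonempty ∧ IsConnected Ω ∧ 0 < m ∧ 0 < r₀ ∧
  ∀ y ∈ frontier Ω, ∃ (T : E n ≃ₗᵢ[ℝ] E n) (φ : E (n - 1) → ℝ),
    LipschitzWith m.toNNReal φ ∧
    ∀ x : E n, x ∈ Ω ∩ ball y r₀ ↔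
      ‖x - y‖ < r₀ ∧
        φ ((EuclideanSpace.equiv (Fin (n - 1)) ℝ).symm
            (fun i => T (x - y) (Fin.castLE (Nat.sub_le n 1) i))) <
          T (x - y) ⟨n - 1, Nat.sub_lt hn Nat.one_pos⟩

/-- The set `Ω^δ = {x ∈ Ω : dist(x, ∂Ω) > δ}`. -/
def innerSet {n : ℕ} (Ω : Set (E n)) (δ : ℝ) : Set (E n) :=
  {x ∈ Ω | δ < infDist x (frontier Ω)}

/-- The corkscrew property (2.3) with constant `μ`. -/
def Corkscrew {n : ℕ} (Ω : Set (E n)) (r₀ μ : ℝ) : Prop :=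
  ∀ y ∈ frontier Ω, ∀ r : ℝ, 0 < r → r < r₀ →
    (∃ y₁ : E n, ball y₁ (2 * μ * r) ⊆ ball y r ∩ Ω) ∧
    (∃ y₂ : E n, ball y₂ (2 * μ * r) ⊆ ball y r \ Ω)

open MeasureTheory Set Metric Filter
noncomputable section

/-- Uniformly elliptic constant matrices. -/
def Ell {n : ℕ} (ν : ℝ) (A : Fin n → Fin n → ℝ) : Prop :=
  (∀ ξ : Fin n → ℝ, ν * ∑ i, ξ i ^ 2 ≤ ∑ i, ∑ j, A i j * ξ i * ξ j) ∧ ∀ i j, |A i j| ≤ ν⁻¹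

/-- Pointwise parabolic smoothness. -/
def SmAt {n : ℕ} (u : E n × ℝ → ℝ) (X : E n × ℝ) : Prop :=
  ContDiffAt ℝ 2 (fun x => u (x, X.2)) X.1 ∧ DifferentiableAt ℝ (fun t => u (X.1, t)) X.2

/-- Operator with frozen coefficient matrix. -/
def Lop {n : ℕ} (A : Fin n → Fin n → ℝ) (u : E n × ℝ → ℝ) (X : E n × ℝ) : ℝ :=
  (∑ i, ∑ j, A i j * D2 u X i j) - Dt u X

/-- Pointwise supersolution. -/
def SupAt {n : ℕ} (ν : ℝ) (u : E n × ℝ → ℝ) (X : E n × ℝ) : Prop :=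
  SmAt u X ∧ ∃ A, Ell ν A ∧ Lop A u X ≤ 0

/-- Pointwise subsolution. -/
def SubAt {n : ℕ} (ν : ℝ) (u : E n × ℝ → ℝ) (X : E n × ℝ) : Prop :=
  SmAt u X ∧ ∃ A, Ell ν A ∧ 0 ≤ Lop A u X

variable {n : ℕ}

theorem diffAt_fderiv {f : E n → ℝ} {x : E n} (hf : ContDiffAt ℝ 2 f x) :
    DifferentiableAt ℝ (fderiv ℝ f) x :=
  (hf.fderiv_right (m := 1) (by norm_num)).differentiableAt (by norm_num)

theorem D2_eq {u : E n × ℝ → ℝ} {X : E n × ℝ} (h : SmAt u X) (i j : Fin n) :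
    D2 u X i j = fderiv ℝ (fderiv ℝ (fun x => u (x, X.2))) X.1 (EuclideanSpace.single i 1)
      (EuclideanSpace.single j 1) := by
  unfold D2
  have h1 := diffAt_fderiv h.1
  rw [fderiv_clm_apply h1 (differentiableAt_const _)]
  simp

theorem D2_symm {u : E n × ℝ → ℝ} {X : E n × ℝ} (h : SmAt u X) (i j : Fin n) :
    D2 u X i j = D2 u X j i := by
  rw [D2_eq h, D2_eq h]
  have := h.1.isSymmSndFDerivAt (by simp)
  exact this _ _

theorem D2_quad {u : E n × ℝ → ℝ} {X : E n × ℝ} (h : SmAt u X) (v : E n) :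
    ∑ i, ∑ j, D2 u X i j * v i * v j =
      fderiv ℝ (fderiv ℝ (fun x => u (x, X.2))) X.1 v v := by
  have hv : v = ∑ i, v i • (EuclideanSpace.single i (1:ℝ) : E n) := by
    ext k
    simp [Finset.sum_apply, Pi.single_apply]
  conv_rhs => rw [hv]
  simp only [map_sum, map_smul, _root_.sum_apply, _root_.smul_apply,
    smul_eq_mul, Finset.mul_sum, D2_eq h]
  rw [Finset.sum_comm]
  refine Finset.sum_congr rfl fun i _ => Finset.sum_congr rfl fun j _ => ?_
  ring

theorem second_order_min {f : E n → ℝ} {x : E n} (hf : ContDiffAt ℝ 2 f x)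
    (hm : IsLocalMin f x) (v : E n) : 0 ≤ fderiv ℝ (fderiv ℝ f) x v v := by
  by_contra hneg
  push Not at hneg
  let γ : ℝ → E n := fun s => x + s • v
  let g : ℝ → ℝ := fun s => f (γ s)
  have hγ : ∀ s, HasDerivAt γ v s := fun s => by
    have := ((hasDerivAt_id s).smul_const v).const_add x
    simpa [γ] using this
  have hγc : Continuous γ := by fun_prop
  have hγ0 : γ 0 = x := by simp [γ]
  have hev : ∀ᶠ y in nhds x, DifferentiableAt ℝ f y := by
    have := hf.eventually (by simp)
    filter_upwards [this] with y hy using hy.differentiableAt (by norm_num)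
  have hev2 : ∀ᶠ s in nhds (0:ℝ), DifferentiableAt ℝ f (γ s) := by
    have : Tendsto γ (nhds 0) (nhds x) := by rw [← hγ0]; exact hγc.continuousAt
    exact this.eventually hev
  have hg1 : ∀ᶠ s in nhds (0:ℝ), HasDerivAt g (fderiv ℝ f (γ s) v) s := by
    filter_upwards [hev2] with s hs
    exact hs.hasFDerivAt.comp_hasDerivAt s (hγ s)
  have hd1 : deriv g =ᶠ[nhds 0] fun s => fderiv ℝ f (γ s) v := by
    filter_upwards [hg1] with s hs using hs.deriv
  have hd2 : HasDerivAt (fun s => fderiv ℝ f (γ s) v) (fderiv ℝ (fderiv ℝ f) x v v) 0 := by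
    have h1 : HasFDerivAt (fderiv ℝ f) (fderiv ℝ (fderiv ℝ f) x) (γ 0) := by
      rw [hγ0]; exact (diffAt_fderiv hf).hasFDerivAt
    have h2 := h1.comp_hasDerivAt (0:ℝ) (hγ 0)
    have h3 := h2.clm_apply (hasDerivAt_const (0:ℝ) v)
    simpa using h3
  have hdd : deriv (deriv g) 0 = fderiv ℝ (fderiv ℝ f) x v v := by
    rw [hd1.deriv_eq]; exact hd2.deriv
  have hming : IsLocalMin g 0 := by
    have : Tendsto γ (nhds 0) (nhds x) := by rw [← hγ0]; exact hγc.continuousAt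
    have h4 := this.eventually hm
    filter_upwards [h4] with s hs
    simpa [g, hγ0] using hs
  have hd0 : deriv g 0 = 0 := hming.deriv_eq_zero
  have hmaxg : IsLocalMax g 0 :=
    isLocalMax_of_deriv_deriv_neg (by rw [hdd]; exact hneg) hd0 hg1.self_of_nhds.continuousAt
  have hconst : g =ᶠ[nhds 0] fun _ => g 0 := by
    filter_upwards [hming, hmaxg] with s h1 h2
    exact le_antisymm h2 h1
  have h5 : deriv g =ᶠ[nhds 0] fun _ => 0 := by
    have := hconst.deriv
    simpa using this
  have : deriv (deriv g) 0 = 0 := by rw [h5.deriv_eq]; simp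
  rw [hdd] at this
  linarith

theorem Ell.trace_le {ν : ℝ} {A : Fin n → Fin n → ℝ} (hA : Ell ν A) :
    ∑ i, A i i ≤ n * ν⁻¹ := by
  calc ∑ i, A i i ≤ ∑ _i : Fin n, ν⁻¹ := Finset.sum_le_sum fun i _ => (le_abs_self _).trans (hA.2 i i)
    _ = n * ν⁻¹ := by simp

theorem Ell.trace_nonneg {ν : ℝ} (hν : 0 ≤ ν) {A : Fin n → Fin n → ℝ} (hA : Ell ν A) :
    0 ≤ ∑ i, A i i := by
  refine Finset.sum_nonneg fun i _ => ?_
  have := hA.1 (Pi.single i 1)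
  simp [Pi.single_apply] at this
  linarith

theorem Ell.contract {ν : ℝ} {A : Fin n → Fin n → ℝ} (hA : Ell ν A)
    {H : Matrix (Fin n) (Fin n) ℝ} (hH : H.PosSemidef) :
    ν * H.trace ≤ ∑ i, ∑ j, A i j * H i j := by
  obtain ⟨m, w, hw⟩ := Matrix.posSemidef_iff_eq_sum_vecMulVec.mp hH
  have h1 : ∀ i j, H i j = ∑ k, w k i * w k j := by
    intro i j
    rw [hw]
    simp [Matrix.sum_apply, Matrix.vecMulVec_apply]
  have h2 : H.trace = ∑ k, ∑ i, w k i ^ 2 := by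
    simp only [Matrix.trace, Matrix.diag, h1]
    rw [Finset.sum_comm]
    simp [sq]
  have h3 : ∑ i, ∑ j, A i j * H i j = ∑ k, ∑ i, ∑ j, A i j * w k i * w k j := by
    simp only [h1, Finset.mul_sum]
    rw [show (∑ i, ∑ j, ∑ k, A i j * (w k i * w k j)) = ∑ i, ∑ k, ∑ j, A i j * (w k i * w k j) from
      Finset.sum_congr rfl fun i _ => Finset.sum_comm]
    rw [Finset.sum_comm]
    simp only [mul_assoc]
  rw [h2, h3, Finset.mul_sum]
  exact Finset.sum_le_sum fun k _ => hA.1 (w k)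

theorem psd_of_quad {H : Matrix (Fin n) (Fin n) ℝ} (hs : ∀ i j, H i j = H j i)
    (hq : ∀ v : E n, 0 ≤ ∑ i, ∑ j, H i j * v i * v j) : H.PosSemidef := by
  rw [Matrix.posSemidef_iff_dotProduct_mulVec]
  refine ⟨?_, fun x => ?_⟩
  · ext i j; simp [Matrix.conjTranspose_apply, hs j i]
  · have := hq (WithLp.toLp 2 x)
    simp only [dotProduct, Matrix.mulVec, Finset.mul_sum] at *
    simp only [star_trivial, Pi.star_apply]
    calc (0:ℝ) ≤ _ := this
      _ = _ := Finset.sum_congr rfl fun i _ => Finset.sum_congr rfl fun j _ => by ring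

theorem det_le_of_psd {H : Matrix (Fin n) (Fin n) ℝ} (hH : H.PosSemidef) {C : ℝ}
    (hC : H.trace ≤ C) : |H.det| ≤ C ^ n := by
  have hd := hH.isHermitian.det_eq_prod_eigenvalues
  have ht := hH.isHermitian.trace_eq_sum_eigenvalues
  simp only [RCLike.ofReal_real_eq_id, id] at hd ht
  have hp : ∀ i, 0 ≤ hH.isHermitian.eigenvalues i := hH.eigenvalues_nonneg
  have h1 : ∀ i, hH.isHermitian.eigenvalues i ≤ C := fun i => by
    refine le_trans ?_ hC
    rw [ht]
    exact Finset.single_le_sum (fun j _ => hp j) (Finset.mem_univ i)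
  rw [hd, abs_of_nonneg (Finset.prod_nonneg fun i _ => hp i)]
  calc _ ≤ ∏ _i : Fin n, C := Finset.prod_le_prod (fun i _ => hp i) fun i _ => h1 i
    _ = C ^ n := by simp

theorem SmAt.sub {u w : E n × ℝ → ℝ} {X : E n × ℝ} (hu : SmAt u X) (hw : SmAt w X) :
    SmAt (fun Y => u Y - w Y) X := ⟨hu.1.sub hw.1, hu.2.sub hw.2⟩

theorem SmAt.const_mul {u : E n × ℝ → ℝ} {X : E n × ℝ} (hu : SmAt u X) (c : ℝ) :
    SmAt (fun Y => c * u Y) X := ⟨contDiffAt_const.mul hu.1, hu.2.const_mul c⟩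

theorem SmAt.const_sub {u : E n × ℝ → ℝ} {X : E n × ℝ} (hu : SmAt u X) (c : ℝ) :
    SmAt (fun Y => c - u Y) X := ⟨contDiffAt_const.sub hu.1, hu.2.const_sub c⟩

theorem Dt_sub {u w : E n × ℝ → ℝ} {X : E n × ℝ} (hu : SmAt u X) (hw : SmAt w X) :
    Dt (fun Y => u Y - w Y) X = Dt u X - Dt w X := by
  unfold Dt
  exact deriv_fun_sub hu.2 hw.2

theorem D2_sub {u w : E n × ℝ → ℝ} {X : E n × ℝ} (hu : SmAt u X) (hw : SmAt w X) (i j : Fin n) :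
    D2 (fun Y => u Y - w Y) X i j = D2 u X i j - D2 w X i j := by
  rw [D2_eq hu, D2_eq hw, D2_eq (hu.sub hw)]
  have h1 : fderiv ℝ (fun x => u (x, X.2) - w (x, X.2)) =ᶠ[nhds X.1]
      fun x => fderiv ℝ (fun x => u (x, X.2)) x - fderiv ℝ (fun x => w (x, X.2)) x := by
    filter_upwards [hu.1.eventually (by simp), hw.1.eventually (by simp)] with y h1 h2
    exact fderiv_fun_sub (h1.differentiableAt (by norm_num)) (h2.differentiableAt (by norm_num))
  rw [h1.fderiv_eq, fderiv_fun_sub (diffAt_fderiv hu.1) (diffAt_fderiv hw.1)]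
  rfl

theorem Dt_const_mul {u : E n × ℝ → ℝ} {X : E n × ℝ} (hu : SmAt u X) (c : ℝ) :
    Dt (fun Y => c * u Y) X = c * Dt u X := by
  unfold Dt
  exact deriv_const_mul c hu.2

theorem D2_const_mul {u : E n × ℝ → ℝ} {X : E n × ℝ} (hu : SmAt u X) (c : ℝ) (i j : Fin n) :
    D2 (fun Y => c * u Y) X i j = c * D2 u X i j := by
  rw [D2_eq hu, D2_eq (hu.const_mul c)]
  have h1 : fderiv ℝ (fun x => c * u (x, X.2)) =ᶠ[nhds X.1]
      fun x => c • fderiv ℝ (fun x => u (x, X.2)) x := by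
    filter_upwards [hu.1.eventually (by simp)] with y h1
    exact fderiv_const_mul (h1.differentiableAt (by norm_num)) c
  rw [h1.fderiv_eq, fderiv_fun_const_smul (diffAt_fderiv hu.1)]
  rfl

theorem D2_timefun (g : ℝ → ℝ) (X : E n × ℝ) (i j : Fin n) :
    D2 (fun Y => g Y.2) X i j = 0 := by
  unfold D2
  simp

theorem Lop_sub {A : Fin n → Fin n → ℝ} {u w : E n × ℝ → ℝ} {X : E n × ℝ} (hu : SmAt u X)
    (hw : SmAt w X) : Lop A (fun Y => u Y - w Y) X = Lop A u X - Lop A w X := by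
  unfold Lop
  simp only [D2_sub hu hw, Dt_sub hu hw, mul_sub, Finset.sum_sub_distrib]
  ring

theorem Lop_const_mul {A : Fin n → Fin n → ℝ} {u : E n × ℝ → ℝ} {X : E n × ℝ} (hu : SmAt u X)
    (c : ℝ) : Lop A (fun Y => c * u Y) X = c * Lop A u X := by
  unfold Lop
  simp only [D2_const_mul hu c, Dt_const_mul hu c, mul_sub, Finset.mul_sum]
  congr 1
  refine Finset.sum_congr rfl fun i _ => Finset.sum_congr rfl fun j _ => by ring

theorem smAt_time {g : ℝ → ℝ} {X : E n × ℝ} (hg : DifferentiableAt ℝ g X.2) :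
    SmAt (fun Y : E n × ℝ => g Y.2) X := ⟨(contDiffAt_const : ContDiffAt ℝ 2 (fun _ : E n => g X.2) X.1), hg⟩

theorem Lop_time {A : Fin n → Fin n → ℝ} (g : ℝ → ℝ) (X : E n × ℝ) :
    Lop A (fun Y : E n × ℝ => g Y.2) X = - deriv g X.2 := by
  unfold Lop
  simp only [D2_timefun, mul_zero, Finset.sum_const_zero, Dt]
  ring

theorem SupAt.const_mul {ν : ℝ} {u : E n × ℝ → ℝ} {X : E n × ℝ} (hu : SupAt ν u X) {c : ℝ}
    (hc : 0 ≤ c) : SupAt ν (fun Y => c * u Y) X := by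
  obtain ⟨h1, A, hA, h2⟩ := hu
  exact ⟨h1.const_mul c, A, hA, by rw [Lop_const_mul h1]; exact mul_nonpos_of_nonneg_of_nonpos hc h2⟩

theorem SubAt.const_sub {ν : ℝ} {u : E n × ℝ → ℝ} {X : E n × ℝ} (hu : SubAt ν u X) (c : ℝ) :
    SupAt ν (fun Y => c - u Y) X := by
  obtain ⟨h1, A, hA, h2⟩ := hu
  refine ⟨h1.const_sub c, A, hA, ?_⟩
  have h3 : SmAt (fun _ : E n × ℝ => c) X := smAt_time (g := fun _ => c) (by fun_prop)
  rw [Lop_sub h3 h1, Lop_time (fun _ => c)]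
  simp [h2]

end

open MeasureTheory Set Metric Filter
noncomputable section
variable {n : ℕ}

theorem deriv_nonneg_of_left_max {g : ℝ → ℝ} {t : ℝ} (hg : DifferentiableAt ℝ g t)
    (h : ∀ᶠ s in nhdsWithin t (Iio t), g s ≤ g t) : 0 ≤ deriv g t := by
  have h1 := hg.hasDerivAt.hasDerivWithinAt (s := Iio t)
  rw [hasDerivWithinAt_iff_tendsto_slope' (by simp)] at h1
  refine ge_of_tendsto h1 ?_
  filter_upwards [h, self_mem_nhdsWithin] with s hs hst
  rw [slope_def_field]
  have : s < t := hst
  exact div_nonneg_of_nonpos (by linarith) (by linarith)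

/-- Maximum principle, strict version. -/
theorem max_principle {ν : ℝ} (hν : 0 ≤ ν) {K : Set (E n × ℝ)} (hK : IsCompact K) {w : E n × ℝ → ℝ}
    (hw : ContinuousOn w K)
    (h : ∀ X ∈ K, 0 < w X → (∀ᶠ Y in nhds X, Y.2 ≤ X.2 → Y ∈ K) ∧ SmAt w X ∧
      ∃ A, Ell ν A ∧ 0 < Lop A w X) : ∀ X ∈ K, w X ≤ 0 := by
  intro X0 hX0
  by_contra hpos
  push Not at hpos
  obtain ⟨X, hXK, hmax⟩ := hK.exists_isMaxOn ⟨X0, hX0⟩ hw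
  have hX : 0 < w X := hpos.trans_le (hmax hX0)
  obtain ⟨hev, hsm, A, hA, hL⟩ := h X hXK hX
  have hx : IsLocalMax (fun x => w (x, X.2)) X.1 := by
    have hc : Tendsto (fun x : E n => ((x, X.2) : E n × ℝ)) (nhds X.1) (nhds X) := by
      have : Continuous (fun x : E n => ((x, X.2) : E n × ℝ)) := by fun_prop
      exact this.continuousAt
    filter_upwards [hc.eventually hev] with y hy
    exact hmax (hy le_rfl)
  have ht : 0 ≤ Dt w X := by
    refine deriv_nonneg_of_left_max hsm.2 ?_
    have hc : Tendsto (fun t : ℝ => ((X.1, t) : E n × ℝ)) (nhds X.2) (nhds X) := by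
      have : Continuous (fun t : ℝ => ((X.1, t) : E n × ℝ)) := by fun_prop
      exact this.continuousAt
    filter_upwards [nhdsWithin_le_nhds (hc.eventually hev), self_mem_nhdsWithin] with s hs hst
    exact hmax (hs (le_of_lt hst))
  have hsm' : SmAt (fun Y => (-1) * w Y) X := hsm.const_mul (-1)
  have hmin : IsLocalMin (fun x => (-1) * w (x, X.2)) X.1 := by
    filter_upwards [hx] with y hy
    simpa using hy
  have hq : ∀ v : E n, 0 ≤ ∑ i, ∑ j, D2 (fun Y => (-1) * w Y) X i j * v i * v j := fun v => by
    rw [D2_quad hsm']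
    exact second_order_min hsm'.1 hmin v
  have hpsd : (Matrix.of fun i j => D2 (fun Y => (-1) * w Y) X i j).PosSemidef :=
    psd_of_quad (fun i j => D2_symm hsm' i j) hq
  have h1 := hA.contract hpsd
  have h2 : 0 ≤ ν * (Matrix.of fun i j => D2 (fun Y => (-1) * w Y) X i j).trace :=
    mul_nonneg hν hpsd.trace_nonneg
  have h3 : ∑ i, ∑ j, A i j * (Matrix.of fun i j => D2 (fun Y => (-1) * w Y) X i j) i j =
      - ∑ i, ∑ j, A i j * D2 w X i j := by
    simp only [Matrix.of_apply, D2_const_mul hsm, ← Finset.sum_neg_distrib]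
    refine Finset.sum_congr rfl fun i _ => Finset.sum_congr rfl fun j _ => by ring
  unfold Lop at hL
  linarith

/-- Hessian of a radial function. -/
theorem D2_radial {f : ℝ → ℝ → ℝ} (z : E n) (X : E n × ℝ)
    (hf : ContDiffAt ℝ 2 (fun s => f s X.2) (‖X.1 - z‖ ^ 2)) (i j : Fin n) :
    D2 (fun Y : E n × ℝ => f (‖Y.1 - z‖ ^ 2) Y.2) X i j =
      4 * deriv (deriv (fun s => f s X.2)) (‖X.1 - z‖ ^ 2) * ((X.1 - z) i * (X.1 - z) j)
      + 2 * deriv (fun s => f s X.2) (‖X.1 - z‖ ^ 2) * (if i = j then 1 else 0) := by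
  set g : ℝ → ℝ := fun s => f s X.2 with hg
  have hN : ∀ x : E n, HasFDerivAt (fun x : E n => ‖x - z‖ ^ 2) (2 • (innerSL ℝ (x - z))) x := by
    intro x
    have := ((hasFDerivAt_id x).sub_const z).norm_sq
    simpa using this
  have hNc : Continuous (fun x : E n => ‖x - z‖ ^ 2) := by fun_prop
  have hev : ∀ᶠ s in nhds (‖X.1 - z‖ ^ 2), DifferentiableAt ℝ g s := by
    filter_upwards [hf.eventually (by simp)] with s hs using hs.differentiableAt (by norm_num)
  have hev2 := (hNc.continuousAt (x := X.1)).eventually hev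
  have h1 : (fun x => fderiv ℝ (fun x' : E n => g (‖x' - z‖ ^ 2)) x (EuclideanSpace.single j 1))
      =ᶠ[nhds X.1] fun x => deriv g (‖x - z‖ ^ 2) * (2 * (x - z) j) := by
    filter_upwards [hev2] with x hx
    have := (hx.hasDerivAt.comp_hasFDerivAt x (hN x)).fderiv
    have h2 : fderiv ℝ (fun x' : E n => g (‖x' - z‖ ^ 2)) x = deriv g (‖x - z‖ ^ 2) • (2 • (innerSL ℝ (x - z))) := this
    rw [h2]
    simp [EuclideanSpace.inner_single_right]
  unfold D2
  rw [h1.fderiv_eq]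
  have hd2 : DifferentiableAt ℝ (deriv g) (‖X.1 - z‖ ^ 2) := by
    have h7 : ContDiffAt ℝ 1 (fderiv ℝ g) (‖X.1 - z‖ ^ 2) := hf.fderiv_right (by norm_num)
    have h8 : DifferentiableAt ℝ (fun s => fderiv ℝ g s 1) (‖X.1 - z‖ ^ 2) :=
      (h7.differentiableAt (by norm_num)).clm_apply (differentiableAt_const _)
    have h9 : deriv g = fun s => fderiv ℝ g s 1 := by
      funext s; exact fderiv_apply_one_eq_deriv.symm
    rw [h9]; exact h8
  have h3 := hd2.hasDerivAt.comp_hasFDerivAt X.1 (hN X.1)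
  have h4 : HasFDerivAt (fun x : E n => 2 * (x - z) j) ((2 : ℝ) • (EuclideanSpace.proj j : E n →L[ℝ] ℝ)) X.1 := by
    have := (((EuclideanSpace.proj j : E n →L[ℝ] ℝ).hasFDerivAt (x := X.1)).sub_const (z j)).const_mul 2
    simpa using this
  have h5 := h3.mul h4
  have h6 := h5.fderiv
  simp only [Function.comp_def] at h6
  erw [h6]
  simp [EuclideanSpace.inner_single_right, Pi.single_apply]
  by_cases hij : i = j
  · subst hij; simp; ring
  · simp [hij, Ne.symm hij]; ring

theorem smAt_radial {f : ℝ → ℝ → ℝ} (z : E n) (X : E n × ℝ)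
    (hf : ContDiffAt ℝ 2 (fun s => f s X.2) (‖X.1 - z‖ ^ 2))
    (ht : DifferentiableAt ℝ (fun t => f (‖X.1 - z‖ ^ 2) t) X.2) :
    SmAt (fun Y : E n × ℝ => f (‖Y.1 - z‖ ^ 2) Y.2) X := by
  refine ⟨?_, ht⟩
  have h1 : ContDiffAt ℝ 2 (fun x : E n => ‖x - z‖ ^ 2) X.1 := by
    apply ContDiff.contDiffAt
    exact (contDiff_id.sub contDiff_const).norm_sq ℝ
  exact ContDiffAt.comp X.1 (g := fun s => f s X.2) hf h1

theorem Lop_radial {f : ℝ → ℝ → ℝ} (A : Fin n → Fin n → ℝ) (z : E n) (X : E n × ℝ)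
    (hf : ContDiffAt ℝ 2 (fun s => f s X.2) (‖X.1 - z‖ ^ 2)) :
    Lop A (fun Y : E n × ℝ => f (‖Y.1 - z‖ ^ 2) Y.2) X =
      4 * deriv (deriv (fun s => f s X.2)) (‖X.1 - z‖ ^ 2) *
        (∑ i, ∑ j, A i j * (X.1 - z) i * (X.1 - z) j)
      + 2 * deriv (fun s => f s X.2) (‖X.1 - z‖ ^ 2) * (∑ i, A i i)
      - deriv (fun t => f (‖X.1 - z‖ ^ 2) t) X.2 := by
  unfold Lop
  simp only [D2_radial z X hf, Dt, mul_add, Finset.sum_add_distrib, Finset.mul_sum]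
  congr 2
  · refine Finset.sum_congr rfl fun i _ => Finset.sum_congr rfl fun j _ => by ring
  · refine Finset.sum_congr rfl fun i _ => ?_
    rw [Finset.sum_eq_single i]
    · simp; ring
    · intro j _ hj; simp [Ne.symm hj]
    · simp

theorem Ell.quad_ge {ν : ℝ} {A : Fin n → Fin n → ℝ} (hA : Ell ν A) (v : E n) :
    ν * ‖v‖ ^ 2 ≤ ∑ i, ∑ j, A i j * v i * v j := by
  have := hA.1 (fun i => v i)
  rwa [EuclideanSpace.norm_sq_eq, Finset.sum_congr rfl fun i _ => by rw [Real.norm_eq_abs, sq_abs]]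

theorem Ell.quad_le {ν : ℝ} (hν : 0 < ν) {A : Fin n → Fin n → ℝ} (hA : Ell ν A) (v : E n) :
    ∑ i, ∑ j, A i j * v i * v j ≤ n * ν⁻¹ * ‖v‖ ^ 2 := by
  have hn : ‖v‖ ^ 2 = ∑ i, v i ^ 2 := by
    rw [EuclideanSpace.norm_sq_eq]
    exact Finset.sum_congr rfl fun i _ => by rw [Real.norm_eq_abs, sq_abs]
  have h0 : 0 < ν⁻¹ := inv_pos.mpr hν
  calc ∑ i, ∑ j, A i j * v i * v j ≤ ∑ i, ∑ j, ν⁻¹ * ((v i ^ 2 + v j ^ 2) / 2) := by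
        refine Finset.sum_le_sum fun i _ => Finset.sum_le_sum fun j _ => ?_
        have h1 := hA.2 i j
        calc A i j * v i * v j ≤ |A i j * v i * v j| := le_abs_self _
          _ = |A i j| * |v i * v j| := by rw [mul_assoc, abs_mul]
          _ ≤ ν⁻¹ * ((v i ^ 2 + v j ^ 2) / 2) := by
              refine mul_le_mul h1 ?_ (abs_nonneg _) h0.le
              rw [abs_le]; constructor <;> nlinarith [sq_nonneg (v i - v j), sq_nonneg (v i + v j)]
    _ = n * ν⁻¹ * ‖v‖ ^ 2 := by
        rw [hn]
        simp only [← Finset.mul_sum, ← Finset.sum_div, Finset.sum_add_distrib, Finset.sum_const,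
          Finset.card_univ, Fintype.card_fin, nsmul_eq_mul]
        ring
end

open MeasureTheory Set Metric Filter
noncomputable section
variable {n : ℕ}

theorem le_of_forall_eps {a K V : ℝ} (h : ∀ ε > 0, a ≤ (K + ε) * (V + ε)) : a ≤ K * V := by
  have hc : Tendsto (fun ε : ℝ => (K + ε) * (V + ε)) (nhdsWithin 0 (Ioi 0)) (nhds (K * V)) := by
    have : Continuous (fun ε : ℝ => (K + ε) * (V + ε)) := by fun_prop
    have h2 := (this.tendsto 0).mono_left (nhdsWithin_le_nhds (s := Ioi 0))
    simpa using h2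
  refine ge_of_tendsto hc ?_
  filter_upwards [self_mem_nhdsWithin] with ε hε using h ε hε

/-- One-dimensional record-time lemma. -/
theorem record_measure {v : ℝ → ℝ} {α β c K : ℝ} (hab : α ≤ β) (hv : ContinuousOn v (Icc α β))
    (hc : c ≤ v α) (hK : 0 ≤ K) {S : Set ℝ} (hSI : S ⊆ Icc α β)
    (hS : ∀ t ∈ Icc α β, v t < c → (∀ t' ∈ Icc α t, v t ≤ v t') → t ∈ S)
    (hd : ∀ t ∈ S, ∀ K' > K, ∀ᶠ t' in nhdsWithin t (Iio t), v t' ≤ v t + K' * (t - t')) :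
    c - v β ≤ K * volume.real S := by
  have hSfin : volume S ≠ ⊤ := ((measure_mono hSI).trans_lt measure_Icc_lt_top).ne
  refine le_of_forall_eps fun ε hε => ?_
  obtain ⟨U, hSU, hUo, hU⟩ := S.exists_isOpen_lt_add (μ := volume) hSfin
    (ε := ENNReal.ofReal ε) (by simpa using hε)
  have hUr : volume.real U ≤ volume.real S + ε := by
    have h1 := ENNReal.toReal_mono (ENNReal.add_ne_top.2 ⟨hSfin, ENNReal.ofReal_ne_top⟩) hU.le
    rwa [ENNReal.toReal_add hSfin ENNReal.ofReal_ne_top, ENNReal.toReal_ofReal hε.le] at h1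
  have hUfin : volume U ≠ ⊤ := (hU.trans_le le_top).ne
  set m : ℝ → ℝ := fun t => volume.real (U ∩ Ioc α t) with hm
  have hmadd : ∀ s t, α ≤ s → s ≤ t → m t = m s + volume.real (U ∩ Ioc s t) := by
    intro s t hs hst
    rw [hm]
    simp only
    rw [← measureReal_union]
    · rw [← inter_union_distrib_left, Ioc_union_Ioc_eq_Ioc hs hst]
    · exact (Ioc_disjoint_Ioc_of_le le_rfl).mono inter_subset_right inter_subset_right
    · exact hUo.measurableSet.inter measurableSet_Ioc
  have hmle : ∀ s t : ℝ, s ≤ t → volume.real (U ∩ Ioc s t) ≤ t - s := by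
    intro s t hst
    have := measureReal_mono (μ := volume) (s₁ := U ∩ Ioc s t) (s₂ := Ioc s t) inter_subset_right
      measure_Ioc_lt_top.ne
    rwa [Real.volume_real_Ioc_of_le hst] at this
  have hmc : ContinuousOn m (Icc α β) := by
    have : LipschitzOnWith 1 m (Icc α β) := by
      refine LipschitzOnWith.of_le_add fun s hs t ht => ?_
      rw [Real.dist_eq]
      rcases le_total s t with h | h
      · have := hmadd s t hs.1 h
        have h3 : 0 ≤ volume.real (U ∩ Ioc s t) := measureReal_nonneg
        have := abs_nonneg (s - t)
        linarith
      · have := hmadd t s ht.1 h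
        have h3 := hmle t s h
        have := le_abs_self (s - t)
        linarith
    exact this.continuousOn
  set H : ℝ → ℝ := fun t => v t + (K + ε) * m t with hH
  have hHc : ContinuousOn H (Icc α β) := hv.add (continuousOn_const.mul hmc)
  have hmβ : m β ≤ volume.real U := measureReal_mono inter_subset_left hUfin
  suffices hfin : c ≤ H β by
    have h1 : (K + ε) * m β ≤ (K + ε) * (volume.real S + ε) := by gcongr; linarith
    simp only [hH] at hfin
    linarith
  by_contra hlt
  push Not at hlt
  have hcl : IsCompact (Icc α β ∩ H ⁻¹' Iic (H β)) :=
    isCompact_Icc.of_isClosed_subset (hHc.preimage_isClosed_of_isClosed isClosed_Icc isClosed_Iic)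
      inter_subset_left
  obtain ⟨t0, ht0, hmin⟩ := hcl.exists_isLeast ⟨β, ⟨hab, le_rfl⟩, by simp⟩
  have ht0H : H t0 ≤ H β := ht0.2
  have hmα : m α = 0 := by simp [hm]
  have hαlt : α < t0 := by
    rcases ht0.1.1.eq_or_lt with h | h
    · rw [← h] at ht0H
      simp only [hH] at ht0H hlt
      rw [hmα] at ht0H
      linarith
    · exact h
  have hbef : ∀ t' ∈ Ico α t0, H t0 < H t' := by
    intro t' ht'
    by_contra hcon
    push Not at hcon
    have := hmin ⟨⟨ht'.1, ht'.2.le.trans ht0.1.2⟩, hcon.trans ht0H⟩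
    linarith [ht'.2]
  have hm0 : 0 ≤ m t0 := measureReal_nonneg
  have hε' : 0 < K + ε := by linarith
  have ht0S : t0 ∈ S := by
    refine hS t0 ht0.1 ?_ ?_
    · have : 0 ≤ (K + ε) * m t0 := by positivity
      simp only [hH] at ht0H hlt
      linarith
    · intro t' ht'
      rcases ht'.2.eq_or_lt with h | h
      · rw [h]
      · have h1 := hbef t' ⟨ht'.1, h⟩
        have h2 := hmadd t' t0 ht'.1 h.le
        have h3 : 0 ≤ volume.real (U ∩ Ioc t' t0) := measureReal_nonneg
        have h4 : (K + ε) * m t' ≤ (K + ε) * m t0 := by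
          apply mul_le_mul_of_nonneg_left _ hε'.le; linarith
        simp only [hH] at h1
        linarith
  obtain ⟨l, hl, hlU⟩ := mem_nhdsLE_iff_exists_Ioc_subset.1
    (mem_nhdsWithin_of_mem_nhds (t := Iic t0) (hUo.mem_nhds (hSU ht0S)))
  have hev : ∀ᶠ t' in nhdsWithin t0 (Iio t0), t' ∈ Ioo (max l α) t0 :=
    Ioo_mem_nhdsLT (max_lt hl hαlt)
  obtain ⟨t', h1, h2⟩ := ((hd t0 ht0S (K + ε) (by linarith)).and hev).exists
  have hl' : l < t' := (le_max_left _ _).trans_lt h2.1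
  have hα' : α < t' := (le_max_right _ _).trans_lt h2.1
  have h3 := hmadd t' t0 hα'.le h2.2.le
  have h4 : U ∩ Ioc t' t0 = Ioc t' t0 := by
    apply inter_eq_right.2
    exact (Ioc_subset_Ioc_left hl'.le).trans hlU
  rw [h4, Real.volume_real_Ioc_of_le h2.2.le] at h3
  have h5 := hbef t' ⟨hα'.le, h2.2⟩
  simp only [hH] at h5
  rw [h3] at h5
  nlinarith
end

open MeasureTheory Set Metric Filter
noncomputable section
variable {n : ℕ}

/-- The map sending a contact point to the paraboloid vertex. -/
def PhiA (r : ℝ) (g : E n → ℝ) (x : E n) : E n :=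
  WithLp.toLp 2 (fun i => x i + r ^ 2 / 8 * fderiv ℝ g x (EuclideanSpace.single i 1))

theorem phi_diff {u : E n × ℝ → ℝ} {X : E n × ℝ} (h : SmAt u X) (r : ℝ) :
    DifferentiableAt ℝ (PhiA r (fun x => u (x, X.2))) X.1 ∧
    (fderiv ℝ (PhiA r (fun x => u (x, X.2))) X.1).det =
      (Matrix.of fun i j => (if i = j then 1 else 0) + r ^ 2 / 8 * D2 u X j i).det := by
  have hc : ∀ i : Fin n, DifferentiableAt ℝ (fun x : E n => fderiv ℝ (fun x => u (x, X.2)) x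
      (EuclideanSpace.single i 1)) X.1 := fun i =>
    (diffAt_fderiv h.1).clm_apply (differentiableAt_const _)
  have hci : ∀ i : Fin n, DifferentiableAt ℝ (fun x : E n => x i) X.1 := fun i =>
    (EuclideanSpace.proj i : E n →L[ℝ] ℝ).differentiableAt
  have hd : DifferentiableAt ℝ (PhiA r (fun x => u (x, X.2))) X.1 := by
    rw [differentiableAt_euclidean]
    intro i
    exact (hci i).add ((hc i).const_mul _)
  refine ⟨hd, ?_⟩
  have hent : ∀ i j, (fderiv ℝ (PhiA r (fun x => u (x, X.2))) X.1 (EuclideanSpace.single j 1)) i =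
      (if i = j then 1 else 0) + r ^ 2 / 8 * D2 u X j i := by
    intro i j
    have h1 : HasFDerivAt (fun x => PhiA r (fun x => u (x, X.2)) x i)
        ((EuclideanSpace.proj i : E n →L[ℝ] ℝ) ∘L fderiv ℝ (PhiA r (fun x => u (x, X.2))) X.1) X.1 :=
      (EuclideanSpace.proj i : E n →L[ℝ] ℝ).hasFDerivAt.comp X.1 hd.hasFDerivAt
    have h2 : HasFDerivAt (fun x => PhiA r (fun x => u (x, X.2)) x i)
        ((EuclideanSpace.proj i : E n →L[ℝ] ℝ) + (r ^ 2 / 8) • fderiv ℝ (fun x : E n =>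
          fderiv ℝ (fun x => u (x, X.2)) x (EuclideanSpace.single i 1)) X.1) X.1 :=
      ((EuclideanSpace.proj i : E n →L[ℝ] ℝ).hasFDerivAt (x := X.1)).add
        ((hc i).hasFDerivAt.const_mul (r ^ 2 / 8))
    have h3 := congrArg (fun L : E n →L[ℝ] ℝ => L (EuclideanSpace.single j 1)) (h1.unique h2)
    have h4 : (fderiv ℝ (PhiA r (fun x => u (x, X.2))) X.1 (EuclideanSpace.single j 1)) i =
        (EuclideanSpace.single j (1:ℝ) : E n) i + r ^ 2 / 8 * D2 u X j i := h3
    rw [h4]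
    simp [Pi.single_apply]
  unfold ContinuousLinearMap.det
  rw [← LinearMap.det_toMatrix (EuclideanSpace.basisFun (Fin n) ℝ).toBasis]
  congr 1
  ext i j
  rw [LinearMap.toMatrix_apply]
  simpa using hent i j

/-- Pointwise information at a contact point. -/
theorem contactA {ν : ℝ} (hν : 0 < ν) {u : E n × ℝ → ℝ} {X : E n × ℝ} (h : SupAt ν u X)
    {r : ℝ} (hr : 0 < r) {y : E n}
    (hx : IsLocalMin (fun x => u (x, X.2) + 4 / r ^ 2 * ‖x - y‖ ^ 2) X.1)
    (ht : ∀ᶠ s in nhdsWithin X.2 (Iio X.2),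
      u X - 9 / 32 / r ^ 2 * X.2 ≤ u (X.1, s) - 9 / 32 / r ^ 2 * s) :
    PhiA r (fun x => u (x, X.2)) X.1 = y ∧
    |(Matrix.of fun i j => (if i = j then 1 else 0) + r ^ 2 / 8 * D2 u X j i).det| ≤
      ((9 / 32 + 8 * n / ν) / (8 * ν)) ^ n ∧
    -((9 / 32 + 8 * n / ν) / r ^ 2) ≤ Dt u X - 9 / 32 / r ^ 2 := by
  obtain ⟨hs, A, hA, hL⟩ := h
  have hr2 : 0 < r ^ 2 := by positivity
  have hN : HasFDerivAt (fun x : E n => ‖x - y‖ ^ 2) (2 • (innerSL ℝ (X.1 - y))) X.1 := by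
    have := ((hasFDerivAt_id X.1).sub_const y).norm_sq
    simpa using this
  -- time derivative
  have hDt : Dt u X - 9 / 32 / r ^ 2 ≤ 0 := by
    have hg : DifferentiableAt ℝ (fun s => 9 / 32 / r ^ 2 * s - u (X.1, s)) X.2 :=
      (differentiableAt_id.const_mul _).sub hs.2
    have h1 := deriv_nonneg_of_left_max hg (by
      filter_upwards [ht] with s hs'
      simp only [Prod.mk.eta]
      linarith)
    rw [deriv_fun_sub (by fun_prop) hs.2] at h1
    have h2 : deriv (fun s : ℝ => 9 / 32 / r ^ 2 * s) X.2 = 9 / 32 / r ^ 2 := by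
      simpa using ((hasDerivAt_id X.2).const_mul (9 / 32 / r ^ 2)).deriv
    rw [h2] at h1
    unfold Dt
    linarith
  -- gradient
  have hgrad : ∀ i, fderiv ℝ (fun x => u (x, X.2)) X.1 (EuclideanSpace.single i 1) =
      - (8 / r ^ 2 * (X.1 - y) i) := by
    intro i
    have h1 := ((hs.1.differentiableAt (by norm_num)).hasFDerivAt.add
      (hN.const_mul (4 / r ^ 2)))
    have h2 := hx.hasFDerivAt_eq_zero h1
    have h3 := congrArg (fun L : E n →L[ℝ] ℝ => L (EuclideanSpace.single i 1)) h2
    simp [EuclideanSpace.inner_single_right] at h3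
    simp only [PiLp.sub_apply]
    have h4 : 4 / r ^ 2 * (2 * (X.1 i - y i)) = 8 / r ^ 2 * (X.1 i - y i) := by ring
    linarith
  -- Hessian
  let w : E n × ℝ → ℝ := fun Y => (fun (s : ℝ) (_ : ℝ) => - (4 / r ^ 2) * s) (‖Y.1 - y‖ ^ 2) Y.2
  have hlin : ContDiff ℝ 2 (fun s : ℝ => - (4 / r ^ 2) * s) := contDiff_const.mul contDiff_id
  have hwS : SmAt w X := smAt_radial (f := fun (s : ℝ) (_ : ℝ) => - (4 / r ^ 2) * s) y X
    hlin.contDiffAt (by fun_prop)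
  have hD1 : deriv (fun s : ℝ => - (4 / r ^ 2) * s) = fun _ => - (4 / r ^ 2) := by
    funext s
    simp
  have hwD : ∀ i j, D2 w X i j = - (8 / r ^ 2) * (if i = j then 1 else 0) := by
    intro i j
    have h1 := D2_radial (f := fun (s : ℝ) (_ : ℝ) => - (4 / r ^ 2) * s) y X hlin.contDiffAt i j
    rw [hD1] at h1
    simp only [deriv_const] at h1
    show D2 (fun Y : E n × ℝ => - (4 / r ^ 2) * ‖Y.1 - y‖ ^ 2) X i j = _
    rw [h1]
    ring
  have hvS : SmAt (fun Y => u Y - w Y) X := hs.sub hwS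
  have hmin : IsLocalMin (fun x => (fun Y => u Y - w Y) (x, X.2)) X.1 := by
    filter_upwards [hx] with x hx'
    simp only [w]
    linarith
  have hq : ∀ v : E n, 0 ≤ ∑ i, ∑ j, D2 (fun Y => u Y - w Y) X i j * v i * v j := fun v => by
    rw [D2_quad hvS]
    exact second_order_min hvS.1 hmin v
  have hDd : ∀ i j, D2 (fun Y => u Y - w Y) X i j =
      D2 u X i j + 8 / r ^ 2 * (if i = j then 1 else 0) := by
    intro i j
    rw [D2_sub hs hwS, hwD]; ring
  set H : Matrix (Fin n) (Fin n) ℝ := Matrix.of fun i j => D2 (fun Y => u Y - w Y) X i j with hH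
  have hpsd : H.PosSemidef := psd_of_quad (fun i j => D2_symm hvS i j) hq
  have hcon := hA.contract hpsd
  have hsum : ∑ i, ∑ j, A i j * H i j = ∑ i, ∑ j, A i j * D2 u X i j + 8 / r ^ 2 * ∑ i, A i i := by
    simp only [hH, Matrix.of_apply, hDd, mul_add, Finset.sum_add_distrib, Finset.mul_sum]
    congr 1
    refine Finset.sum_congr rfl fun i _ => ?_
    rw [Finset.sum_eq_single i]
    · simp; ring
    · intro j _ hj; simp [Ne.symm hj]
    · simp
  have htr := hA.trace_le
  have htr0 := hpsd.trace_nonneg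
  unfold Lop at hL
  have h8 : 8 / r ^ 2 * ∑ i, A i i ≤ 8 * n / ν / r ^ 2 := by
    calc 8 / r ^ 2 * ∑ i, A i i ≤ 8 / r ^ 2 * (n * ν⁻¹) := by gcongr
      _ = 8 * n / ν / r ^ 2 := by field_simp
  have hνtr : 0 ≤ ν * H.trace := by positivity
  refine ⟨?_, ?_, ?_⟩
  · ext i
    simp only [PhiA, hgrad, PiLp.sub_apply]
    field_simp
    ring
  · have hM : (Matrix.of fun i j => (if i = j then (1:ℝ) else 0) + r ^ 2 / 8 * D2 u X j i) =
        (r ^ 2 / 8) • H := by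
      ext i j
      simp only [Matrix.of_apply, Matrix.smul_apply, smul_eq_mul, hH, hDd, D2_symm hs j i]
      field_simp
      ring
    rw [hM]
    refine det_le_of_psd (hpsd.smul (by positivity)) ?_
    rw [Matrix.trace_smul, smul_eq_mul]
    have h9 : ν * H.trace ≤ (9 / 32 + 8 * n / ν) / r ^ 2 := by
      rw [add_div]; linarith
    rw [le_div_iff₀ hr2] at h9
    rw [le_div_iff₀ (by positivity)]
    linarith
  · rw [add_div]
    have : 0 ≤ 9 / 32 / r ^ 2 := by positivity
    linarith
end

open MeasureTheory Set Metric Filter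
noncomputable section
set_option maxHeartbeats 1000000
set_option linter.deprecated false
variable {n : ℕ}

theorem tietze_real {Z : Type*} [TopologicalSpace Z] [NormalSpace Z] {K : Set Z} (hK : IsClosed K)
    {u : Z → ℝ} (hu : ContinuousOn u K) : ∃ U : Z → ℝ, Continuous U ∧ ∀ x ∈ K, U x = u x := by
  obtain ⟨g, hg⟩ := ContinuousMap.exists_restrict_eq hK ⟨K.domRestrict u, hu.domRestrict⟩
  refine ⟨g, g.continuous, fun x hx => ?_⟩
  have := congrArg (fun f : C(K, ℝ) => f ⟨x, hx⟩) hg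
  exact this

theorem lemmaA_core {ν : ℝ} (hν : 0 < ν) {u : E n × ℝ → ℝ} {x0 x1 : E n} {t1 r : ℝ} (hr : 0 < r)
    (hc : ContinuousOn u (closedBall x0 r ×ˢ Icc (t1 - 2 * r ^ 2) t1))
    (hnn : ∀ X ∈ closedBall x0 r ×ˢ Icc (t1 - 2 * r ^ 2) t1, 0 ≤ u X)
    (hsup : ∀ X ∈ ball x0 r ×ˢ Ioc (t1 - 2 * r ^ 2) t1, SupAt ν u X)
    (hx1 : x1 ∈ closedBall x0 (r / 2)) (hu : u (x1, t1) < 1 / 4) :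
    volume (ball x1 (r / 8)) * ENNReal.ofReal (r ^ 2 / (4 * (9 / 32 + 8 * n / ν))) ≤
      ENNReal.ofReal (((9 / 32 + 8 * n / ν) / (8 * ν)) ^ n) *
        volume {X | X ∈ ball x0 r ×ˢ Ioo (t1 - 2 * r ^ 2) t1 ∧ u X ≤ 1} := by
  set τ := t1 - 2 * r ^ 2 with hτ
  set C2 : ℝ := 9 / 32 + 8 * n / ν with hC2
  have hC2p : 0 < C2 := by positivity
  have hr2 : 0 < r ^ 2 := by positivity
  obtain ⟨U, hUc, hU⟩ := tietze_real (isClosed_closedBall.prod isClosed_Icc) hc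
  have hKc : IsCompact (closedBall x0 r) := isCompact_closedBall x0 r
  have hKne : (closedBall x0 r).Nonempty := ⟨x0, mem_closedBall_self hr.le⟩
  let F : E n × ℝ → E n → ℝ := fun p x =>
    U (x, p.2) + 4 / r ^ 2 * ‖x - p.1‖ ^ 2 - 9 / 32 / r ^ 2 * (p.2 - τ)
  have hFc : Continuous (fun q : (E n × ℝ) × E n => F q.1 q.2) := by
    simp only [F]; fun_prop
  let v : E n × ℝ → ℝ := fun p => sInf (F p '' closedBall x0 r)
  have hvc : Continuous v := hKc.continuous_sInf hFc
  have hFpc : ∀ p, Continuous (F p) := fun p => by simp only [F]; fun_prop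
  have hvle : ∀ p, ∀ x ∈ closedBall x0 r, v p ≤ F p x := fun p x hx =>
    csInf_le (hKc.image (hFpc p)).bddBelow (mem_image_of_mem _ hx)
  have hvat : ∀ p, ∃ x ∈ closedBall x0 r, v p = F p x := fun p =>
    hKc.exists_sInf_image_eq hKne (hFpc p).continuousOn
  let T : Set (E n × ℝ) := {p | p.1 ∈ ball x1 (r / 8) ∧ p.2 ∈ Icc τ t1 ∧ v p < 0 ∧
    ∀ s ∈ Icc (0:ℝ) 1, v p ≤ v (p.1, τ + s * (p.2 - τ))}
  have hTm : MeasurableSet T := by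
    have h1 : MeasurableSet {p : E n × ℝ | p.1 ∈ ball x1 (r / 8)} :=
      (isOpen_ball.preimage continuous_fst).measurableSet
    have h2 : MeasurableSet {p : E n × ℝ | p.2 ∈ Icc τ t1} :=
      (isClosed_Icc.preimage continuous_snd).measurableSet
    have h3 : MeasurableSet {p : E n × ℝ | v p < 0} :=
      (isOpen_lt hvc continuous_const).measurableSet
    have h4 : MeasurableSet {p : E n × ℝ | ∀ s ∈ Icc (0:ℝ) 1, v p ≤ v (p.1, τ + s * (p.2 - τ))} := by
      have : {p : E n × ℝ | ∀ s ∈ Icc (0:ℝ) 1, v p ≤ v (p.1, τ + s * (p.2 - τ))} =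
          ⋂ s ∈ Icc (0:ℝ) 1, {p | v p ≤ v (p.1, τ + s * (p.2 - τ))} := by
        ext p; simp
      rw [this]
      refine (isClosed_biInter fun s _ => isClosed_le hvc (hvc.comp ?_)).measurableSet
      fun_prop
    exact h1.inter (h2.inter (h3.inter h4))
  have hrec : ∀ p ∈ T, ∀ t' ∈ Icc τ p.2, v p ≤ v (p.1, t') := by
    intro p hp t' ht'
    rcases hp.2.1.1.eq_or_lt with h | h
    · have : t' = p.2 := le_antisymm ht'.2 (h ▸ ht'.1)
      rw [this]
    · have h1 := hp.2.2.2 ((t' - τ) / (p.2 - τ)) ⟨div_nonneg (by linarith [ht'.1]) (by linarith),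
        (div_le_one (by linarith)).2 (by linarith [ht'.2])⟩
      rw [div_mul_cancel₀ _ (by linarith)] at h1
      simpa using h1
  have hF0 : ∀ y ∈ ball x1 (r / 8), ∀ x ∈ closedBall x0 r, 0 ≤ F (y, τ) x := by
    intro y hy x hx
    have h1 : 0 ≤ U (x, τ) := by
      have hm : (x, τ) ∈ closedBall x0 r ×ˢ Icc τ t1 := ⟨hx, le_rfl, by simp only [hτ]; linarith⟩
      rw [hU _ hm]; exact hnn _ hm
    simp only [F, sub_self, mul_zero, sub_zero]
    positivity
  -- contact
  have hcontact : ∀ p ∈ T, ∃ x ∈ ball x0 r, U (x, p.2) ≤ 1 ∧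
      SmAt u (x, p.2) ∧
      PhiA r (fun x => u (x, p.2)) x = p.1 ∧
      |(Matrix.of fun i j => (if i = j then 1 else 0) + r ^ 2 / 8 * D2 u (x, p.2) j i).det| ≤
        (C2 / (8 * ν)) ^ n ∧
      ∀ K' > C2 / r ^ 2, ∀ᶠ t' in nhdsWithin p.2 (Iio p.2), v (p.1, t') ≤ v p + K' * (p.2 - t') := by
    rintro ⟨y, t⟩ hp
    obtain ⟨hy, ht, hneg, -⟩ := id hp
    simp only at hy ht hneg ⊢
    obtain ⟨x, hx, hxv⟩ := hvat (y, t)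
    have hUx0 : 0 ≤ U (x, t) := by
      rw [hU (x, t) ⟨hx, ht⟩]; exact hnn (x, t) ⟨hx, ht⟩
    have htτ : 0 ≤ t - τ := by linarith [ht.1]
    have htτ2 : t - τ ≤ 2 * r ^ 2 := by have := ht.2; simp only [hτ]; linarith
    have hb : 9 / 32 / r ^ 2 * (t - τ) ≤ 9 / 16 := by
      calc 9 / 32 / r ^ 2 * (t - τ) ≤ 9 / 32 / r ^ 2 * (2 * r ^ 2) := by gcongr
        _ = 9 / 16 := by field_simp; norm_num
    have hFneg : F (y, t) x < 0 := hxv ▸ hneg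
    have hxb : x ∈ ball x0 r := by
      by_contra hxn
      have hxr : r ≤ dist x x0 := by simpa using hxn
      have h1 : dist x0 x1 ≤ r / 2 := by rw [dist_comm]; exact hx1
      have h2 : dist x1 y < r / 8 := by rw [dist_comm]; exact hy
      have h3 : 3 * r / 8 ≤ ‖x - y‖ := by
        rw [← dist_eq_norm]
        have := dist_triangle4_right x x0 y x1
        have h4 := dist_triangle x y x0
        have h5 := dist_triangle y x1 x0
        rw [dist_comm y x1, dist_comm x1 x0] at h5
        linarith
      have h4 : 9 / 16 ≤ 4 / r ^ 2 * ‖x - y‖ ^ 2 := by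
        calc (9:ℝ) / 16 = 4 / r ^ 2 * (3 * r / 8) ^ 2 := by field_simp; norm_num
          _ ≤ _ := by gcongr
      simp only [F] at hFneg
      linarith
    have htpos : τ < t := by
      rcases ht.1.eq_or_lt with h | h
      · have := hF0 y hy x hx
        rw [h] at this; linarith
      · exact h
    have hS : SupAt ν u (x, t) := hsup (x, t) ⟨hxb, htpos, ht.2⟩
    have hmin : ∀ x' ∈ closedBall x0 r, ∀ t' ∈ Icc τ t, F (y, t) x ≤ F (y, t') x' := by
      intro x' hx' t' ht'
      rw [← hxv]
      exact (hrec _ hp t' ht').trans (hvle _ _ hx')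
    have hUu : ∀ x' ∈ closedBall x0 r, ∀ t' ∈ Icc τ t, U (x', t') = u (x', t') :=
      fun x' hx' t' ht' => hU (x', t') ⟨hx', ht'.1, ht'.2.trans ht.2⟩
    have htt : t ∈ Icc τ t := ⟨ht.1, le_rfl⟩
    have hlm : IsLocalMin (fun x' => u (x', (x, t).2) + 4 / r ^ 2 * ‖x' - y‖ ^ 2) (x, t).1 := by
      filter_upwards [isOpen_ball.mem_nhds hxb] with x' hx'
      have h1 := hmin x' (ball_subset_closedBall hx') t htt
      simp only [F] at h1
      rw [hUu x hx t htt, hUu x' (ball_subset_closedBall hx') t htt] at h1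
      linarith
    have hevI : ∀ᶠ s in nhdsWithin t (Iio t), s ∈ Ioo τ t := Ioo_mem_nhdsLT htpos
    have hlt : ∀ᶠ s in nhdsWithin (x, t).2 (Iio (x, t).2),
        u (x, t) - 9 / 32 / r ^ 2 * (x, t).2 ≤ u ((x, t).1, s) - 9 / 32 / r ^ 2 * s := by
      filter_upwards [hevI] with s hs
      have h1 := hmin x hx s ⟨hs.1.le, hs.2.le⟩
      simp only [F] at h1
      rw [hUu x hx t htt, hUu x hx s ⟨hs.1.le, hs.2.le⟩] at h1
      linarith
    obtain ⟨hP, hdet, hDt⟩ := contactA hν hS hr hlm hlt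
    refine ⟨x, hxb, ?_, hS.1, hP, hdet, ?_⟩
    · have : 0 ≤ 4 / r ^ 2 * ‖x - y‖ ^ 2 := by positivity
      simp only [F] at hFneg
      linarith
    · intro K' hK'
      have hd : HasDerivAt (fun s => u (x, s) - 9 / 32 / r ^ 2 * s)
          (Dt u (x, t) - 9 / 32 / r ^ 2) t := by
        have h1 : HasDerivAt (fun s => u (x, s)) (Dt u (x, t)) t := hS.1.2.hasDerivAt
        have h2 := h1.sub ((hasDerivAt_id t).const_mul (9 / 32 / r ^ 2))
        have h3 : Dt u (x, t) - 9 / 32 / r ^ 2 = Dt u (x, t) - 9 / 32 / r ^ 2 * 1 := by ring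
        rw [h3]; exact h2
      have h1 := hd.hasDerivWithinAt (s := Iio t)
      rw [hasDerivWithinAt_iff_tendsto_slope' (by simp)] at h1
      have h2 : -K' < Dt u (x, t) - 9 / 32 / r ^ 2 := by
        have : -(C2 / r ^ 2) ≤ Dt u (x, t) - 9 / 32 / r ^ 2 := hDt
        linarith
      filter_upwards [h1.eventually (lt_mem_nhds h2), hevI] with s hs hsI
      have hst : s - t < 0 := by linarith [hsI.2]
      rw [slope_def_field, lt_div_iff_of_neg hst] at hs
      have h3 := hvle (y, s) x hx
      rw [hxv]
      simp only [F] at h3 ⊢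
      rw [hUu x hx t htt]
      rw [hUu x hx s ⟨hsI.1.le, hsI.2.le⟩] at h3
      linarith
  -- lower bound for the volume of T
  have hlow : volume (ball x1 (r / 8)) * ENNReal.ofReal (r ^ 2 / (4 * C2)) ≤ volume T := by
    rw [Measure.volume_eq_prod, Measure.prod_apply hTm]
    have hsl : ∀ y ∈ ball x1 (r / 8), ENNReal.ofReal (r ^ 2 / (4 * C2)) ≤
        volume (Prod.mk y ⁻¹' T) := by
      intro y hy
      have hTfin : volume (Prod.mk y ⁻¹' T) ≠ ⊤ :=
        ((measure_mono (fun t ht => ht.2.1 : Prod.mk y ⁻¹' T ⊆ Icc τ t1)).trans_lt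
          measure_Icc_lt_top).ne
      have hR := record_measure (v := fun t => v (y, t)) (α := τ) (β := t1) (c := 0)
        (K := C2 / r ^ 2) (S := Prod.mk y ⁻¹' T) (by simp only [hτ]; linarith)
        (by fun_prop)
        (by obtain ⟨x, hx, hxv⟩ := hvat (y, τ)
            rw [hxv]; exact hF0 y hy x hx) (by positivity)
        (fun t ht => ht.2.1)
        (fun t ht h0 hr' => ⟨hy, ht, h0, fun s hs => by
          simp only
          refine hr' _ ⟨?_, ?_⟩
          · have := mul_nonneg hs.1 (by linarith [ht.1] : 0 ≤ t - τ); linarith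
          · have := mul_le_mul_of_nonneg_right hs.2 (by linarith [ht.1] : 0 ≤ t - τ); linarith⟩)
        (fun t ht => by
          obtain ⟨x, -, -, -, -, -, h⟩ := hcontact _ ht
          exact h)
      have hv1 : v (y, t1) ≤ -(1 / 4) := by
        have hx1' : x1 ∈ closedBall x0 r := closedBall_subset_closedBall (by linarith) hx1
        refine (hvle (y, t1) x1 hx1').trans ?_
        simp only [F]
        rw [hU (x1, t1) ⟨hx1', by simp only [hτ]; linarith, le_rfl⟩]
        have h1 : ‖x1 - y‖ ≤ r / 8 := by
          rw [← dist_eq_norm, dist_comm]; exact (mem_ball.1 hy).le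
        have h2 : 4 / r ^ 2 * ‖x1 - y‖ ^ 2 ≤ 1 / 16 := by
          calc 4 / r ^ 2 * ‖x1 - y‖ ^ 2 ≤ 4 / r ^ 2 * (r / 8) ^ 2 := by gcongr
            _ = 1 / 16 := by field_simp; norm_num
        have h3 : 9 / 32 / r ^ 2 * (t1 - τ) = 9 / 16 := by
          simp only [hτ]; field_simp; ring
        linarith
      rw [ENNReal.ofReal_le_iff_le_toReal hTfin]
      have h5 : 1 / 4 ≤ C2 / r ^ 2 * volume.real (Prod.mk y ⁻¹' T) := by linarith
      rw [div_le_iff₀ (by positivity)]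
      rw [div_mul_eq_mul_div, le_div_iff₀ hr2] at h5
      change r ^ 2 ≤ volume.real (Prod.mk y ⁻¹' T) * (4 * C2)
      linarith
    calc volume (ball x1 (r / 8)) * ENNReal.ofReal (r ^ 2 / (4 * C2))
        = ∫⁻ _y in ball x1 (r / 8), ENNReal.ofReal (r ^ 2 / (4 * C2)) := by
          rw [setLIntegral_const, mul_comm]
      _ ≤ ∫⁻ y in ball x1 (r / 8), volume (Prod.mk y ⁻¹' T) :=
          setLIntegral_mono' measurableSet_ball hsl
      _ ≤ ∫⁻ y, volume (Prod.mk y ⁻¹' T) := setLIntegral_le_lintegral _ _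
  refine hlow.trans ?_
  -- upper bound
  set G : Set (E n × ℝ) := {X | X ∈ ball x0 r ×ˢ Ioo τ t1 ∧ u X ≤ 1} with hG
  have hGU : G = (ball x0 r ×ˢ Ioo τ t1) ∩ {X | U X ≤ 1} := by
    ext X
    simp only [hG, mem_setOf_eq, mem_inter_iff]
    refine and_congr_right fun hX => ?_
    rw [hU X ⟨ball_subset_closedBall hX.1, Ioo_subset_Icc_self hX.2⟩]
  have hGm : MeasurableSet G := by
    rw [hGU]
    exact (measurableSet_ball.prod measurableSet_Ioo).inter
      (isClosed_le hUc continuous_const).measurableSet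
  rw [Measure.volume_eq_prod, Measure.prod_apply_symm hTm, Measure.prod_apply_symm hGm,
    ← lintegral_const_mul' _ _ ENNReal.ofReal_ne_top]
  have hne : ∀ᵐ t : ℝ, t ≠ t1 ∧ t ≠ τ := by
    have h1 : ∀ᵐ t : ℝ, t ≠ t1 := by simp [ae_iff]
    have h2 : ∀ᵐ t : ℝ, t ≠ τ := by simp [ae_iff]
    exact h1.and h2
  refine lintegral_mono_ae ?_
  filter_upwards [hne] with t ht
  by_cases htI : t ∈ Ioo τ t1
  swap
  · have : (fun x => (x, t)) ⁻¹' T = ∅ := by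
      ext y
      simp only [mem_preimage, mem_empty_iff_false, iff_false]
      intro hp
      have h1 : t ∈ Icc τ t1 := hp.2.1
      exact htI ⟨lt_of_le_of_ne h1.1 (Ne.symm ht.2), lt_of_le_of_ne h1.2 ht.1⟩
    rw [this]; simp
  set Φ := PhiA r (fun x => u (x, t)) with hΦ
  let G' : Set (E n) := (ball x0 r ∩ {x | U (x, t) ≤ 1}) ∩ {x | |(fderiv ℝ Φ x).det| ≤ (C2 / (8 * ν)) ^ n}
  have hG'm : MeasurableSet G' := by
    refine (measurableSet_ball.inter
      (isClosed_le (by fun_prop) continuous_const).measurableSet).inter ?_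
    have : Measurable (fun x => |(fderiv ℝ Φ x).det|) :=
      (continuous_abs.comp ContinuousLinearMap.continuous_det).measurable.comp (measurable_fderiv ℝ Φ)
    exact measurableSet_le this measurable_const
  have hsm : ∀ x ∈ ball x0 r, SmAt u (x, t) := fun x hx => (hsup (x, t) ⟨hx, htI.1, htI.2.le⟩).1
  have hsub : (fun x => (x, t)) ⁻¹' T ⊆ Φ '' G' := by
    intro y hy
    obtain ⟨x, hx, hx1, hxs, hxΦ, hxd, -⟩ := hcontact _ hy
    refine ⟨x, ⟨⟨hx, hx1⟩, ?_⟩, hxΦ⟩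
    have := (phi_diff hxs r).2
    simp only [mem_setOf_eq]
    simp only at this
    rw [hΦ, this]
    exact hxd
  calc volume ((fun x => (x, t)) ⁻¹' T) ≤ volume (Φ '' G') := measure_mono hsub
    _ ≤ ∫⁻ x in G', ENNReal.ofReal |(fderiv ℝ Φ x).det| :=
        addHaar_image_le_lintegral_abs_det_fderiv volume hG'm
          (fun x hx => ((phi_diff (hsm x hx.1.1) r).1).hasFDerivAt.hasFDerivWithinAt)
    _ ≤ ∫⁻ _x in G', ENNReal.ofReal ((C2 / (8 * ν)) ^ n) :=
        setLIntegral_mono' hG'm fun x hx => ENNReal.ofReal_le_ofReal hx.2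
    _ = ENNReal.ofReal ((C2 / (8 * ν)) ^ n) * volume G' := setLIntegral_const _ _
    _ ≤ _ := by
        gcongr
        intro x hx
        simp only [hGU]
        exact ⟨⟨hx.1.1, htI⟩, hx.1.2⟩

/-- Measure-to-point estimate. -/
theorem lemmaA (n : ℕ) {ν : ℝ} (hν : 0 < ν) : ∃ ξ : ℝ, 0 < ξ ∧ ∀ (u : E n × ℝ → ℝ) (x0 : E n)
    (t1 r h : ℝ), 0 < r → 0 < h →
    ContinuousOn u (closedBall x0 r ×ˢ Icc (t1 - 2 * r ^ 2) t1) →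
    (∀ X ∈ closedBall x0 r ×ˢ Icc (t1 - 2 * r ^ 2) t1, 0 ≤ u X) →
    (∀ X ∈ ball x0 r ×ˢ Ioc (t1 - 2 * r ^ 2) t1, SupAt ν u X) →
    volume {X | X ∈ ball x0 r ×ˢ Ioo (t1 - 2 * r ^ 2) t1 ∧ u X ≤ h} ≤
      ENNReal.ofReal (ξ * r ^ (n + 2)) →
    ∀ x ∈ closedBall x0 (r / 2), h / 4 ≤ u (x, t1) := by
  set C2 : ℝ := 9 / 32 + 8 * n / ν with hC2
  have hC2p : 0 < C2 := by positivity
  set ω : ℝ := volume.real (ball (0 : E n) 1) with hω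
  have hωp : 0 < ω := by
    rw [hω, measureReal_def]
    exact ENNReal.toReal_pos (measure_ball_pos _ _ one_pos).ne' measure_ball_lt_top.ne
  have hωv : volume (ball (0 : E n) 1) = ENNReal.ofReal ω := by
    rw [hω, measureReal_def, ENNReal.ofReal_toReal measure_ball_lt_top.ne]
  set C3 : ℝ := (C2 / (8 * ν)) ^ n with hC3
  have hC3p : 0 < C3 := by positivity
  refine ⟨ω / 8 ^ n / (4 * C2) / C3 / 2, by positivity, ?_⟩
  intro u x0 t1 r h hr hh hc hnn hsup hvol x hx
  by_contra hlt
  push Not at hlt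
  have hr2 : 0 < r ^ 2 := by positivity
  have hmain := lemmaA_core hν (u := fun X => h⁻¹ * u X) (x0 := x0) (x1 := x) (t1 := t1) hr
    (continuousOn_const.mul hc) (fun X hX => mul_nonneg (inv_nonneg.2 hh.le) (hnn X hX))
    (fun X hX => (hsup X hX).const_mul (inv_nonneg.2 hh.le)) hx
    (by rw [inv_mul_lt_iff₀ hh]; linarith)
  have hset : {X | X ∈ ball x0 r ×ˢ Ioo (t1 - 2 * r ^ 2) t1 ∧ h⁻¹ * u X ≤ 1} =
      {X | X ∈ ball x0 r ×ˢ Ioo (t1 - 2 * r ^ 2) t1 ∧ u X ≤ h} := by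
    ext X
    simp only [mem_setOf_eq]
    refine and_congr_right fun _ => ?_
    rw [inv_mul_le_iff₀ hh, mul_one]
  rw [hset] at hmain
  have h1 := hmain.trans (mul_le_mul_right hvol _)
  rw [Measure.addHaar_ball_of_pos _ _ (by positivity : 0 < r / 8), hωv, finrank_euclideanSpace,
    Fintype.card_fin, ← ENNReal.ofReal_mul (by positivity), ← ENNReal.ofReal_mul (by positivity),
    ← ENNReal.ofReal_mul (by positivity), ENNReal.ofReal_le_ofReal_iff (by positivity)] at h1
  have h2 : C3 * (ω / 8 ^ n / (4 * C2) / C3 / 2 * r ^ (n + 2)) =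
      ((r / 8) ^ n * ω * (r ^ 2 / (4 * C2))) / 2 := by
    rw [div_pow, pow_add]
    field_simp
  have h3 : 0 < (r / 8) ^ n * ω * (r ^ 2 / (4 * C2)) := by positivity
  have h4 : (r / 8) ^ n * ω * (r ^ 2 / (4 * C2)) ≤ C3 * (ω / 8 ^ n / (4 * C2) / C3 / 2 * r ^ (n + 2)) := h1
  linarith
end

open MeasureTheory Set Metric Filter
noncomputable section
set_option maxHeartbeats 1000000
set_option linter.deprecated false
variable {n : ℕ}

/-- Barrier positivity. -/
theorem barrierB_pos {ν : ℝ} (hν : 0 < ν) {q : ℕ}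
    (hq : (8 * ν + (4 * n / ν + 32)) ^ 2 / (512 * ν) < q) {A : Fin n → Fin n → ℝ} (hA : Ell ν A)
    (x0 : E n) (ρ t0 c : ℝ) (hρ : 0 < ρ) (hc : 0 < c) (X : E n × ℝ) (ht : t0 ≤ X.2)
    (hs : ‖X.1 - x0‖ ^ 2 ≤ ρ ^ 2 + 16 * (X.2 - t0)) :
    SmAt (fun Y : E n × ℝ => c * ((ρ ^ 2 + 16 * (Y.2 - t0)) - ‖Y.1 - x0‖ ^ 2) ^ 2 /
      (ρ ^ 2 + 16 * (Y.2 - t0)) ^ q) X ∧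
    0 < Lop A (fun Y : E n × ℝ => c * ((ρ ^ 2 + 16 * (Y.2 - t0)) - ‖Y.1 - x0‖ ^ 2) ^ 2 /
      (ρ ^ 2 + 16 * (Y.2 - t0)) ^ q) X := by
  let f : ℝ → ℝ → ℝ := fun s t => c * ((ρ ^ 2 + 16 * (t - t0)) - s) ^ 2 / (ρ ^ 2 + 16 * (t - t0)) ^ q
  set ψ : ℝ := ρ ^ 2 + 16 * (X.2 - t0) with hψ
  have hψp : 0 < ψ := by have := pow_pos hρ 2; rw [hψ]; linarith
  have hq0 : 0 < (q : ℝ) := lt_of_le_of_lt (by positivity) hq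
  have hf1 : ContDiffAt ℝ 2 (fun s => f s X.2) (‖X.1 - x0‖ ^ 2) := by
    apply ContDiff.contDiffAt
    simp only [f]
    fun_prop
  have hd1 : deriv (fun s => f s X.2) = fun s => -2 * c * (ψ - s) / ψ ^ q := by
    funext s
    have h1 : HasDerivAt (fun s : ℝ => ψ - s) (-1) s := by
      simpa using (hasDerivAt_id s).const_sub ψ
    have h2 := (((h1.pow 2).const_mul c).div_const (ψ ^ q)).deriv
    simp only [f]
    refine Eq.trans ?_ (h2.trans ?_)
    · rfl
    · simp; ring
  have hd2 : deriv (fun s => -2 * c * (ψ - s) / ψ ^ q) = fun _ => 2 * c / ψ ^ q := by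
    funext s
    have h1 : HasDerivAt (fun s : ℝ => ψ - s) (-1) s := by
      simpa using (hasDerivAt_id s).const_sub ψ
    have h2 := ((h1.const_mul (-2 * c)).div_const (ψ ^ q)).deriv
    rw [h2]; ring
  have hdt : HasDerivAt (fun t => f (‖X.1 - x0‖ ^ 2) t)
      (c * (32 * (ψ - ‖X.1 - x0‖ ^ 2) / ψ ^ q - 16 * q * (ψ - ‖X.1 - x0‖ ^ 2) ^ 2 / ψ ^ (q + 1))) X.2 := by
    have h0 : HasDerivAt (fun t : ℝ => ρ ^ 2 + 16 * (t - t0)) 16 X.2 := by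
      simpa using (((hasDerivAt_id X.2).sub_const t0).const_mul 16).const_add (ρ ^ 2)
    have h1 := (((h0.sub_const (‖X.1 - x0‖ ^ 2)).pow 2).const_mul c).div (h0.pow q) (pow_ne_zero _ hψp.ne')
    refine HasDerivAt.congr_deriv h1 ?_
    rw [← hψ]
    obtain ⟨k, rfl⟩ : ∃ k, q = k + 1 := Nat.exists_eq_succ_of_ne_zero (by rintro rfl; simp at hq0)
    simp only [Nat.add_sub_cancel, Nat.cast_add, Nat.cast_one, Pi.pow_apply, Pi.sub_apply]
    simp only [← hψ]
    field_simp
    push_cast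
    ring
  refine ⟨smAt_radial (f := f) x0 X hf1 hdt.differentiableAt, ?_⟩
  have hL := Lop_radial (f := f) A x0 X hf1
  have hgoal : Lop A (fun Y : E n × ℝ => c * ((ρ ^ 2 + 16 * (Y.2 - t0)) - ‖Y.1 - x0‖ ^ 2) ^ 2 /
      (ρ ^ 2 + 16 * (Y.2 - t0)) ^ q) X = _ := hL
  rw [hgoal, hd1, hd2, hdt.deriv]
  set s := ‖X.1 - x0‖ ^ 2 with hsdef
  set qd := ∑ i, ∑ j, A i j * (X.1 - x0) i * (X.1 - x0) j with hqd
  have h1 : ν * s ≤ qd := hA.quad_ge (X.1 - x0)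
  have h2 : ∑ i, A i i ≤ n / ν := by have := hA.trace_le; rwa [← div_eq_mul_inv] at this
  set tr := ∑ i, A i i with htr
  have hz : 0 ≤ ψ - s := by linarith
  have hpos : 0 < c / ψ ^ q / ψ := by positivity
  have hkey : 0 < 8 * ν * ψ ^ 2 - (8 * ν + (4 * n / ν + 32)) * (ψ - s) * ψ + q * 16 * (ψ - s) ^ 2 := by
    set B := 8 * ν + (4 * n / ν + 32) with hB
    rw [div_lt_iff₀ (by positivity)] at hq
    have hid : 32 * ν * (8 * ν * ψ ^ 2 - B * (ψ - s) * ψ + q * 16 * (ψ - s) ^ 2) =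
        (16 * ν * ψ - B * (ψ - s)) ^ 2 + (q * (512 * ν) - B ^ 2) * (ψ - s) ^ 2 := by ring
    have h3 : 0 ≤ (q * (512 * ν) - B ^ 2) := by linarith
    have h4 : 0 < 32 * ν * (8 * ν * ψ ^ 2 - B * (ψ - s) * ψ + q * 16 * (ψ - s) ^ 2) := by
      rw [hid]
      rcases hz.eq_or_lt with h | h
      · rw [← h]; simp; positivity
      · have : 0 < (q * (512 * ν) - B ^ 2) * (ψ - s) ^ 2 := by
          apply mul_pos (by linarith) (by positivity)
        positivity
    exact pos_of_mul_pos_right h4 (by positivity)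
  have hexp : 4 * (2 * c / ψ ^ q) * qd + 2 * (-2 * c * (ψ - s) / ψ ^ q) * tr -
      c * (32 * (ψ - s) / ψ ^ q - 16 * q * (ψ - s) ^ 2 / ψ ^ (q + 1)) =
      c / ψ ^ q / ψ * (8 * qd * ψ - 4 * (ψ - s) * tr * ψ - 32 * (ψ - s) * ψ + 16 * q * (ψ - s) ^ 2) := by
    rw [pow_succ]
    field_simp
    ring
  have hb1 : 8 * (ν * s) * ψ ≤ 8 * qd * ψ := by gcongr
  have hb2 : 4 * (ψ - s) * tr * ψ ≤ 4 * (ψ - s) * (n / ν) * ψ := by gcongr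
  have hlast : 0 < c / ψ ^ q / ψ *
      (8 * qd * ψ - 4 * (ψ - s) * tr * ψ - 32 * (ψ - s) * ψ + 16 * q * (ψ - s) ^ 2) := by
    apply mul_pos hpos
    have h5 : 4 * (ψ - s) * (n / ν) * ψ = (4 * n / ν) * (ψ - s) * ψ := by ring
    nlinarith
  rw [← hexp] at hlast
  exact hlast

/-- Propagation of positivity. -/
theorem lemmaB (n : ℕ) {ν : ℝ} (hν : 0 < ν) : ∃ Q : ℕ, ∀ (u : E n × ℝ → ℝ) (x0 : E n)
    (t0 t1 ρ P h : ℝ), 0 < ρ → 0 < h → 0 ≤ P → ρ ^ 2 + 16 * (t1 - t0) ≤ P ^ 2 →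
    ContinuousOn u (closedBall x0 P ×ˢ Icc t0 t1) →
    (∀ X ∈ closedBall x0 P ×ˢ Icc t0 t1, 0 ≤ u X) →
    (∀ X ∈ ball x0 P ×ˢ Ioc t0 t1, SupAt ν u X) →
    (∀ x ∈ closedBall x0 ρ, h ≤ u (x, t0)) →
    ∀ t ∈ Icc t0 t1, ∀ x : E n, ‖x - x0‖ ^ 2 ≤ (ρ ^ 2 + 16 * (t - t0)) / 2 →
      h / 4 * (ρ ^ 2 / (ρ ^ 2 + 16 * (t - t0))) ^ Q ≤ u (x, t) := by
  obtain ⟨Q, hQ⟩ := exists_nat_gt ((8 * ν + (4 * n / ν + 32)) ^ 2 / (512 * ν))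
  refine ⟨Q, ?_⟩
  intro u x0 t0 t1 ρ P h hρ hh hP0 hP hc hnn hsup hini t ht x hx
  have hq : (8 * ν + (4 * n / ν + 32)) ^ 2 / (512 * ν) < ((Q + 2 : ℕ) : ℝ) := by
    push_cast; linarith
  set c := h * ρ ^ (2 * Q) with hcdef
  have hcp : 0 < c := by positivity
  have hρ2 : 0 < ρ ^ 2 := by positivity
  let φ : E n × ℝ → ℝ := fun Y => c * ((ρ ^ 2 + 16 * (Y.2 - t0)) - ‖Y.1 - x0‖ ^ 2) ^ 2 /
      (ρ ^ 2 + 16 * (Y.2 - t0)) ^ (Q + 2)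
  let K : Set (E n × ℝ) := {Y | Y.2 ∈ Icc t0 t1 ∧ ‖Y.1 - x0‖ ^ 2 ≤ ρ ^ 2 + 16 * (Y.2 - t0)}
  have hKsub : K ⊆ closedBall x0 P ×ˢ Icc t0 t1 := by
    intro Y hY
    refine ⟨?_, hY.1⟩
    rw [mem_closedBall, dist_eq_norm]
    refine abs_le_of_sq_le_sq' ?_ hP0 |>.2
    have := hY.2; have := hY.1.2
    linarith
  have hKcl : IsClosed K := by
    have h1 : IsClosed {Y : E n × ℝ | ‖Y.1 - x0‖ ^ 2 ≤ ρ ^ 2 + 16 * (Y.2 - t0)} :=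
      isClosed_le (by fun_prop) (by fun_prop)
    exact (isClosed_Icc.preimage continuous_snd).inter h1
  have hKc : IsCompact K :=
    ((isCompact_closedBall x0 P).prod isCompact_Icc).of_isClosed_subset hKcl hKsub
  have hψp : ∀ Y ∈ K, 0 < ρ ^ 2 + 16 * (Y.2 - t0) := fun Y hY => by have := hY.1.1; linarith
  have hφc : ContinuousOn φ K := by
    refine ContinuousOn.div ?_ ?_ (fun Y hY => (pow_pos (hψp Y hY) _).ne')
    · fun_prop
    · fun_prop
  have hmp := max_principle hν.le hKc (w := fun Y => φ Y - u Y) (hφc.sub (hc.mono hKsub)) (by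
    intro X hX hw
    have hu0 : 0 ≤ u X := hnn X (hKsub hX)
    have hφpos : 0 < φ X := by linarith
    have hlt : ‖X.1 - x0‖ ^ 2 < ρ ^ 2 + 16 * (X.2 - t0) := by
      rcases hX.2.eq_or_lt with h' | h'
      · simp only [φ, h', sub_self] at hφpos
        simp at hφpos
      · exact h'
    have htpos : t0 < X.2 := by
      rcases hX.1.1.eq_or_lt with h' | h'
      · exfalso
        have h1 : h ≤ u X := by
          have : X = (X.1, t0) := by rw [h']
          rw [this]
          apply hini
          rw [mem_closedBall, dist_eq_norm]
          refine abs_le_of_sq_le_sq' ?_ hρ.le |>.2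
          rw [← h'] at hlt; linarith
        have h2 : φ X ≤ h := by
          simp only [φ, ← h', sub_self, mul_zero, add_zero]
          rw [div_le_iff₀ (by positivity), hcdef]
          have h3 : (ρ ^ 2 - ‖X.1 - x0‖ ^ 2) ^ 2 ≤ (ρ ^ 2) ^ 2 := by
            rw [← h', sub_self] at hlt
            apply pow_le_pow_left₀ (by linarith)
            have := sq_nonneg ‖X.1 - x0‖
            linarith
          calc h * ρ ^ (2 * Q) * (ρ ^ 2 - ‖X.1 - x0‖ ^ 2) ^ 2 ≤ h * ρ ^ (2 * Q) * (ρ ^ 2) ^ 2 := by gcongr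
            _ = h * (ρ ^ 2) ^ (Q + 2) := by rw [pow_add, pow_mul]; ring
        linarith
      · exact h'
    have hin : X ∈ ball x0 P ×ˢ Ioc t0 t1 := by
      refine ⟨?_, htpos, hX.1.2⟩
      rw [mem_ball, dist_eq_norm]
      refine lt_of_pow_lt_pow_left₀ 2 hP0 ?_
      have := hX.1.2
      linarith
    obtain ⟨hsm, A, hA, hL⟩ := hsup X hin
    obtain ⟨hb1, hb2⟩ := barrierB_pos hν hq hA x0 ρ t0 c hρ hcp X htpos.le hX.2
    refine ⟨?_, SmAt.sub hb1 hsm, A, hA, ?_⟩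
    · have e1 : ∀ᶠ Y : E n × ℝ in nhds X, t0 < Y.2 :=
        (isOpen_lt continuous_const continuous_snd).mem_nhds htpos
      have e2 : ∀ᶠ Y : E n × ℝ in nhds X, ‖Y.1 - x0‖ ^ 2 < ρ ^ 2 + 16 * (Y.2 - t0) :=
        (isOpen_lt (by fun_prop) (by fun_prop)).mem_nhds hlt
      filter_upwards [e1, e2] with Y h1 h2 h3
      exact ⟨⟨h1.le, h3.trans hX.1.2⟩, h2.le⟩
    · rw [Lop_sub hb1 hsm]
      linarith)
  set ψ := ρ ^ 2 + 16 * (t - t0) with hψ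
  have hψ0 : 0 < ψ := by rw [hψ]; have := ht.1; linarith
  have hXK : ((x, t) : E n × ℝ) ∈ K := ⟨ht, by simp only; linarith⟩
  have h1 := hmp _ hXK
  have h2 : h / 4 * (ρ ^ 2 / ψ) ^ Q ≤ φ (x, t) := by
    simp only [φ]
    rw [← hψ, le_div_iff₀ (by positivity), hcdef]
    have h3 : (ψ / 2) ^ 2 ≤ (ψ - ‖x - x0‖ ^ 2) ^ 2 := by
      apply pow_le_pow_left₀ (by positivity); linarith
    calc h / 4 * (ρ ^ 2 / ψ) ^ Q * ψ ^ (Q + 2) = h * ρ ^ (2 * Q) * (ψ / 2) ^ 2 := by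
          rw [div_pow, pow_mul, pow_add]; field_simp; norm_num
      _ ≤ _ := by gcongr
  linarith
end

open MeasureTheory Set Metric Filter
noncomputable section
set_option maxHeartbeats 1000000
set_option linter.deprecated false
variable {n : ℕ}

theorem rising_sun {U : Set ℝ} (hU : MeasurableSet U) {A B α : ℝ} (hAB : A ≤ B) (hα : 0 ≤ α)
    {S : Set ℝ} (hSm : MeasurableSet S) (hSI : S ⊆ Icc A B)
    (hS : ∀ p ∈ S, ∃ b ∈ Icc A B, p < b ∧ α * (b - p) < volume.real (U ∩ Ioc p b)) :
    α * volume.real S ≤ volume.real (U ∩ Ioc A B) := by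
  set m : ℝ → ℝ := fun t => volume.real (U ∩ Ioc A t) with hm
  have hfin : ∀ s t : ℝ, volume (U ∩ Ioc s t) ≠ ⊤ := fun s t =>
    ((measure_mono inter_subset_right).trans_lt measure_Ioc_lt_top).ne
  have hmadd : ∀ s t, A ≤ s → s ≤ t → m t = m s + volume.real (U ∩ Ioc s t) := by
    intro s t hs hst
    rw [hm]
    simp only
    rw [← measureReal_union ((Ioc_disjoint_Ioc_of_le le_rfl).mono inter_subset_right inter_subset_right) (hU.inter measurableSet_Ioc) (hfin _ _) (hfin _ _),
      ← inter_union_distrib_left, Ioc_union_Ioc_eq_Ioc hs hst]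
  have hmle : ∀ s t : ℝ, s ≤ t → volume.real (U ∩ Ioc s t) ≤ t - s := by
    intro s t hst
    have := measureReal_mono (μ := volume) (s₁ := U ∩ Ioc s t) (s₂ := Ioc s t) inter_subset_right
      measure_Ioc_lt_top.ne
    rwa [Real.volume_real_Ioc_of_le hst] at this
  have hmc : ContinuousOn m (Icc A B) := by
    have : LipschitzOnWith 1 m (Icc A B) := by
      refine LipschitzOnWith.of_le_add fun s hs t ht => ?_
      rw [Real.dist_eq]
      rcases le_total s t with h | h
      · have := hmadd s t hs.1 h
        have h3 : 0 ≤ volume.real (U ∩ Ioc s t) := measureReal_nonneg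
        have := abs_nonneg (s - t)
        linarith
      · have := hmadd t s ht.1 h
        have h3 := hmle t s h
        have := le_abs_self (s - t)
        linarith
    exact this.continuousOn
  let S' : Set ℝ := (fun s : ℝ => -s) ⁻¹' S
  have hS'm : MeasurableSet S' := measurable_neg hSm
  have hS'v : volume.real S' = volume.real S := by
    have : S' = -S := rfl
    rw [measureReal_def, measureReal_def, this, Measure.measure_neg]
  have hS'I : S' ⊆ Icc (-B) (-A) := fun s hs => by
    have h1 := hSI hs
    exact ⟨by linarith [h1.2], by linarith [h1.1]⟩
  have hR := record_measure (v := fun s => - m (-s) - α * s) (α := -B) (β := -A)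
    (c := -m B + α * B) (K := α) (S := Icc (-B) (-A) \ S') (by linarith) (by
      refine ContinuousOn.sub (ContinuousOn.neg ?_) (by fun_prop)
      refine hmc.comp (by fun_prop) ?_
      intro s hs
      exact ⟨by linarith [hs.2], by linarith [hs.1]⟩) (by simp) hα diff_subset
    (by
      intro t ht _ hrec
      refine ⟨ht, fun htS => ?_⟩
      obtain ⟨b, hb, hpb, hlt⟩ := hS (-t) htS
      have h1 := hrec (-b) ⟨by linarith [hb.2], by linarith⟩
      have h2 := hmadd (-t) b (by linarith [ht.2]) hpb.le
      simp only [neg_neg] at h1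
      rw [h2] at h1
      linarith)
    (by
      intro t ht K' hK'
      by_cases htB : -B < t
      · filter_upwards [Ioo_mem_nhdsLT htB] with t' ht'
        have h2 := hmadd (-t) (-t') (by linarith [ht.1.2]) (by linarith [ht'.2])
        have h3 : 0 ≤ volume.real (U ∩ Ioc (-t) (-t')) := measureReal_nonneg
        have h4 : α * (t - t') ≤ K' * (t - t') := by
          apply mul_le_mul_of_nonneg_right hK'.le; linarith [ht'.2]
        linarith
      · filter_upwards [self_mem_nhdsWithin] with t' ht'
        have ht'' : t' < t := ht'
        have h2 := hmadd (-t) (-t') (by linarith [ht.1.2]) (by linarith)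
        have h3 : 0 ≤ volume.real (U ∩ Ioc (-t) (-t')) := measureReal_nonneg
        have h4 : α * (t - t') ≤ K' * (t - t') := by
          apply mul_le_mul_of_nonneg_right hK'.le; linarith
        linarith)
  have hmA : m A = 0 := by simp [hm]
  simp only [neg_neg, hmA] at hR
  have hd : volume.real (Icc (-B) (-A) \ S') = (B - A) - volume.real S := by
    rw [measureReal_diff hS'I hS'm (measure_Icc_lt_top.ne : volume (Icc (-B) (-A)) ≠ ⊤),
      Real.volume_real_Icc_of_le (by linarith), hS'v]
    ring
  rw [hd] at hR
  have : m B = volume.real (U ∩ Ioc A B) := rfl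
  linarith

/-- Stacking of cylinders. -/
theorem stacking {ι : Type*} (c : ι → E n × ℝ) (r : ι → ℝ) (hr : ∀ i, 0 < r i) {M A B : ℝ}
    (hM : 1 < M) (hAB : A ≤ B) (hA : ∀ i, A ≤ (c i).2 - r i ^ 2)
    (hB : ∀ i, (c i).2 + (M + 1) * r i ^ 2 ≤ B) :
    ENNReal.ofReal ((M - 1) / (M + 3)) *
      volume (⋃ i, ball (c i).1 (r i) ×ˢ Ioo ((c i).2 - r i ^ 2) ((c i).2 + r i ^ 2)) ≤
    volume (⋃ i, ball (c i).1 (r i) ×ˢ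
      Ioo ((c i).2 + 2 * r i ^ 2) ((c i).2 + (M + 1) * r i ^ 2)) := by
  set G := ⋃ i, ball (c i).1 (r i) ×ˢ Ioo ((c i).2 - r i ^ 2) ((c i).2 + r i ^ 2) with hG
  set G' := ⋃ i, ball (c i).1 (r i) ×ˢ
      Ioo ((c i).2 + 2 * r i ^ 2) ((c i).2 + (M + 1) * r i ^ 2) with hG'
  have hGo : IsOpen G := isOpen_iUnion fun i => isOpen_ball.prod isOpen_Ioo
  have hGo' : IsOpen G' := isOpen_iUnion fun i => isOpen_ball.prod isOpen_Ioo
  rw [Measure.volume_eq_prod, Measure.prod_apply hGo.measurableSet,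
    Measure.prod_apply hGo'.measurableSet, ← lintegral_const_mul' _ _ ENNReal.ofReal_ne_top]
  refine lintegral_mono fun x => ?_
  have hα : 0 ≤ (M - 1) / (M + 3) := div_nonneg (by linarith) (by linarith)
  have hgI : Prod.mk x ⁻¹' G ⊆ Icc A B := by
    intro t ht
    simp only [hG, mem_preimage, mem_iUnion] at ht
    obtain ⟨i, hi⟩ := ht
    have h1 := hi.2
    simp only at h1
    have h2 := hA i; have h3 := hB i
    have h4 := pow_pos (hr i) 2
    exact ⟨by linarith [h1.1], by nlinarith [h1.2]⟩
  have hgI' : Prod.mk x ⁻¹' G' ⊆ Ioc A B := by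
    intro t ht
    simp only [hG', mem_preimage, mem_iUnion] at ht
    obtain ⟨i, hi⟩ := ht
    have h1 := hi.2
    simp only at h1
    have h2 := hA i; have h3 := hB i
    have h4 := pow_pos (hr i) 2
    exact ⟨by linarith [h1.1], by linarith [h1.2]⟩
  have hmk : Continuous (Prod.mk x : ℝ → E n × ℝ) := by fun_prop
  have hf1 : volume (Prod.mk x ⁻¹' G) ≠ ⊤ := ((measure_mono hgI).trans_lt measure_Icc_lt_top).ne
  have hf2 : volume (Prod.mk x ⁻¹' G') ≠ ⊤ := ((measure_mono hgI').trans_lt measure_Ioc_lt_top).ne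
  have hrs := rising_sun (U := Prod.mk x ⁻¹' G') (S := Prod.mk x ⁻¹' G)
    (α := (M - 1) / (M + 3)) (hGo'.preimage hmk).measurableSet hAB hα
    (hGo.preimage hmk).measurableSet hgI (by
      intro p hp
      simp only [hG, mem_preimage, mem_iUnion] at hp
      obtain ⟨i, hi⟩ := hp
      have h1 := hi.2
      simp only at h1
      have h2 := hA i; have h3 := hB i
      have h4 := pow_pos (hr i) 2
      have hx : x ∈ ball (c i).1 (r i) := hi.1
      refine ⟨(c i).2 + (M + 1) * r i ^ 2, ⟨by nlinarith, h3⟩, by nlinarith [h1.2], ?_⟩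
      have hsub : Ioo ((c i).2 + 2 * r i ^ 2) ((c i).2 + (M + 1) * r i ^ 2) ⊆
          Prod.mk x ⁻¹' G' ∩ Ioc p ((c i).2 + (M + 1) * r i ^ 2) := by
        intro t ht
        refine ⟨mem_iUnion.2 ⟨i, hx, ht⟩, by linarith [ht.1, h1.2], ht.2.le⟩
      have h5 := measureReal_mono (μ := volume) hsub
        ((measure_mono inter_subset_right).trans_lt measure_Ioc_lt_top).ne
      rw [Real.volume_real_Ioo_of_le (by nlinarith)] at h5
      refine lt_of_lt_of_le ?_ h5
      have h6 : (c i).2 + (M + 1) * r i ^ 2 - p < (M + 3) * r i ^ 2 := by nlinarith [h1.1]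
      calc (M - 1) / (M + 3) * ((c i).2 + (M + 1) * r i ^ 2 - p)
          < (M - 1) / (M + 3) * ((M + 3) * r i ^ 2) := by
            apply mul_lt_mul_of_pos_left h6
            exact div_pos (by linarith) (by linarith)
        _ = (M - 1) * r i ^ 2 := by field_simp
        _ = _ := by ring)
  rw [inter_eq_left.2 hgI'] at hrs
  rw [measureReal_def, measureReal_def] at hrs
  rw [← ENNReal.ofReal_toReal hf1, ← ENNReal.ofReal_toReal hf2, ← ENNReal.ofReal_mul hα]
  exact ENNReal.ofReal_le_ofReal hrs

theorem Cr_volume (X : E n × ℝ) {r : ℝ} (hr : 0 < r) :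
    volume (Cr X r) = ENNReal.ofReal (2 * volume.real (ball (0 : E n) 1) * r ^ (n + 2)) := by
  unfold Cr CRr
  have hωv : volume (ball (0 : E n) 1) = ENNReal.ofReal (volume.real (ball (0 : E n) 1)) := by
    rw [measureReal_def, ENNReal.ofReal_toReal measure_ball_lt_top.ne]
  rw [Measure.volume_eq_prod, Measure.prod_prod, Measure.addHaar_ball_of_pos _ _ hr,
    finrank_euclideanSpace, Fintype.card_fin, Real.volume_Ioo, hωv,
    ← ENNReal.ofReal_mul (by positivity), ← ENNReal.ofReal_mul (by positivity)]
  congr 1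
  ring

theorem Cr_isOpen (X : E n × ℝ) (r : ℝ) : IsOpen (Cr X r) := isOpen_ball.prod isOpen_Ioo

/-- Covering lemma. -/
theorem covering {ι : Type*} (c : ι → E n × ℝ) (r : ι → ℝ) (hr : ∀ i, 0 < r i) {R : ℝ}
    (hR : ∀ i, r i ≤ R) {S : Set (E n × ℝ)} (hSm : MeasurableSet S)
    (hSG : S ⊆ ⋃ i, Cr (c i) (r i)) {ξ : ℝ} (hξ : 0 < ξ)
    (hd : ∀ i, ENNReal.ofReal (ξ * r i ^ (n + 2)) ≤ volume (Cr (c i) (r i) \ S)) :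
    volume S + ENNReal.ofReal (ξ / (2 * volume.real (ball (0 : E n) 1) * 5 ^ (n + 2))) *
      volume (⋃ i, Cr (c i) (r i)) ≤ volume (⋃ i, Cr (c i) (r i)) := by
  set ω : ℝ := volume.real (ball (0 : E n) 1) with hω
  have hωp : 0 < ω := by
    rw [hω, measureReal_def]
    exact ENNReal.toReal_pos (measure_ball_pos _ _ one_pos).ne' measure_ball_lt_top.ne
  set G := ⋃ i, Cr (c i) (r i) with hG
  obtain ⟨v, -, hvd, hvc⟩ := Vitali.exists_disjoint_subfamily_covering_enlargement
    (fun i => Cr (c i) (r i)) (univ : Set ι) r 2 (by norm_num) (fun i _ => (hr i).le) R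
    (fun i _ => hR i) (fun i _ => ⟨c i, mem_ball_self (hr i), by
      have := pow_pos (hr i) 2
      constructor <;> linarith⟩)
  have hvcount : v.Countable := hvd.countable_of_isOpen (fun i _ => Cr_isOpen _ _) (fun i _ => ⟨c i, mem_ball_self (hr i), by
      have := pow_pos (hr i) 2
      constructor <;> linarith⟩)
  have hGsub : G ⊆ ⋃ i ∈ v, Cr (c i) (5 * r i) := by
    intro X hX
    obtain ⟨a, ha⟩ := mem_iUnion.1 hX
    obtain ⟨b, hb, ⟨Z, hZa, hZb⟩, hab⟩ := hvc a (mem_univ a)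
    refine mem_iUnion₂.2 ⟨b, hb, ?_, ?_⟩
    · have h1 := mem_ball.1 ha.1
      have h2 := mem_ball.1 hZa.1
      have h3 := mem_ball.1 hZb.1
      rw [mem_ball]
      have h4 := dist_triangle4 X.1 (c a).1 Z.1 (c b).1
      rw [dist_comm (c a).1 Z.1] at h4
      linarith
    · have h1 := ha.2
      have h2 := hZa.2
      have h3 := hZb.2
      have h4 : r a ^ 2 ≤ 4 * r b ^ 2 := by
        have := pow_le_pow_left₀ (hr a).le hab 2
        rw [mul_pow] at this; linarith
      have h5 := pow_pos (hr b) 2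
      have h6 : (5 * r b) ^ 2 = 25 * r b ^ 2 := by ring
      rw [mem_Ioo, h6]
      constructor
      · linarith [h1.1, h2.2, h3.1]
      · linarith [h1.2, h2.1, h3.2]
  have hsum : ENNReal.ofReal (ξ / (2 * ω * 5 ^ (n + 2))) * volume G ≤ volume (G \ S) := by
    have hvc' : Countable v := hvcount.to_subtype
    calc ENNReal.ofReal (ξ / (2 * ω * 5 ^ (n + 2))) * volume G
        ≤ ENNReal.ofReal (ξ / (2 * ω * 5 ^ (n + 2))) * volume (⋃ i ∈ v, Cr (c i) (5 * r i)) := by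
          gcongr
      _ ≤ ENNReal.ofReal (ξ / (2 * ω * 5 ^ (n + 2))) * ∑' i : v, volume (Cr (c i) (5 * r i)) := by
          gcongr
          exact measure_biUnion_le _ hvcount _
      _ = ∑' i : v, ENNReal.ofReal (ξ * r i ^ (n + 2)) := by
          rw [← ENNReal.tsum_mul_left]
          congr 1
          funext i
          rw [Cr_volume _ (by have := hr i; positivity), ← ENNReal.ofReal_mul (by positivity)]
          congr 1
          rw [← hω]
          rw [mul_pow]
          field_simp
      _ ≤ ∑' i : v, volume (Cr (c i) (r i) \ S) := ENNReal.tsum_le_tsum fun i => hd i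
      _ = volume (⋃ i : v, Cr (c i) (r i) \ S) := by
          rw [measure_iUnion]
          · intro i j hij
            exact (hvd i.2 j.2 (fun h => hij (Subtype.ext h))).mono diff_subset diff_subset
          · intro i
            exact (Cr_isOpen _ _).measurableSet.diff hSm
      _ ≤ volume (G \ S) := by
          apply measure_mono
          refine iUnion_subset fun i => diff_subset_diff_left ?_
          exact subset_iUnion (fun i => Cr (c i) (r i)) (i : ι)
  calc volume S + ENNReal.ofReal (ξ / (2 * ω * 5 ^ (n + 2))) * volume G
      ≤ volume S + volume (G \ S) := by gcongr
    _ = volume G := by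
        rw [← measure_union disjoint_sdiff_right
          ((isOpen_iUnion fun i => Cr_isOpen _ _).measurableSet.diff hSm), union_diff_cancel hSG]
end

open MeasureTheory Set Metric Filter
noncomputable section
set_option maxHeartbeats 1000000
set_option linter.deprecated false
variable {n : ℕ}

/-- Nonnegative continuous supersolution on a set. -/
def SupOn (ν : ℝ) (u : E n × ℝ → ℝ) (S : Set (E n × ℝ)) : Prop :=
  ContinuousOn u S ∧ (∀ X ∈ S, 0 ≤ u X) ∧ ∀ X ∈ S, SupAt ν u X

theorem SupOn.mono {ν : ℝ} {u : E n × ℝ → ℝ} {S T : Set (E n × ℝ)} (h : SupOn ν u S)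
    (hT : T ⊆ S) : SupOn ν u T :=
  ⟨h.1.mono hT, fun X hX => h.2.1 X (hT hX), fun X hX => h.2.2 X (hT hX)⟩

/-- Conclusion of Lemma A, centred form. -/
def PropA (n : ℕ) (ν ξ : ℝ) : Prop := ∀ (u : E n × ℝ → ℝ) (x : E n) (t r h : ℝ), 0 < r → 0 < h →
  SupOn ν u (closedBall x r ×ˢ Icc (t - r ^ 2) (t + r ^ 2)) →
  volume {X | X ∈ Cr (x, t) r ∧ u X ≤ h} ≤ ENNReal.ofReal (ξ * r ^ (n + 2)) →
  ∀ y ∈ closedBall x (r / 2), h / 4 ≤ u (y, t + r ^ 2)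

theorem exists_propA (n : ℕ) {ν : ℝ} (hν : 0 < ν) : ∃ ξ : ℝ, 0 < ξ ∧ PropA n ν ξ := by
  obtain ⟨ξ, hξ, H⟩ := lemmaA n hν
  refine ⟨ξ, hξ, ?_⟩
  intro u x t r h hr hh hS hvol y hy
  have e : t + r ^ 2 - 2 * r ^ 2 = t - r ^ 2 := by ring
  refine H u x (t + r ^ 2) r h hr hh ?_ ?_ ?_ ?_ y hy
  · rw [e]; exact hS.1
  · rw [e]; exact hS.2.1
  · rw [e]; exact fun X hX => hS.2.2 X ⟨ball_subset_closedBall hX.1, Ioc_subset_Icc_self hX.2⟩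
  · rw [e]; exact hvol

/-- Conclusion of Lemma B. -/
def PropB (n : ℕ) (ν : ℝ) (Q : ℕ) : Prop := ∀ (u : E n × ℝ → ℝ) (x0 : E n)
    (t0 t1 ρ P h : ℝ), 0 < ρ → 0 < h → 0 ≤ P → ρ ^ 2 + 16 * (t1 - t0) ≤ P ^ 2 →
    SupOn ν u (closedBall x0 P ×ˢ Icc t0 t1) →
    (∀ x ∈ closedBall x0 ρ, h ≤ u (x, t0)) →
    ∀ t ∈ Icc t0 t1, ∀ x : E n, ‖x - x0‖ ^ 2 ≤ (ρ ^ 2 + 16 * (t - t0)) / 2 →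
      h / 4 * (ρ ^ 2 / (ρ ^ 2 + 16 * (t - t0))) ^ Q ≤ u (x, t)

theorem exists_propB (n : ℕ) {ν : ℝ} (hν : 0 < ν) : ∃ Q : ℕ, PropB n ν Q := by
  obtain ⟨Q, H⟩ := lemmaB n hν
  refine ⟨Q, ?_⟩
  intro u x0 t0 t1 ρ P h hρ hh hP0 hP hS hini t ht x hx
  exact H u x0 t0 t1 ρ P h hρ hh hP0 hP hS.1 hS.2.1
    (fun X hX => hS.2.2 X ⟨ball_subset_closedBall hX.1, Ioc_subset_Icc_self hX.2⟩) hini t ht x hx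

theorem lemmaAB {ν ξ : ℝ} {Q : ℕ} (hA : PropA n ν ξ) (hB : PropB n ν Q) {M : ℝ} (hM : 1 ≤ M)
    {u : E n × ℝ → ℝ} {x : E n} {t r h : ℝ} (hr : 0 < r) (hh : 0 < h)
    (hS : SupOn ν u (closedBall x (4 * (M + 2) * r) ×ˢ Icc (t - r ^ 2) (t + (M + 1) * r ^ 2)))
    (hvol : volume {X | X ∈ Cr (x, t) (r / 2) ∧ u X ≤ h} ≤ ENNReal.ofReal (ξ * (r / 2) ^ (n + 2)))
    {y : E n} (hy : y ∈ ball x r) {s : ℝ} (hs : s ∈ Icc (t + 2 * r ^ 2) (t + (M + 1) * r ^ 2)) :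
    1 / 16 * (1 / (1 + 256 * (M + 1))) ^ Q * h ≤ u (y, s) := by
  have hr2 : 0 < r ^ 2 := by positivity
  have hMr : r ^ 2 ≤ M * r ^ 2 := by nlinarith
  have h1 : ∀ y ∈ closedBall x (r / 2 / 2), h / 4 ≤ u (y, t + (r / 2) ^ 2) := by
    apply hA u x t (r / 2) h (by positivity) hh _ hvol
    apply hS.mono
    apply Set.prod_mono
    · apply closedBall_subset_closedBall; nlinarith
    · apply Icc_subset_Icc <;> nlinarith
  have h2 := hB u x (t + (r / 2) ^ 2) (t + (M + 1) * r ^ 2) (r / 2 / 2) (4 * (M + 2) * r) (h / 4)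
    (by positivity) (by positivity) (by positivity) (by nlinarith) (hS.mono (by
      apply Set.prod_mono le_rfl
      apply Icc_subset_Icc <;> nlinarith)) h1 s ⟨by nlinarith [hs.1], hs.2⟩ y (by
      rw [mem_ball, dist_eq_norm] at hy
      have : ‖y - x‖ ^ 2 ≤ r ^ 2 := by gcongr
      nlinarith [hs.1])
  refine le_trans ?_ h2
  have h3 : 1 / (1 + 256 * (M + 1)) ≤
      (r / 2 / 2) ^ 2 / ((r / 2 / 2) ^ 2 + 16 * (s - (t + (r / 2) ^ 2))) := by
    rw [div_le_div_iff₀ (by positivity) (by nlinarith [hs.1])]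
    nlinarith [hs.2]
  have h4 := pow_le_pow_left₀ (by positivity) h3 Q
  calc 1 / 16 * (1 / (1 + 256 * (M + 1))) ^ Q * h = h / 4 / 4 * (1 / (1 + 256 * (M + 1))) ^ Q := by
        ring
    _ ≤ _ := by gcongr

/-- Selection of a good radius. -/
theorem select_radius {S : Set (E n × ℝ)} (hSo : IsOpen S) {X : E n × ℝ} (hX : X ∈ S)
    {ξ R : ℝ} (hR : 0 < R)
    (hnt : ¬ volume (Cr X R \ S) ≤ ENNReal.ofReal (ξ * R ^ (n + 2))) :
    ∃ r, 0 < r ∧ r ≤ R ∧ ENNReal.ofReal (ξ * r ^ (n + 2)) ≤ volume (Cr X r \ S) ∧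
      volume (Cr X (r / 2) \ S) ≤ ENNReal.ofReal (ξ * (r / 2) ^ (n + 2)) := by
  classical
  have hex : ∃ j : ℕ, volume (Cr X (R / 2 ^ j) \ S) ≤ ENNReal.ofReal (ξ * (R / 2 ^ j) ^ (n + 2)) := by
    obtain ⟨ε, hε, hb⟩ := Metric.isOpen_iff.1 hSo X hX
    have hlim : Tendsto (fun j : ℕ => R / 2 ^ j) atTop (nhds 0) := by
      have := (tendsto_pow_atTop_nhds_zero_of_lt_one (r := (1 / 2 : ℝ)) (by norm_num)
        (by norm_num)).const_mul R
      simpa [div_eq_mul_inv] using this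
    obtain ⟨j, hj⟩ := (hlim.eventually (gt_mem_nhds (show (0 : ℝ) < min ε 1 by positivity))).exists
    refine ⟨j, ?_⟩
    have : Cr X (R / 2 ^ j) \ S = ∅ := by
      rw [diff_eq_empty]
      refine Subset.trans ?_ hb
      intro Y hY
      rw [mem_ball, Prod.dist_eq]
      have hp : 0 < R / 2 ^ j := by positivity
      have h1 := lt_min_iff.1 hj
      refine max_lt ?_ ?_
      · exact (mem_ball.1 hY.1).trans h1.1
      · rw [Real.dist_eq, abs_lt]
        have := hY.2
        have h3 : (R / 2 ^ j) ^ 2 ≤ R / 2 ^ j := by nlinarith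
        constructor <;> linarith [this.1, this.2, h1.1]
    rw [this]; simp
  have hf := Nat.find_spec hex
  have hj0 : Nat.find hex ≠ 0 := by
    intro h0
    rw [h0] at hf
    apply hnt; simpa using hf
  obtain ⟨j, hj⟩ := Nat.exists_eq_succ_of_ne_zero hj0
  have hm := Nat.find_min hex (m := j) (by omega)
  refine ⟨R / 2 ^ j, by positivity, div_le_self hR.le (one_le_pow₀ (by norm_num)),
    (not_le.1 hm).le, ?_⟩
  have e : R / 2 ^ j / 2 = R / 2 ^ (Nat.find hex) := by rw [hj, pow_succ]; field_simp
  rw [e]; exact hf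

theorem omega_pos (n : ℕ) : 0 < volume.real (ball (0 : E n) 1) := by
  rw [measureReal_def]
  exact ENNReal.toReal_pos (measure_ball_pos _ _ one_pos).ne' measure_ball_lt_top.ne

/-- Measure growth step. -/
theorem growth {S T : Set (E n × ℝ)} (hSo : IsOpen S) {ξ R M ε A B : ℝ} (hξ : 0 < ξ) (hR : 0 < R)
    (hε : 0 < ε) (hε1 : ε ≤ 1 / 2)
    (hεξ : ε ≤ ξ / (2 * volume.real (ball (0 : E n) 1) * 5 ^ (n + 2))) (hM : M = 1 + 8 / ε)
    (hnt : ∀ X ∈ S, ¬ volume (Cr X R \ S) ≤ ENNReal.ofReal (ξ * R ^ (n + 2)))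
    (hSA : ∀ X ∈ S, A ≤ X.2 ∧ X.2 ≤ B) (hTf : volume T ≠ ⊤)
    (hT : ∀ X ∈ S, ∀ r, 0 < r → r ≤ R →
      volume (Cr X (r / 2) \ S) ≤ ENNReal.ofReal (ξ * (r / 2) ^ (n + 2)) →
      ball X.1 r ×ˢ Ioo (X.2 + 2 * r ^ 2) (X.2 + (M + 1) * r ^ 2) ⊆ T) :
    (1 + ε / 2) * volume.real S ≤ volume.real T := by
  rcases S.eq_empty_or_nonempty with rfl | ⟨X0, hX0⟩
  · simp
  have hABle : A ≤ B := (hSA X0 hX0).1.trans (hSA X0 hX0).2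
  have hM1 : 1 < M := by rw [hM]; have : 0 < 8 / ε := by positivity
                         linarith
  have hsel : ∀ X : S, ∃ r, 0 < r ∧ r ≤ R ∧
      ENNReal.ofReal (ξ * r ^ (n + 2)) ≤ volume (Cr (X : E n × ℝ) r \ S) ∧
      volume (Cr (X : E n × ℝ) (r / 2) \ S) ≤ ENNReal.ofReal (ξ * (r / 2) ^ (n + 2)) :=
    fun X => select_radius hSo X.2 hR (hnt X X.2)
  choose r hr hrR hr1 hr2 using hsel
  set c : S → E n × ℝ := fun X => X with hc
  have hcov := covering c r hr hrR hSo.measurableSet (fun X hX => mem_iUnion.2 ⟨⟨X, hX⟩, by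
    refine ⟨mem_ball_self (hr ⟨X, hX⟩), ?_, ?_⟩ <;>
    · simp only [hc]; have := hr ⟨X, hX⟩; nlinarith⟩) hξ hr1
  have hrr : ∀ X, r X ^ 2 ≤ R ^ 2 := fun X => by have := hr X; have := hrR X; gcongr
  have hst := stacking c r hr (M := M) (A := A - R ^ 2) (B := B + (M + 1) * R ^ 2) hM1
    (by nlinarith) (fun X => by have := (hSA X X.2).1; have := hrr X; simp only [hc]; linarith)
    (fun X => by
      have := (hSA X X.2).2
      have h3 : (M + 1) * r X ^ 2 ≤ (M + 1) * R ^ 2 := by have := hrr X; gcongr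
      simp only [hc]; linarith)
  have hG'T : volume (⋃ i, ball (c i).1 (r i) ×ˢ
      Ioo ((c i).2 + 2 * r i ^ 2) ((c i).2 + (M + 1) * r i ^ 2)) ≤ volume T :=
    measure_mono (iUnion_subset fun X => hT X X.2 _ (hr X) (hrR X) (hr2 X))
  have hst2 := hst.trans hG'T
  set G := ⋃ i, Cr (c i) (r i) with hG
  have hst3 : ENNReal.ofReal ((M - 1) / (M + 3)) * volume G ≤ volume T := hst2
  have hα : 0 < (M - 1) / (M + 3) := div_pos (by linarith) (by linarith)
  have hGf : volume G ≠ ⊤ := by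
    intro h
    rw [h, ENNReal.mul_top (by simpa using hα)] at hst3
    exact hTf (top_le_iff.1 hst3)
  have hSf : volume S ≠ ⊤ := ne_top_of_le_ne_top hGf (le_self_add.trans hcov)
  have h1 : volume.real S + (ξ / (2 * volume.real (ball (0 : E n) 1) * 5 ^ (n + 2))) * volume.real G
      ≤ volume.real G := by
    have := ENNReal.toReal_mono hGf hcov
    rw [ENNReal.toReal_add hSf (ENNReal.mul_ne_top ENNReal.ofReal_ne_top hGf), ENNReal.toReal_mul,
      ENNReal.toReal_ofReal (by have := omega_pos n; positivity)] at this
    exact this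
  have h2 : (M - 1) / (M + 3) * volume.real G ≤ volume.real T := by
    have := ENNReal.toReal_mono hTf hst3
    rw [ENNReal.toReal_mul, ENNReal.toReal_ofReal hα.le] at this
    exact this
  have hG0 : 0 ≤ volume.real G := measureReal_nonneg
  have h3 : volume.real S ≤ (1 - ε) * volume.real G := by nlinarith
  have hαe : (M - 1) / (M + 3) = 1 / (1 + ε / 2) := by
    rw [hM]; field_simp; ring
  rw [hαe] at h2
  have h4 : (1 + ε / 2) * volume.real S ≤ (1 + ε / 2) * ((1 - ε) * volume.real G) := by gcongr
  refine h4.trans (le_trans ?_ h2)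
  rw [← mul_assoc]
  gcongr
  rw [le_div_iff₀ (by positivity)]
  nlinarith [sq_nonneg ε, pow_pos hε 3]
end

open MeasureTheory Set Metric Filter
noncomputable section
set_option maxHeartbeats 1000000
set_option linter.deprecated false
variable {n : ℕ}

theorem lemmaD (n : ℕ) {ν : ℝ} (hν : 0 < ν) {ξ' : ℝ} (hξ' : 0 < ξ') : ∃ c2 : ℝ, 0 < c2 ∧
    ∀ (u : E n × ℝ → ℝ) (x0 : E n) (t0 ρ h : ℝ), 0 < ρ → 0 < h →
    SupOn ν u (closedBall x0 (12 * ρ) ×ˢ Icc (t0 - 2 * ρ ^ 2) (t0 + 5 * ρ ^ 2)) →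
    ENNReal.ofReal (ξ' * ρ ^ (n + 2)) ≤ volume {X | X ∈ Cr (x0, t0) ρ ∧ h < u X} →
    ∀ x ∈ closedBall x0 ρ, c2 * h ≤ u (x, t0 + 5 * ρ ^ 2) := by
  obtain ⟨ξ, hξ, hA⟩ := exists_propA n hν
  obtain ⟨Q, hB⟩ := exists_propB n hν
  set ω : ℝ := volume.real (ball (0 : E n) 1) with hω
  have hωp : 0 < ω := omega_pos n
  set ε : ℝ := min (ξ / (2 * ω * 5 ^ (n + 2))) (1 / 2) with hεd
  have hε : 0 < ε := by positivity
  have hε1 : ε ≤ 1 / 2 := min_le_right _ _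
  have hεξ : ε ≤ ξ / (2 * ω * 5 ^ (n + 2)) := min_le_left _ _
  obtain ⟨M, hM⟩ : ∃ M : ℝ, M = 1 + 8 / ε := ⟨_, rfl⟩
  have hM1 : 1 ≤ M := by rw [hM]; have : 0 < 8 / ε := by positivity
                         linarith
  obtain ⟨c1, hc1⟩ : ∃ c1 : ℝ, c1 = 1 / 16 * (1 / (1 + 256 * (M + 1))) ^ Q := ⟨_, rfl⟩
  have hc1p : 0 < c1 := by rw [hc1]; positivity
  have hc1le : c1 ≤ 1 := by
    rw [hc1]
    have : (1 / (1 + 256 * (M + 1))) ^ Q ≤ 1 := by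
      apply pow_le_one₀ (by positivity)
      rw [div_le_one (by positivity)]; linarith
    linarith
  obtain ⟨c, hc⟩ : ∃ c : ℝ, c = c1 / 2 := ⟨_, rfl⟩
  have hcp : 0 < c := by rw [hc]; positivity
  have hcle : c ≤ 1 := by rw [hc]; linarith
  obtain ⟨j, hj⟩ := pow_unbounded_of_one_lt (2 * ω * 2 ^ (n + 2) / ξ')
    (show 1 < 1 + ε / 2 by linarith)
  obtain ⟨k0, hk0⟩ : ∃ k0 : ℕ, k0 = j + 1 := ⟨_, rfl⟩
  have hk01 : (1 : ℝ) ≤ k0 := by rw [hk0]; push_cast; linarith [(Nat.cast_nonneg j : (0 : ℝ) ≤ j)]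
  obtain ⟨κ, hκ⟩ : ∃ κ : ℝ, κ = 1 / (k0 * (M + 1) + 1) := ⟨_, rfl⟩
  have hκp : 0 < κ := by rw [hκ]; positivity
  have hκM : (k0 * (M + 1) + 1) * κ = 1 := by rw [hκ]; field_simp
  have hpM : 0 ≤ k0 * M * κ := by positivity
  have hpk : 0 ≤ k0 * κ := by positivity
  have hκ1 : κ ≤ 1 := by linarith
  have hk0κ : k0 * κ ≤ 1 := by linarith
  refine ⟨c ^ k0 / 16 * (κ ^ 2 / 4 / 97) ^ Q, by positivity, ?_⟩
  intro u x0 t0 ρ h hρ hh hS hvol x hx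
  have hρ2 : 0 < ρ ^ 2 := by positivity
  obtain ⟨rm, hrm⟩ : ∃ rm : ℝ, rm = κ * ρ := ⟨_, rfl⟩
  have hrmp : 0 < rm := by rw [hrm]; positivity
  have hrmρ : rm ≤ ρ := by rw [hrm]; nlinarith
  have hrm2 : rm ^ 2 ≤ ρ ^ 2 := by gcongr
  have hkr : k0 * rm ≤ ρ := by
    have h := mul_le_mul_of_nonneg_right hk0κ hρ.le
    rw [hrm]; linarith
  have hkM : k0 * (M + 1) * rm ≤ ρ := by
    have h : k0 * (M + 1) * κ ≤ 1 := by linarith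
    have h := mul_le_mul_of_nonneg_right h hρ.le
    rw [hrm]; linarith
  have hkM2 : k0 * (M + 1) * rm ^ 2 ≤ ρ ^ 2 := by
    have h := mul_le_mul hkM hrmρ hrmp.le hρ.le
    linarith
  let box : ℕ → Set (E n × ℝ) := fun k =>
    ball x0 (ρ + k * rm) ×ˢ Ioo (t0 - ρ ^ 2) (t0 + ρ ^ 2 + k * (M + 1) * rm ^ 2)
  let Ek : ℕ → Set (E n × ℝ) := fun k => box k ∩ u ⁻¹' Ioi (c ^ k * h)
  have hbox : ∀ k ≤ k0, ∀ X ∈ box k, ‖X.1 - x0‖ < 2 * ρ ∧ t0 - ρ ^ 2 < X.2 ∧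
      X.2 < t0 + 2 * ρ ^ 2 := by
    intro k hk X hX
    have hkk : (k : ℝ) ≤ k0 := by exact_mod_cast hk
    have h1 := hX.1
    rw [mem_ball, dist_eq_norm] at h1
    have h2 : k * rm ≤ k0 * rm := by gcongr
    have h3 : k * (M + 1) * rm ^ 2 ≤ k0 * (M + 1) * rm ^ 2 := by gcongr
    exact ⟨by linarith, hX.2.1, by linarith [hX.2.2]⟩
  have hEo : ∀ k ≤ k0, IsOpen (Ek k) := by
    intro k hk
    refine (hS.1.mono ?_).isOpen_inter_preimage (isOpen_ball.prod isOpen_Ioo) isOpen_Ioi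
    intro X hX
    obtain ⟨h1, h2, h3⟩ := hbox k hk X hX
    refine ⟨?_, by linarith, by linarith⟩
    rw [mem_closedBall, dist_eq_norm]; linarith
  have hterm : ∃ k ≤ k0, ∃ X ∈ Ek k, volume (Cr X rm \ Ek k) ≤ ENNReal.ofReal (ξ * rm ^ (n + 2)) := by
    by_contra! hno
    have hsub : ∀ k ≤ k0, Ek k ⊆ Cr (x0, t0) (2 * ρ) := by
      intro k hk X hX
      obtain ⟨h1, h2, h3⟩ := hbox k hk X hX.1
      refine ⟨by rw [mem_ball, dist_eq_norm]; exact h1, ?_, ?_⟩ <;> simp only <;> linarith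
    have hCf : volume (Cr (x0, t0) (2 * ρ)) ≠ ⊤ := by
      rw [Cr_volume _ (by positivity)]; exact ENNReal.ofReal_ne_top
    have hfin : ∀ k ≤ k0, volume (Ek k) ≠ ⊤ := fun k hk =>
      ne_top_of_le_ne_top hCf (measure_mono (hsub k hk))
    have hstep : ∀ k, k + 1 ≤ k0 → (1 + ε / 2) * volume.real (Ek k) ≤ volume.real (Ek (k + 1)) := by
      intro k hk
      refine growth (hEo k (by omega)) hξ hrmp hε hε1 hεξ hM
        (fun X hX => not_le.2 (hno k (by omega) X hX)) (A := t0 - ρ ^ 2) (B := t0 + 2 * ρ ^ 2)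
        (fun X hX => ?_) (hfin _ hk) ?_
      · obtain ⟨h1, h2, h3⟩ := hbox k (by omega) X hX.1
        exact ⟨h2.le, h3.le⟩
      · intro X hX r hr hrr hv Y hY
        obtain ⟨h1, h2, h3⟩ := hbox k (by omega) X hX.1
        have hr2 : r ^ 2 ≤ rm ^ 2 := by gcongr
        have hMr2 : (M + 1) * r ^ 2 ≤ (M + 1) * rm ^ 2 := by gcongr
        have hM2 : (M + 1) * rm ^ 2 ≤ k0 * (M + 1) * rm ^ 2 := by
          have : 0 ≤ (M + 1) * rm ^ 2 := by positivity
          nlinarith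
        have hYx := hY.1
        have hY2 := hY.2
        have hXx := hX.1.1
        have hX2 := hX.1.2
        refine ⟨⟨?_, ?_, ?_⟩, ?_⟩
        · rw [mem_ball] at hYx hXx ⊢
          have := dist_triangle Y.1 X.1 x0
          push_cast; linarith
        · linarith [hY2.1, sq_nonneg r]
        · push_cast; linarith [hY2.2, hX2.2]
        · have hMrm : (M + 1) * rm ≤ ρ := by
            have : 0 ≤ (M + 1) * rm := by positivity
            nlinarith
          have := lemmaAB hA hB hM1 (u := u) (x := X.1) (t := X.2) (r := r) (h := c ^ k * h) hr
            (by positivity) (hS.mono (by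
              intro Z hZ
              have hZ1 := hZ.1
              have hZ2 := hZ.2
              rw [mem_closedBall, dist_eq_norm] at hZ1
              refine ⟨?_, ?_, ?_⟩
              · rw [mem_closedBall, dist_eq_norm]
                have := norm_sub_le_norm_sub_add_norm_sub Z.1 X.1 x0
                have : (M + 2) * r ≤ (M + 2) * rm := by gcongr
                linarith
              · linarith [hZ2.1]
              · linarith [hZ2.2])) (le_trans (measure_mono (by
              intro Z hZ
              refine ⟨hZ.1, fun hZE => ?_⟩
              have h5 := hZE.2
              simp only [mem_preimage, mem_Ioi] at h5
              linarith [hZ.2])) hv) hYx ⟨hY2.1.le, hY2.2.le⟩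
          rw [← hc1] at this
          have h6 : c ^ (k + 1) * h < c1 * (c ^ k * h) := by
            rw [pow_succ, hc]
            have : 0 < (c1 / 2) ^ k * h := by positivity
            nlinarith
          exact lt_of_lt_of_le h6 this
    have hgrow : ∀ k ≤ k0, (1 + ε / 2) ^ k * (ξ' * ρ ^ (n + 2)) ≤ volume.real (Ek k) := by
      intro k
      induction k with
      | zero =>
        intro _
        have : Ek 0 = {X | X ∈ Cr (x0, t0) ρ ∧ h < u X} := by
          ext X
          simp [Ek, box, Cr, CRr]
        rw [pow_zero, one_mul, this, measureReal_def,
          ← ENNReal.toReal_ofReal (show 0 ≤ ξ' * ρ ^ (n + 2) by positivity)]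
        refine ENNReal.toReal_mono ?_ hvol
        rw [← this]; exact hfin 0 (by omega)
      | succ k ih =>
        intro hk
        refine le_trans ?_ (hstep k hk)
        rw [pow_succ]
        have := ih (by omega)
        nlinarith
    have h1 := hgrow k0 le_rfl
    have h2 : volume.real (Ek k0) ≤ 2 * ω * (2 * ρ) ^ (n + 2) := by
      have := ENNReal.toReal_mono hCf (measure_mono (hsub k0 le_rfl))
      rw [Cr_volume _ (by positivity), ENNReal.toReal_ofReal (by positivity)] at this
      exact this
    have h3 : (1 + ε / 2) ^ j ≤ (1 + ε / 2) ^ k0 := by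
      apply pow_le_pow_right₀ (by linarith); omega
    rw [div_lt_iff₀ hξ'] at hj
    have h4 : 2 * ω * (2 * ρ) ^ (n + 2) < (1 + ε / 2) ^ k0 * (ξ' * ρ ^ (n + 2)) := by
      rw [mul_pow]
      have h5 : 2 * ω * 2 ^ (n + 2) < (1 + ε / 2) ^ k0 * ξ' := by nlinarith
      have h6 : 0 < ρ ^ (n + 2) := by positivity
      nlinarith
    linarith
  obtain ⟨k, hk, X, hX, hv⟩ := hterm
  obtain ⟨h1, h2, h3⟩ := hbox k hk X hX.1
  have hA1 := hA u X.1 X.2 rm (c ^ k * h) hrmp (by positivity) (hS.mono (by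
      intro Z hZ
      have hZ1 := hZ.1
      have hZ2 := hZ.2
      rw [mem_closedBall, dist_eq_norm] at hZ1
      refine ⟨?_, ?_, ?_⟩
      · rw [mem_closedBall, dist_eq_norm]
        have := norm_sub_le_norm_sub_add_norm_sub Z.1 X.1 x0
        linarith
      · linarith [hZ2.1]
      · linarith [hZ2.2])) (le_trans (measure_mono (by
      intro Z hZ
      refine ⟨hZ.1, fun hZE => ?_⟩
      have h5 := hZE.2
      simp only [mem_preimage, mem_Ioi] at h5
      linarith [hZ.2])) hv)
  have hB1 := hB u X.1 (X.2 + rm ^ 2) (t0 + 5 * ρ ^ 2) (rm / 2) (10 * ρ) (c ^ k * h / 4)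
    (by positivity) (by positivity) (by positivity) (by linarith [sq_nonneg rm]) (hS.mono (by
      intro Z hZ
      have hZ1 := hZ.1
      have hZ2 := hZ.2
      rw [mem_closedBall, dist_eq_norm] at hZ1
      refine ⟨?_, ?_, ?_⟩
      · rw [mem_closedBall, dist_eq_norm]
        have := norm_sub_le_norm_sub_add_norm_sub Z.1 X.1 x0
        linarith
      · linarith [hZ2.1, sq_nonneg rm]
      · linarith [hZ2.2])) hA1 (t0 + 5 * ρ ^ 2) ⟨by linarith, le_rfl⟩ x (by
      rw [mem_closedBall, dist_eq_norm] at hx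
      have h5 : ‖x - X.1‖ ≤ 3 * ρ := by
        have := norm_sub_le_norm_sub_add_norm_sub x x0 X.1
        rw [norm_sub_rev x0 X.1] at this
        linarith
      have h6 : ‖x - X.1‖ ^ 2 ≤ (3 * ρ) ^ 2 := by gcongr
      linarith [sq_nonneg rm])
  refine le_trans ?_ hB1
  have h7 : κ ^ 2 / 4 / 97 ≤ (rm / 2) ^ 2 / ((rm / 2) ^ 2 + 16 * (t0 + 5 * ρ ^ 2 - (X.2 + rm ^ 2))) := by
    rw [div_le_div_iff₀ (by norm_num) (by linarith [sq_nonneg rm, pow_pos hrmp 2])]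
    have h8 : rm ^ 2 = κ ^ 2 * ρ ^ 2 := by rw [hrm]; ring
    have h9 : (rm / 2) ^ 2 + 16 * (t0 + 5 * ρ ^ 2 - (X.2 + rm ^ 2)) ≤ 97 * ρ ^ 2 := by linarith [sq_nonneg rm]
    have h10 : 0 ≤ κ ^ 2 := by positivity
    calc _ ≤ κ ^ 2 / 4 * (97 * ρ ^ 2) := by gcongr
      _ = _ := by rw [div_pow, h8]; ring
  have h8 := pow_le_pow_left₀ (by positivity) h7 Q
  have h9 : c ^ k0 ≤ c ^ k := pow_le_pow_of_le_one hcp.le hcle hk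
  calc c ^ k0 / 16 * (κ ^ 2 / 4 / 97) ^ Q * h = c ^ k0 * h / 4 / 4 * (κ ^ 2 / 4 / 97) ^ Q := by ring
    _ ≤ _ := by gcongr
end

open MeasureTheory Set Metric Filter
noncomputable section
set_option maxHeartbeats 1000000
set_option linter.deprecated false
variable {n : ℕ}

/-- Interior Harnack inequality. -/
theorem harnack (n : ℕ) {ν : ℝ} (hν : 0 < ν) : ∃ C : ℝ, 0 < C ∧
    ∀ (u : E n × ℝ → ℝ) (x0 : E n) (t0 ρ : ℝ), 0 < ρ →
    SupOn ν u (closedBall x0 (12 * ρ) ×ˢ Icc (t0 - 2 * ρ ^ 2) (t0 + 2 * ρ ^ 2)) →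
    (∀ X ∈ closedBall x0 (12 * ρ) ×ˢ Icc (t0 - 2 * ρ ^ 2) (t0 + 2 * ρ ^ 2), SubAt ν u X) →
    ∀ x ∈ closedBall x0 ρ, ∀ τ ∈ Icc (ρ ^ 2) (2 * ρ ^ 2), u (x0, t0) ≤ C * u (x, t0 + τ) := by
  obtain ⟨ξ, hξ, hA⟩ := exists_propA n hν
  obtain ⟨Q, hB⟩ := exists_propB n hν
  obtain ⟨c2, hc2, hD⟩ := lemmaD n hν hξ
  obtain ⟨p, hp⟩ : ∃ p : ℕ, p = 2 * Q + 2 := ⟨_, rfl⟩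
  obtain ⟨β, hβ⟩ : ∃ β : ℝ, β = 1 / (18 * (p + 1)) := ⟨_, rfl⟩
  have hβp : 0 < β := by rw [hβ]; positivity
  have hβe : 18 * (p + 1) * β = 1 := by rw [hβ]; field_simp
  have hpβ : 0 ≤ p * β := by positivity
  have hβ1 : β ≤ 1 / 18 := by linarith
  have hβpow : 8 / 9 ≤ (1 - 2 * β) ^ p := by
    have := one_add_mul_le_pow (show -2 ≤ -(2 * β) by linarith) p
    have e : 1 - 2 * β = 1 + -(2 * β) := by ring
    rw [e]; refine le_trans ?_ this
    linarith
  refine ⟨12 / c2 * (49 / β ^ 2) ^ Q, by positivity, ?_⟩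
  intro u x0 t0 ρ hρ hS hSub x hx τ hτ
  have hρ2 : 0 < ρ ^ 2 := by positivity
  let d : E n × ℝ → ℝ := fun X => min (ρ - ‖X.1 - x0‖) (Real.sqrt (X.2 - t0 + ρ ^ 2))
  have hdd : ∀ X, d X = min (ρ - ‖X.1 - x0‖) (Real.sqrt (X.2 - t0 + ρ ^ 2)) := fun _ => rfl
  have hd : Continuous d := by
    refine Continuous.min (by fun_prop) ?_
    exact Real.continuous_sqrt.comp (by fun_prop)
  let K : Set (E n × ℝ) := closedBall x0 ρ ×ˢ Icc (t0 - ρ ^ 2) t0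
  have hK : IsCompact K := (isCompact_closedBall x0 ρ).prod isCompact_Icc
  have hKS : K ⊆ closedBall x0 (12 * ρ) ×ˢ Icc (t0 - 2 * ρ ^ 2) (t0 + 2 * ρ ^ 2) := by
    apply Set.prod_mono
    · apply closedBall_subset_closedBall; linarith
    · apply Icc_subset_Icc <;> linarith
  have h0K : (x0, t0) ∈ K := ⟨mem_closedBall_self hρ.le, by simp only; linarith, le_rfl⟩
  have hxu : 0 ≤ u (x, t0 + τ) := by
    apply hS.2.1
    refine ⟨closedBall_subset_closedBall (by linarith) hx, ?_, ?_⟩ <;> simp only <;>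
      linarith [hτ.1, hτ.2]
  obtain ⟨X1, hX1, hmax⟩ := hK.exists_isMaxOn ⟨_, h0K⟩
    (f := fun X => d X ^ p * u X) ((hd.pow p).continuousOn.mul (hS.1.mono hKS))
  have hd0 : d (x0, t0) = ρ := by
    simp only [d, sub_self, norm_zero, sub_zero, zero_add, Real.sqrt_sq hρ.le, min_self]
  have hdK : ∀ X ∈ K, 0 ≤ d X := by
    intro X hX
    have := hX.1
    rw [mem_closedBall, dist_eq_norm] at this
    exact le_min (by linarith) (Real.sqrt_nonneg _)
  obtain ⟨h, hh⟩ : ∃ h, h = u X1 := ⟨_, rfl⟩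
  obtain ⟨d1, hd1⟩ : ∃ d1, d1 = d X1 := ⟨_, rfl⟩
  have hmax' : ∀ X ∈ K, d X ^ p * u X ≤ d1 ^ p * h := by
    intro X hX; rw [hh, hd1]; exact hmax hX
  have hm0 : ρ ^ p * u (x0, t0) ≤ d1 ^ p * h := by
    have := hmax' _ h0K
    rwa [hd0] at this
  have hh0 : 0 ≤ h := by rw [hh]; exact hS.2.1 _ (hKS hX1)
  have hd10 : 0 ≤ d1 := by rw [hd1]; exact hdK _ hX1
  by_cases hz : u (x0, t0) ≤ 0
  · refine hz.trans (mul_nonneg (by positivity) hxu)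
  push Not at hz
  have hpos : 0 < d1 ^ p * h := lt_of_lt_of_le (by positivity) hm0
  have hhp : 0 < h := by
    rcases hh0.eq_or_lt with e | e
    · rw [← e, mul_zero] at hpos; exact absurd hpos (lt_irrefl _)
    · exact e
  have hd1p : 0 < d1 := by
    rcases hd10.eq_or_lt with e | e
    · rw [← e, zero_pow (by omega), zero_mul] at hpos; exact absurd hpos (lt_irrefl _)
    · exact e
  have hX1a : ‖X1.1 - x0‖ ≤ ρ - d1 := by
    have : d1 ≤ ρ - ‖X1.1 - x0‖ := by rw [hd1]; exact min_le_left _ _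
    linarith
  have hd1ρ : d1 ≤ ρ := by linarith [norm_nonneg (X1.1 - x0)]
  have hX1b : d1 ^ 2 ≤ X1.2 - t0 + ρ ^ 2 := by
    have : d1 ≤ Real.sqrt (X1.2 - t0 + ρ ^ 2) := by rw [hd1]; exact min_le_right _ _
    rwa [Real.le_sqrt hd10 (by linarith [hX1.2.1])] at this
  have hX1t : X1.2 ≤ t0 := hX1.2.2
  have hX1t' : t0 - ρ ^ 2 ≤ X1.2 := hX1.2.1
  clear_value d
  obtain ⟨r, hr⟩ : ∃ r, r = β * d1 := ⟨_, rfl⟩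
  have hrp : 0 < r := by rw [hr]; positivity
  have hrd : r ≤ d1 / 18 := by rw [hr]; nlinarith
  have hr2d : 18 * r ^ 2 ≤ ρ ^ 2 := by nlinarith
  have hr2p : 0 < r ^ 2 := by positivity
  have hcyl : closedBall X1.1 r ×ˢ Icc (X1.2 - 2 * r ^ 2) X1.2 ⊆ K := by
    intro X hX
    have h1 := hX.1
    rw [mem_closedBall, dist_eq_norm] at h1
    refine ⟨?_, ?_, ?_⟩
    · rw [mem_closedBall, dist_eq_norm]
      have := norm_sub_le_norm_sub_add_norm_sub X.1 X1.1 x0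
      linarith
    · have := hX.2.1
      have : r ^ 2 ≤ (d1 / 18) ^ 2 := by gcongr
      linarith [sq_nonneg d1]
    · linarith [hX.2.2]
  have hdc : ∀ X ∈ closedBall X1.1 r ×ˢ Icc (X1.2 - 2 * r ^ 2) X1.2, (1 - 2 * β) * d1 ≤ d X := by
    intro X hX
    have h1 := hX.1
    rw [mem_closedBall, dist_eq_norm] at h1
    rw [hdd]
    refine le_min ?_ (Real.le_sqrt_of_sq_le ?_)
    · have := norm_sub_le_norm_sub_add_norm_sub X.1 X1.1 x0
      have : 0 ≤ β * d1 := by positivity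
      rw [hr] at h1
      linarith
    · have h2 := hX.2.1
      have h3 : r ^ 2 = β ^ 2 * d1 ^ 2 := by rw [hr]; ring
      have h4 : β ^ 2 * d1 ^ 2 ≤ β / 18 * d1 ^ 2 := by
        have : β ^ 2 ≤ β / 18 := by nlinarith
        gcongr
      have h5 : 0 ≤ β * d1 ^ 2 := by positivity
      have h6 : ((1 - 2 * β) * d1) ^ 2 = d1 ^ 2 - 4 * (β * d1 ^ 2) + 4 * (β ^ 2 * d1 ^ 2) := by ring
      rw [h6]
      linarith
  have hub : ∀ X ∈ closedBall X1.1 r ×ˢ Icc (X1.2 - 2 * r ^ 2) X1.2, u X ≤ 9 / 8 * h := by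
    intro X hX
    have h1 := hdc X hX
    have h2 := hmax' X (hcyl hX)
    have hu0 : 0 ≤ u X := hS.2.1 _ (hKS (hcyl hX))
    have h3 : ((1 - 2 * β) * d1) ^ p ≤ d X ^ p := by
      apply pow_le_pow_left₀ _ h1
      exact mul_nonneg (by linarith) hd10
    have h4 : 8 / 9 * d1 ^ p * u X ≤ d1 ^ p * h := by
      refine le_trans ?_ h2
      refine mul_le_mul_of_nonneg_right (le_trans ?_ h3) hu0
      rw [mul_pow]
      gcongr
    have h5 : d1 ^ p * (8 / 9 * u X) ≤ d1 ^ p * h := by linarith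
    have h6 := le_of_mul_le_mul_left h5 (by positivity)
    linarith
  have e1 : X1.2 - r ^ 2 + r ^ 2 = X1.2 := by ring
  have e2 : X1.2 - r ^ 2 - r ^ 2 = X1.2 - 2 * r ^ 2 := by ring
  have hvol : ENNReal.ofReal (ξ * r ^ (n + 2)) ≤
      volume {X | X ∈ Cr (X1.1, X1.2 - r ^ 2) r ∧ h / 3 < u X} := by
    by_contra hcon
    push Not at hcon
    have h1 := hA (fun X => 9 / 8 * h - u X) X1.1 (X1.2 - r ^ 2) r (5 / 8 * h) hrp (by positivity)
      (by
        rw [e1, e2]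
        refine ⟨continuousOn_const.sub (hS.1.mono (hcyl.trans hKS)), fun X hX => ?_, fun X hX => ?_⟩
        · linarith [hub X hX]
        · exact (hSub X (hKS (hcyl hX))).const_sub _) (le_trans (measure_mono (by
        intro X hX
        refine ⟨hX.1, ?_⟩
        linarith [hX.2])) hcon.le) X1.1 (mem_closedBall_self (by positivity))
    rw [e1] at h1
    simp only [Prod.mk.eta, ← hh] at h1
    linarith
  have hD1 := hD u X1.1 (X1.2 - r ^ 2) r (h / 3) hrp (by positivity) (hS.mono (by
      intro X hX
      have h1 := hX.1
      rw [mem_closedBall, dist_eq_norm] at h1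
      refine ⟨?_, ?_, ?_⟩
      · rw [mem_closedBall, dist_eq_norm]
        have := norm_sub_le_norm_sub_add_norm_sub X.1 X1.1 x0
        linarith
      · linarith [hX.2.1]
      · linarith [hX.2.2])) hvol
  have hB1 := hB u X1.1 (X1.2 - r ^ 2 + 5 * r ^ 2) (t0 + τ) r (8 * ρ) (c2 * (h / 3)) hrp
    (by positivity) (by positivity) (by linarith [hτ.2]) (hS.mono (by
      intro X hX
      have h1 := hX.1
      rw [mem_closedBall, dist_eq_norm] at h1
      refine ⟨?_, ?_, ?_⟩
      · rw [mem_closedBall, dist_eq_norm]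
        have := norm_sub_le_norm_sub_add_norm_sub X.1 X1.1 x0
        linarith
      · linarith [hX.2.1]
      · linarith [hX.2.2, hτ.2])) hD1 (t0 + τ) ⟨by linarith [hτ.1], le_rfl⟩ x (by
      rw [mem_closedBall, dist_eq_norm] at hx
      have h5 : ‖x - X1.1‖ ≤ 2 * ρ := by
        have := norm_sub_le_norm_sub_add_norm_sub x x0 X1.1
        rw [norm_sub_rev x0 X1.1] at this
        linarith
      have h6 : ‖x - X1.1‖ ^ 2 ≤ (2 * ρ) ^ 2 := by gcongr
      linarith [hτ.1])
  have hrat : β ^ 2 / 49 * (d1 / ρ) ^ 2 ≤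
      r ^ 2 / (r ^ 2 + 16 * (t0 + τ - (X1.2 - r ^ 2 + 5 * r ^ 2))) := by
    rw [le_div_iff₀ (by linarith [hτ.1])]
    have h9 : r ^ 2 + 16 * (t0 + τ - (X1.2 - r ^ 2 + 5 * r ^ 2)) ≤ 49 * ρ ^ 2 := by
      linarith [hτ.2]
    calc _ ≤ β ^ 2 / 49 * (d1 / ρ) ^ 2 * (49 * ρ ^ 2) := by gcongr
      _ = r ^ 2 := by rw [hr]; field_simp
  have h8 := pow_le_pow_left₀ (by positivity) hrat Q
  have h9 : u (x0, t0) ≤ (d1 / ρ) ^ (2 * Q) * h := by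
    have h10 : (d1 / ρ) ^ p ≤ (d1 / ρ) ^ (2 * Q) := by
      apply pow_le_pow_of_le_one (by positivity) _ (by omega)
      rw [div_le_one hρ]; exact hd1ρ
    have h11 : u (x0, t0) ≤ (d1 / ρ) ^ p * h := by
      rw [div_pow, div_mul_eq_mul_div, le_div_iff₀ (by positivity)]
      linarith
    exact h11.trans (by gcongr)
  have h12 : c2 * (h / 3) / 4 * ((β ^ 2 / 49) ^ Q * (d1 / ρ) ^ (2 * Q)) ≤ u (x, t0 + τ) := by
    refine le_trans ?_ hB1
    rw [pow_mul, ← mul_pow]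
    gcongr
  calc u (x0, t0) ≤ (d1 / ρ) ^ (2 * Q) * h := h9
    _ = 12 / c2 * (49 / β ^ 2) ^ Q * (c2 * (h / 3) / 4 * ((β ^ 2 / 49) ^ Q * (d1 / ρ) ^ (2 * Q))) := by
        have : (49 / β ^ 2) ^ Q * (β ^ 2 / 49) ^ Q = 1 := by
          rw [← mul_pow]
          have : 49 / β ^ 2 * (β ^ 2 / 49) = 1 := by field_simp
          rw [this, one_pow]
        calc _ = ((49 / β ^ 2) ^ Q * (β ^ 2 / 49) ^ Q) * ((d1 / ρ) ^ (2 * Q) * h) := by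
              rw [this, one_mul]
          _ = _ := by field_simp; norm_num
    _ ≤ _ := by gcongr
end

open MeasureTheory Set Metric Filter
noncomputable section
set_option maxHeartbeats 1000000
set_option linter.deprecated false
variable {n : ℕ}

/-- Nonnegative solution data, vanishing on the lateral boundary. -/
structure Sol (ν : ℝ) (Ω : Set (E n)) (u : E n × ℝ → ℝ) : Prop where
  op : IsOpen Ω
  cont : ContinuousOn u (closure Ω ×ˢ Ioi (0 : ℝ))
  nonneg : ∀ X ∈ Ω ×ˢ Ioi (0 : ℝ), 0 ≤ u X
  bd : ∀ Z ∈ frontier Ω ×ˢ Ioi (0 : ℝ), u Z = 0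
  sup : ∀ X ∈ Ω ×ˢ Ioi (0 : ℝ), SupAt ν u X
  sub : ∀ X ∈ Ω ×ˢ Ioi (0 : ℝ), SubAt ν u X

theorem Sol.supOn {ν : ℝ} {Ω : Set (E n)} {u : E n × ℝ → ℝ} (h : Sol ν Ω u) {S : Set (E n × ℝ)}
    (hS : S ⊆ Ω ×ˢ Ioi (0 : ℝ)) : SupOn ν u S :=
  ⟨h.cont.mono (hS.trans (Set.prod_mono subset_closure le_rfl)), fun X hX => h.nonneg X (hS hX),
    fun X hX => h.sup X (hS hX)⟩

/-- Harnack chain along a segment. -/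
theorem chain (n : ℕ) {ν : ℝ} (hν : 0 < ν) {a b : ℝ} (ha : 0 ≤ a) (hb : 0 < b) : ∃ C : ℝ, 1 ≤ C ∧
    ∀ (Ω : Set (E n)) (u : E n × ℝ → ℝ), Sol ν Ω u → ∀ (x y : E n) (d T t : ℝ), 0 < d →
    ‖y - x‖ ≤ a * d → b * d ^ 2 ≤ T → T ≤ a * d ^ 2 → b * d ^ 2 ≤ t →
    (∀ θ ∈ Icc (0 : ℝ) 1, ball (x + θ • (y - x)) d ⊆ Ω) → u (x, t) ≤ C * u (y, t + T) := by
  obtain ⟨C, hC, H⟩ := harnack n hν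
  obtain ⟨N, hN⟩ := exists_nat_gt (144 * a + a ^ 2 / b + 2 * a / b + 1)
  have h1 : 0 ≤ a ^ 2 / b := by positivity
  have h2 : 0 ≤ 2 * a / b := by positivity
  have hN1 : 1 < (N : ℝ) := by linarith
  have hN0 : 0 < (N : ℝ) := by linarith
  refine ⟨(max C 1) ^ N, one_le_pow₀ (le_max_right _ _), ?_⟩
  intro Ω u hu x y d T t hd hxy hT1 hT2 ht hseg
  have hd2 : 0 < d ^ 2 := by positivity
  have hbd : 0 < b * d ^ 2 := by positivity
  obtain ⟨q, hq⟩ : ∃ q, q = T / N := ⟨_, rfl⟩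
  have hqN : N * q = T := by rw [hq]; field_simp
  have hqp : 0 < q := by rw [hq]; exact div_pos (by linarith) hN0
  obtain ⟨ρ, hρ⟩ : ∃ ρ, ρ = Real.sqrt q := ⟨_, rfl⟩
  have hρp : 0 < ρ := by rw [hρ]; exact Real.sqrt_pos.2 hqp
  have hρ2 : ρ ^ 2 = q := by rw [hρ]; exact Real.sq_sqrt hqp.le
  have hρd : 12 * ρ < d := by
    apply lt_of_pow_lt_pow_left₀ 2 hd.le
    rw [mul_pow, hρ2, hq, ← mul_div_assoc, div_lt_iff₀ hN0]
    have : 144 * a * d ^ 2 < N * d ^ 2 := by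
      apply mul_lt_mul_of_pos_right _ hd2; linarith
    linarith
  have hstep : ‖y - x‖ ≤ N * ρ := by
    apply le_of_sq_le_sq _ (by positivity)
    have e1 : ‖y - x‖ ^ 2 ≤ (a * d) ^ 2 := by gcongr
    have e2 : a ^ 2 ≤ N * b := by
      have : a ^ 2 / b ≤ N := by linarith
      rwa [div_le_iff₀ hb] at this
    have e3 : a ^ 2 * d ^ 2 ≤ N * b * d ^ 2 := by gcongr
    have e4 : N * (b * d ^ 2) ≤ N * T := by gcongr
    rw [mul_pow, hρ2]
    calc _ ≤ _ := e1
      _ = a ^ 2 * d ^ 2 := by ring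
      _ ≤ _ := e3
      _ ≤ N * T := by linarith
      _ = _ := by rw [← hqN]; ring
  have hqt : 2 * q < t := by
    have e2 : 2 * a < N * b := by
      have : 2 * a / b < N := by linarith
      rwa [div_lt_iff₀ hb] at this
    have e3 : 2 * a * d ^ 2 < N * b * d ^ 2 := by gcongr
    have : N * (2 * q) < N * t := by
      have : N * (b * d ^ 2) ≤ N * t := by gcongr
      linarith
    exact lt_of_mul_lt_mul_left this hN0.le
  have key : ∀ k : ℕ, k ≤ N → u (x, t) ≤ (max C 1) ^ k * u (x + ((k : ℝ) / N) • (y - x), t + k * q) := by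
    intro k
    induction k with
    | zero => intro _; simp
    | succ k ih =>
      intro hk
      refine (ih (by omega)).trans ?_
      rw [pow_succ, mul_assoc]
      refine mul_le_mul_of_nonneg_left ?_ (by positivity)
      have hkN : (k : ℝ) + 1 ≤ N := by exact_mod_cast hk
      have hk0 : (0 : ℝ) ≤ k := Nat.cast_nonneg k
      have hkq : 0 ≤ k * q := by positivity
      have hsub : closedBall (x + ((k : ℝ) / N) • (y - x)) (12 * ρ) ×ˢ
          Icc (t + k * q - 2 * ρ ^ 2) (t + k * q + 2 * ρ ^ 2) ⊆ Ω ×ˢ Ioi (0 : ℝ) := by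
        apply Set.prod_mono
        · refine (closedBall_subset_ball hρd).trans (hseg _ ⟨by positivity, ?_⟩)
          rw [div_le_one hN0]; linarith
        · intro s hs
          rw [hρ2] at hs
          exact mem_Ioi.2 (by linarith [hs.1])
      have hH := H u (x + ((k : ℝ) / N) • (y - x)) (t + k * q) ρ hρp (hu.supOn hsub)
        (fun X hX => hu.sub X (hsub hX)) (x + (((k + 1 : ℕ) : ℝ) / N) • (y - x)) (by
          rw [mem_closedBall, dist_eq_norm]
          have e : x + (((k + 1 : ℕ) : ℝ) / N) • (y - x) - (x + ((k : ℝ) / N) • (y - x)) =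
              (1 / (N : ℝ)) • (y - x) := by
            rw [add_sub_add_left_eq_sub, ← sub_smul]; congr 1; push_cast; ring
          rw [e, norm_smul, Real.norm_of_nonneg (by positivity), one_div, inv_mul_le_iff₀ hN0]
          exact hstep) q (by rw [hρ2]; constructor <;> linarith)
      have e2 : t + k * q + q = t + ((k + 1 : ℕ) : ℝ) * q := by push_cast; ring
      rw [e2] at hH
      refine hH.trans (mul_le_mul_of_nonneg_right (le_max_left _ _) ?_)
      apply hu.nonneg
      refine ⟨hseg _ ⟨by positivity, ?_⟩ (mem_ball_self hd), ?_⟩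
      · rw [div_le_one hN0]; push_cast; linarith
      · exact mem_Ioi.2 (by have : 0 < t := by linarith
                            positivity)
  have := key N le_rfl
  rw [hqN, div_self hN0.ne', one_smul, add_sub_cancel] at this
  exact this
end

open MeasureTheory Set Metric Filter
noncomputable section
set_option maxHeartbeats 1000000
set_option linter.deprecated false
variable {n : ℕ}

/-- Graph chart of `Ω` near `y`: `h` is a Lipschitz defining function, `e` the vertical direction. -/
structure Chart (Ω : Set (E n)) (L R : ℝ) (y e : E n) (h : E n → ℝ) : Prop where
  L1 : 1 ≤ L
  ne : ‖e‖ = 1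
  lip : ∀ z z', |h z - h z'| ≤ L * ‖z - z'‖
  shift : ∀ z (s : ℝ), h (z + s • e) = h z + s
  base : h y = 0
  mem : ∀ z, ‖z - y‖ < R → (z ∈ Ω ↔ 0 < h z)

theorem Chart.depth {Ω : Set (E n)} {L R : ℝ} {y e : E n} {h : E n → ℝ} (H : Chart Ω L R y e h)
    {z : E n} {s : ℝ} (h1 : ‖z - y‖ + s ≤ R) (h2 : L * s ≤ h z) : ball z s ⊆ Ω := by
  intro w hw
  rw [mem_ball, dist_eq_norm] at hw
  have hL := H.L1
  have e1 := norm_sub_le_norm_sub_add_norm_sub w z y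
  rw [H.mem w (by linarith)]
  have e2 := (abs_le.1 (H.lip w z)).1
  have e3 : L * ‖w - z‖ < L * s := mul_lt_mul_of_pos_left hw (by linarith)
  linarith

theorem Chart.h_ge {Ω : Set (E n)} {L R : ℝ} {y e : E n} {h : E n → ℝ} (H : Chart Ω L R y e h)
    {z : E n} {s : ℝ} (h1 : ‖z - y‖ + s ≤ R) (h2 : ball z s ⊆ Ω) (hs : 0 < s) : s ≤ h z := by
  by_contra hcon
  push Not at hcon
  have hz : 0 < h z := (H.mem z (by linarith)).1 (h2 (mem_ball_self hs))
  have e0 : ‖(-(h z)) • e‖ = h z := by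
    rw [norm_smul, H.ne, mul_one, norm_neg, Real.norm_of_nonneg hz.le]
  have hw : z + (-(h z)) • e ∈ Ω := h2 (by rw [mem_ball, dist_eq_norm, add_sub_cancel_left, e0]; exact hcon)
  have e1 : ‖z + (-(h z)) • e - y‖ < R := by
    have := norm_add_le (z - y) ((-(h z)) • e)
    rw [e0] at this
    have e2 : z + (-(h z)) • e - y = z - y + (-(h z)) • e := by abel
    rw [e2]; linarith
  have := (H.mem _ e1).1 hw
  rw [H.shift] at this
  linarith

theorem Chart.ext {Ω : Set (E n)} {L R : ℝ} {y e : E n} {h : E n → ℝ} (H : Chart Ω L R y e h)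
    {w : ℝ} (hw : 0 < w) (hwR : 2 * w ≤ R) {x : E n} (hx : x ∈ Ω) : w / L ≤ ‖x - (y + (-w) • e)‖ := by
  by_contra hcon
  push Not at hcon
  have hL := H.L1
  have hL0 : 0 < L := by linarith
  have e0 : ‖(-w) • e‖ = w := by
    rw [norm_smul, H.ne, mul_one, norm_neg, Real.norm_of_nonneg hw.le]
  have hwL : w / L ≤ w := div_le_self hw.le hL
  have e1 : ‖x - y‖ < R := by
    have := norm_add_le (x - (y + (-w) • e)) ((-w) • e)
    rw [e0] at this
    have e2 : x - (y + (-w) • e) + (-w) • e = x - y := by abel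
    rw [e2] at this; linarith
  have h3 := (H.mem x e1).1 hx
  have h4 := (abs_le.1 (H.lip x (y + (-w) • e))).2
  rw [H.shift, H.base] at h4
  have h5 : L * ‖x - (y + (-w) • e)‖ < L * (w / L) := mul_lt_mul_of_pos_left hcon hL0
  rw [mul_div_cancel₀ _ hL0.ne'] at h5
  linarith

theorem chart_of_lipschitz {hn : 0 < n} {Ω : Set (E n)} {m r₀ R : ℝ}
    (H : IsLipschitzDomain hn Ω m r₀) (hR : 0 < R) (hRr : R ≤ r₀) {y : E n} (hy : y ∈ frontier Ω) :
    ∃ e h, Chart Ω (1 + m) R y e h := by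
  obtain ⟨hop, -, -, hm, hr0, HH⟩ := H
  obtain ⟨T, φ, hφ, hmem⟩ := HH y hy
  let last : Fin n := ⟨n - 1, Nat.sub_lt hn Nat.one_pos⟩
  let pr : E n → E (n - 1) := fun x => (EuclideanSpace.equiv (Fin (n - 1)) ℝ).symm
            (fun i => T x (Fin.castLE (Nat.sub_le n 1) i))
  have hpr : ∀ x x', ‖pr x - pr x'‖ ≤ ‖x - x'‖ := by
    intro x x'
    rw [← T.norm_map (x - x'), EuclideanSpace.norm_eq, EuclideanSpace.norm_eq]
    apply Real.sqrt_le_sqrt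
    have e1 : ∀ i, (pr x - pr x') i = T (x - x') (Fin.castLE (Nat.sub_le n 1) i) := by
      intro i
      simp [pr]
    simp only [e1]
    rw [← Finset.sum_image (f := fun j => ‖T (x - x') j‖ ^ 2) (s := Finset.univ)
      (g := Fin.castLE (Nat.sub_le n 1)) (by
        intro i _ j _ hij
        exact Fin.castLE_injective _ hij)]
    apply Finset.sum_le_sum_of_subset_of_nonneg (Finset.subset_univ _)
    intros; positivity
  let h : E n → ℝ := fun z => T (z - y) last - φ (pr (z - y))
  have hlip : ∀ z z', |h z - h z'| ≤ (1 + m) * ‖z - z'‖ := by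
    intro z z'
    have e1 : |T (z - y) last - T (z' - y) last| ≤ ‖z - z'‖ := by
      have := EuclideanSpace.norm_eq (T (z - y) - T (z' - y))
      rw [← map_sub, T.norm_map, sub_sub_sub_cancel_right] at this
      rw [this]
      apply Real.le_sqrt_of_sq_le
      rw [sq_abs]
      have e3 : (T (z - y) last - T (z' - y) last) ^ 2 = ‖T (z - z') last‖ ^ 2 := by
        rw [Real.norm_eq_abs, sq_abs]
        have : z - z' = (z - y) - (z' - y) := by abel
        rw [this, map_sub]
        simp
      rw [e3]
      exact Finset.single_le_sum (f := fun j => ‖T (z - z') j‖ ^ 2) (fun j _ => by positivity)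
        (Finset.mem_univ last)
    have e2 : |φ (pr (z - y)) - φ (pr (z' - y))| ≤ m * ‖z - z'‖ := by
      have := hφ.dist_le_mul (pr (z - y)) (pr (z' - y))
      rw [Real.dist_eq, dist_eq_norm, Real.coe_toNNReal _ hm.le] at this
      refine this.trans ?_
      have := hpr (z - y) (z' - y)
      rw [sub_sub_sub_cancel_right] at this
      gcongr
    have e3 : h z - h z' = (T (z - y) last - T (z' - y) last) -
      (φ (pr (z - y)) - φ (pr (z' - y))) := by simp only [h]; ring
    rw [e3]
    refine (abs_sub _ _).trans ?_
    linarith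
  have hmem' : ∀ z, ‖z - y‖ < r₀ → (z ∈ Ω ↔ 0 < h z) := by
    intro z hz
    have := hmem z
    rw [mem_inter_iff, mem_ball, dist_eq_norm] at this
    have h2 : 0 < h z ↔ φ (pr (z - y)) < T (z - y) last := by simp only [h]; exact sub_pos
    rw [h2]
    constructor
    · intro hzΩ; exact (this.1 ⟨hzΩ, hz⟩).2
    · intro hh; exact (this.2 ⟨hz, hh⟩).1
  have hcont : Continuous h := by
    have : LipschitzWith (1 + m).toNNReal h := LipschitzWith.of_dist_le_mul fun z z' => by
      rw [Real.dist_eq, dist_eq_norm, Real.coe_toNNReal _ (by linarith)]; exact hlip z z'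
    exact this.continuous
  let e : E n := T.symm (EuclideanSpace.single last 1)
  have hTe : T e = EuclideanSpace.single last 1 := T.apply_symm_apply _
  refine ⟨e, h, by linarith, ?_, hlip, ?_, ?_, fun z hz => hmem' z (by linarith)⟩
  · simp [e]
  · intro z s
    have e1 : T (z + s • e - y) = T (z - y) + s • EuclideanSpace.single last 1 := by
      have e0 : z + s • e - y = (z - y) + s • e := by abel
      rw [e0, map_add, map_smul, hTe]
    have e2 : pr (z + s • e - y) = pr (z - y) := by
      simp only [pr, e1]
      congr 1
      funext i
      have : Fin.castLE (Nat.sub_le n 1) i ≠ last := by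
        intro hh
        have := congrArg Fin.val hh
        simp only [Fin.val_castLE, last] at this
        have := i.2
        omega
      simp [this]
    simp only [h, e2, e1]
    simp
    ring
  · have hyn : y ∉ Ω := by
      rw [hop.frontier_eq] at hy; exact hy.2
    have hle : h y ≤ 0 := by
      by_contra hc
      exact hyn ((hmem' y (by simpa using hr0)).2 (not_le.1 hc))
    by_contra hne
    have hlt : h y < 0 := lt_of_le_of_ne hle hne
    have hnb : {z | h z < 0} ∩ ball y r₀ ∈ nhds y :=
      inter_mem (hcont.continuousAt.eventually (gt_mem_nhds hlt)) (ball_mem_nhds y hr0)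
    have hcl : y ∈ closure Ω := frontier_subset_closure hy
    obtain ⟨z, hz1, hz2⟩ := mem_closure_iff_nhds.1 hcl _ hnb
    have h3 := hz1.2
    rw [mem_ball, dist_eq_norm] at h3
    have := (hmem' z h3).1 hz2
    have h4 : h z < 0 := hz1.1
    linarith

theorem ball_infDist_subset {Ω : Set (E n)} (hΩ : IsOpen Ω) {x : E n} (hx : x ∈ Ω) :
    ball x (infDist x (frontier Ω)) ⊆ Ω := by
  intro w hw
  by_contra hwΩ
  have hpre : IsPreconnected (segment ℝ x w) := (convex_segment x w).isPreconnected
  obtain ⟨z, hz1, hz2⟩ : ∃ z ∈ segment ℝ x w, z ∈ frontier Ω := by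
    by_contra hcon
    push Not at hcon
    have hsub : segment ℝ x w ⊆ Ω ∪ (closure Ω)ᶜ := by
      intro z hz
      by_cases hzΩ : z ∈ Ω
      · exact Or.inl hzΩ
      · refine Or.inr fun hzc => hcon z hz ?_
        rw [hΩ.frontier_eq]
        exact ⟨hzc, hzΩ⟩
    have hw2 : w ∈ (closure Ω)ᶜ :=
      (hsub (right_mem_segment ℝ x w)).resolve_left hwΩ
    obtain ⟨z, -, hz2, hz3⟩ := hpre Ω (closure Ω)ᶜ hΩ isClosed_closure.isOpen_compl hsub
      ⟨x, left_mem_segment ℝ x w, hx⟩ ⟨w, right_mem_segment ℝ x w, hw2⟩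
    exact hz3 (subset_closure hz2)
  have h1 := infDist_le_dist_of_mem (x := x) hz2
  have h2 : z ∈ closedBall x (dist w x) :=
    (convex_closedBall x (dist w x)).segment_subset (mem_closedBall_self dist_nonneg)
      (mem_closedBall.2 le_rfl) hz1
  rw [mem_closedBall] at h2
  rw [mem_ball] at hw
  rw [dist_comm] at h1
  linarith

theorem exists_nearest {Ω : Set (E n)} (hb : Bornology.IsBounded Ω) (hne : (frontier Ω).Nonempty)
    (x : E n) : ∃ y ∈ frontier Ω, ‖x - y‖ = infDist x (frontier Ω) := by
  have hcl : IsClosed (frontier Ω) := isClosed_frontier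
  obtain ⟨y, hy, h⟩ := hcl.exists_infDist_eq_dist hne x
  exact ⟨y, hy, by rw [h, dist_eq_norm]⟩

theorem frontier_nonempty (hn : 0 < n) {Ω : Set (E n)} (hb : Bornology.IsBounded Ω)
    (hne : Ω.Nonempty) : (frontier Ω).Nonempty := by
  rw [nonempty_frontier_iff]
  refine ⟨hne, ?_⟩
  rintro rfl
  haveI : Nonempty (Fin n) := ⟨⟨0, hn⟩⟩
  exact NormedSpace.unbounded_univ ℝ (E n) hb
end

open MeasureTheory Set Metric Filter
noncomputable section
set_option maxHeartbeats 1000000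
set_option linter.deprecated false
set_option linter.unusedVariables false
variable {n : ℕ}

/-- Normalised Lipschitz domain data at scale `R`. -/
structure Dom (Ω : Set (E n)) (L R lam : ℝ) : Prop where
  L1 : 1 ≤ L
  R0 : 0 < R
  op : IsOpen Ω
  bdd : Bornology.IsBounded Ω
  pre : IsPreconnected Ω
  fr : (frontier Ω).Nonempty
  diam : Metric.diam Ω ≤ lam * R
  chart : ∀ y ∈ frontier Ω, ∃ e h, Chart Ω L R y e h

theorem Dom.near {Ω : Set (E n)} {L R lam : ℝ} (H : Dom Ω L R lam) (x : E n) :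
    ∃ y ∈ frontier Ω, ‖x - y‖ = infDist x (frontier Ω) := exists_nearest H.bdd H.fr x

theorem norm_smul_unit {e : E n} (he : ‖e‖ = 1) {s : ℝ} (hs : 0 ≤ s) : ‖s • e‖ = s := by
  rw [norm_smul, he, mul_one, Real.norm_of_nonneg hs]

theorem norm_seg_le {p q y : E n} {ρ θ : ℝ} (hp : ‖p - y‖ ≤ ρ) (hq : ‖q - y‖ ≤ ρ)
    (hθ : θ ∈ Icc (0 : ℝ) 1) : ‖p + θ • (q - p) - y‖ ≤ ρ := by
  have e1 : p + θ • (q - p) - y = (1 - θ) • (p - y) + θ • (q - y) := by module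
  rw [e1]
  refine (norm_add_le _ _).trans ?_
  rw [norm_smul, norm_smul, Real.norm_of_nonneg hθ.1, Real.norm_of_nonneg (by linarith [hθ.2])]
  have h1 : (1 - θ) * ‖p - y‖ ≤ (1 - θ) * ρ := mul_le_mul_of_nonneg_left hp (by linarith [hθ.2])
  have h2 : θ * ‖q - y‖ ≤ θ * ρ := mul_le_mul_of_nonneg_left hq hθ.1
  linarith

/-- Local Harnack inequality near the boundary between deep points. -/
theorem LH (n : ℕ) {ν : ℝ} (hν : 0 < ν) {L ε g0 a : ℝ} (hL : 1 ≤ L) (hε : 0 < ε) (hε1 : ε ≤ 1)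
    (hg0 : 0 < g0) (ha : 0 ≤ a) : ∃ C : ℝ, 1 ≤ C ∧
    ∀ (Ω : Set (E n)) (u : E n × ℝ → ℝ), Sol ν Ω u → ∀ (R : ℝ) (y e : E n) (h : E n → ℝ),
    Chart Ω L R y e h → ∀ (ρ : ℝ) (p q : E n) (T t : ℝ), 0 < ρ → (2 * L + 4) * ρ ≤ R →
    ‖p - y‖ ≤ ρ → ‖q - y‖ ≤ ρ → ε * ρ ≤ h p → ε * ρ ≤ h q → g0 * ρ ^ 2 ≤ T → T ≤ a * ρ ^ 2 →
    g0 * ρ ^ 2 ≤ t → u (p, t) ≤ C * u (q, t + T) := by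
  have hL0 : 0 < L := by linarith
  obtain ⟨C, hC, H⟩ := chain n hν (a := (2 * L + 1) * L / ε + a * L ^ 2 / ε ^ 2)
    (b := g0 * L ^ 2 / (3 * ε ^ 2)) (by positivity) (by positivity)
  refine ⟨C ^ 3, one_le_pow₀ hC, ?_⟩
  intro Ω u hu R y e h hch ρ p q T t hρ hρR hp hq hhp hhq hT1 hT2 ht
  obtain ⟨d, hd⟩ : ∃ d, d = ε * ρ / L := ⟨_, rfl⟩
  have hdp : 0 < d := by rw [hd]; positivity
  have hLd : L * d = ε * ρ := by rw [hd]; field_simp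
  have hdρ : d ≤ ρ := by
    rw [hd, div_le_iff₀ hL0]
    have : ε * ρ ≤ 1 * ρ := by gcongr
    have : ρ * 1 ≤ ρ * L := by gcongr
    linarith
  have hb : g0 * L ^ 2 / (3 * ε ^ 2) * d ^ 2 = g0 * ρ ^ 2 / 3 := by rw [hd]; field_simp
  have haa : ((2 * L + 1) * L / ε + a * L ^ 2 / ε ^ 2) * d ^ 2 =
      (2 * L + 1) * L / ε * d ^ 2 + a * ρ ^ 2 := by rw [hd]; field_simp
  have ha1 : ((2 * L + 1) * L / ε + a * L ^ 2 / ε ^ 2) * d =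
      (2 * L + 1) * ρ + a * L ^ 2 / ε ^ 2 * d := by rw [hd]; field_simp
  have hq1 : 0 ≤ (2 * L + 1) * L / ε * d ^ 2 := by positivity
  have hq2 : 0 ≤ a * L ^ 2 / ε ^ 2 * d := by positivity
  have hg : 0 < g0 * ρ ^ 2 := by positivity
  obtain ⟨σ, hσ⟩ : ∃ σ, σ = (2 * L + 1) * ρ := ⟨_, rfl⟩
  have hσ0 : 0 ≤ σ := by rw [hσ]; positivity
  have hne := hch.ne
  have hLρ : 0 < L * ρ := by positivity
  have hLρ1 : 1 * ρ ≤ L * ρ := by gcongr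
  have hes : ‖σ • e‖ = σ := norm_smul_unit hne hσ0
  have H1 : ∀ p, ‖p - y‖ ≤ ρ → ε * ρ ≤ h p → ∀ θ ∈ Icc (0 : ℝ) 1,
      ball (p + θ • (σ • e)) d ⊆ Ω := by
    intro p hp hhp θ hθ
    have e0 : θ • (σ • e) = (θ * σ) • e := by rw [smul_smul]
    have hθσ : 0 ≤ θ * σ := mul_nonneg hθ.1 hσ0
    have hθσ1 : θ * σ ≤ 1 * σ := mul_le_mul_of_nonneg_right hθ.2 hσ0
    apply hch.depth
    · rw [e0]
      have := norm_add_le (p - y) ((θ * σ) • e)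
      rw [norm_smul_unit hne hθσ] at this
      have e2 : p + (θ * σ) • e - y = p - y + (θ * σ) • e := by abel
      rw [e2]; linarith
    · rw [e0, hch.shift, hLd]; linarith
  have s1 := H Ω u hu p (p + σ • e) d (T / 3) t hdp (by
    rw [add_sub_cancel_left, hes, ha1]; linarith) (by rw [hb]; linarith) (by rw [haa]; linarith)
    (by rw [hb]; linarith) (by rw [add_sub_cancel_left]; exact H1 p hp hhp)
  have s2 := H Ω u hu (p + σ • e) (q + σ • e) d (T / 3) (t + T / 3) hdp (by
    rw [add_sub_add_right_eq_sub, ha1]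
    have := norm_sub_le_norm_sub_add_norm_sub q y p
    rw [norm_sub_rev y p] at this
    linarith) (by rw [hb]; linarith) (by rw [haa]; linarith)
    (by rw [hb]; linarith) (by
      intro θ hθ
      have e1 : p + σ • e + θ • (q + σ • e - (p + σ • e)) = (p + θ • (q - p)) + σ • e := by module
      have hn1 := norm_seg_le hp hq hθ
      rw [e1]
      apply hch.depth
      · have := norm_add_le (p + θ • (q - p) - y) (σ • e)
        rw [hes] at this
        have e2 : p + θ • (q - p) + σ • e - y = p + θ • (q - p) - y + σ • e := by abel
        rw [e2]; linarith
      · have h3 := (abs_le.1 (hch.lip (p + θ • (q - p)) y)).1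
        rw [hch.base] at h3
        have h4 : L * ‖p + θ • (q - p) - y‖ ≤ L * ρ := by gcongr
        have h5 : ε * ρ ≤ 1 * ρ := by gcongr
        rw [hch.shift, hLd]; linarith)
  have s3 := H Ω u hu (q + σ • e) q d (T / 3) (t + T / 3 + T / 3) hdp (by
    rw [sub_add_cancel_left, norm_neg, hes, ha1]; linarith) (by rw [hb]; linarith)
    (by rw [haa]; linarith) (by rw [hb]; linarith) (by
      intro θ hθ
      have e1 : q + σ • e + θ • (q - (q + σ • e)) = q + (1 - θ) • (σ • e) := by module
      rw [e1]
      exact H1 q hq hhq (1 - θ) ⟨by linarith [hθ.2], by linarith [hθ.1]⟩)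
  have e9 : t + T / 3 + T / 3 + T / 3 = t + T := by ring
  rw [e9] at s3
  have hC0 : 0 ≤ C := by linarith
  calc u (p, t) ≤ _ := s1
    _ ≤ C * (C * u (q + σ • e, t + T / 3 + T / 3)) := by gcongr
    _ ≤ C * (C * (C * u (q, t + T))) := by gcongr
    _ = _ := by ring

theorem deep_near {Ω : Set (E n)} {L R lam η κ : ℝ} (H : Dom Ω L R lam) (hη : 0 < η)
    (hη1 : 12 * (2 * L + 4) * η ≤ 1) (hκ : 0 < κ) (hκη : L * κ ≤ η) {x : E n} (hx : x ∈ Ω) :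
    ∃ x', ball x' (κ * R) ⊆ Ω ∧ ‖x - x'‖ ≤ η * R := by
  have hR := H.R0
  have hL := H.L1
  have hLκ : κ ≤ L * κ := by nlinarith
  have hηR : 0 < η * R := by positivity
  have hκR : κ * R ≤ η * R := by gcongr; linarith
  by_cases hd : η * R ≤ infDist x (frontier Ω)
  · refine ⟨x, (ball_subset_ball (by linarith)).trans (ball_infDist_subset H.op hx), ?_⟩
    simp; positivity
  push Not at hd
  obtain ⟨y, hy, hxy⟩ := H.near x
  obtain ⟨e, h, hc⟩ := H.chart y hy
  have hηR1 : η * R * 3 ≤ R := by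
    have : η * 3 ≤ 1 := by nlinarith
    nlinarith
  have hes := norm_smul_unit hc.ne hηR.le
  have hx0 : 0 < h x := (hc.mem x (by linarith)).1 hx
  refine ⟨x + (η * R) • e, ?_, by rw [sub_add_cancel_left, norm_neg, hes]⟩
  apply hc.depth
  · have := norm_add_le (x - y) ((η * R) • e)
    rw [hes] at this
    have e2 : x + (η * R) • e - y = x - y + (η * R) • e := by abel
    rw [e2]; linarith
  · rw [hc.shift]
    have : L * κ * R ≤ η * R := by gcongr
    linarith

theorem DN_local (n : ℕ) {ν : ℝ} (hν : 0 < ν) {L lam η κ g0 a : ℝ} (hL : 1 ≤ L) (hη : 0 < η)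
    (hη1 : 12 * (2 * L + 4) * η ≤ 1) (hκ : 0 < κ) (hκη : κ ≤ η) (hg0 : 0 < g0) (ha : 0 ≤ a) :
    ∃ C : ℝ, 1 ≤ C ∧ ∀ (Ω : Set (E n)) (u : E n × ℝ → ℝ) (R : ℝ), Sol ν Ω u → Dom Ω L R lam →
    ∀ (p q : E n) (T t : ℝ), ball p (κ * R) ⊆ Ω → ball q (κ * R) ⊆ Ω → ‖p - q‖ ≤ 4 * η * R →
    g0 * R ^ 2 ≤ T → T ≤ a * R ^ 2 → g0 * R ^ 2 ≤ t → u (p, t) ≤ C * u (q, t + T) := by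
  obtain ⟨C1, hC1, H1⟩ := chain n hν (a := 4 * η / κ + a / κ ^ 2) (b := g0 / κ ^ 2)
    (by positivity) (by positivity)
  obtain ⟨C2, hC2, H2⟩ := LH n hν (L := L) (ε := κ / (12 * η)) (g0 := g0 / (12 * η) ^ 2)
    (a := a / (12 * η) ^ 2) hL (by positivity) (by rw [div_le_one (by positivity)]; linarith)
    (by positivity) (by positivity)
  refine ⟨max C1 C2, le_max_of_le_left hC1, ?_⟩
  intro Ω u R hu H p q T t hp hq hpq hT1 hT2 ht
  have hR := H.R0
  have hκR : 0 < κ * R := by positivity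
  have hκR1 : κ * R ≤ η * R := by gcongr
  have hpΩ : p ∈ Ω := hp (mem_ball_self hκR)
  have hqΩ : q ∈ Ω := hq (mem_ball_self hκR)
  have htp : 0 < t + T := by
    have : 0 < g0 * R ^ 2 := by positivity
    linarith
  have hun := hu.nonneg (q, t + T) ⟨hqΩ, htp⟩
  by_cases hd : 8 * η * R ≤ infDist p (frontier Ω)
  · refine le_trans (H1 Ω u hu p q (κ * R) T t hκR ?_ ?_ ?_ ?_ ?_)
      (mul_le_mul_of_nonneg_right (le_max_left _ _) hun)
    · rw [norm_sub_rev]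
      refine hpq.trans ?_
      have : (4 * η / κ + a / κ ^ 2) * (κ * R) = 4 * η * R + a / κ * R := by field_simp
      rw [this]
      have : 0 ≤ a / κ * R := by positivity
      linarith
    · have : g0 / κ ^ 2 * (κ * R) ^ 2 = g0 * R ^ 2 := by field_simp
      rw [this]; exact hT1
    · have : (4 * η / κ + a / κ ^ 2) * (κ * R) ^ 2 = 4 * η * κ * R ^ 2 + a * R ^ 2 := by field_simp
      rw [this]
      have : 0 ≤ 4 * η * κ * R ^ 2 := by positivity
      linarith
    · have : g0 / κ ^ 2 * (κ * R) ^ 2 = g0 * R ^ 2 := by field_simp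
      rw [this]; exact ht
    · intro θ hθ
      refine Subset.trans ?_ (ball_infDist_subset H.op hpΩ)
      apply ball_subset_ball'
      rw [dist_eq_norm, add_sub_cancel_left, norm_smul, Real.norm_of_nonneg hθ.1, norm_sub_rev q p]
      have : θ * ‖p - q‖ ≤ 1 * ‖p - q‖ := mul_le_mul_of_nonneg_right hθ.2 (norm_nonneg _)
      linarith
  · push Not at hd
    obtain ⟨y, hy, hxy⟩ := H.near p
    obtain ⟨e, h, hc⟩ := H.chart y hy
    have hqy := norm_sub_le_norm_sub_add_norm_sub q p y
    rw [norm_sub_rev q p] at hqy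
    have h13 : 13 * η * R ≤ R := by
      have h1 : η ≤ L * η := by nlinarith
      have : 13 * η ≤ 1 := by linarith
      nlinarith
    refine le_trans (H2 Ω u hu R y e h hc (12 * η * R) p q T t (by positivity) ?_ (by linarith)
      (by linarith) ?_ ?_ ?_ ?_ ?_)
      (mul_le_mul_of_nonneg_right (le_max_right _ _) hun)
    · have := mul_le_mul_of_nonneg_right hη1 hR.le
      linarith
    · have : κ / (12 * η) * (12 * η * R) = κ * R := by field_simp
      rw [this]
      exact hc.h_ge (by linarith) hp hκR
    · have : κ / (12 * η) * (12 * η * R) = κ * R := by field_simp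
      rw [this]
      exact hc.h_ge (by linarith) hq hκR
    · have : g0 / (12 * η) ^ 2 * (12 * η * R) ^ 2 = g0 * R ^ 2 := by field_simp
      rw [this]; exact hT1
    · have : a / (12 * η) ^ 2 * (12 * η * R) ^ 2 = a * R ^ 2 := by field_simp
      rw [this]; exact hT2
    · have : g0 / (12 * η) ^ 2 * (12 * η * R) ^ 2 = g0 * R ^ 2 := by field_simp
      rw [this]; exact ht
end

open MeasureTheory Set Metric Filter
noncomputable section
set_option maxHeartbeats 1000000
set_option linter.deprecated false
set_option linter.unusedVariables false
variable {n : ℕ}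

/-- Global Harnack inequality between deep points of the domain. -/
theorem DN (n : ℕ) {ν : ℝ} (hν : 0 < ν) {L lam κ g0 a : ℝ} (hL : 1 ≤ L)
    (hκ : 0 < κ) (hg0 : 0 < g0) (ha : 0 ≤ a) :
    ∃ C : ℝ, 1 ≤ C ∧ ∀ (Ω : Set (E n)) (u : E n × ℝ → ℝ) (R : ℝ), Sol ν Ω u → Dom Ω L R lam →
    ∀ (p q : E n) (T t : ℝ), ball p (κ * R) ⊆ Ω → ball q (κ * R) ⊆ Ω →
    g0 * R ^ 2 ≤ T → T ≤ a * R ^ 2 → g0 * R ^ 2 ≤ t → u (p, t) ≤ C * u (q, t + T) := by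
  have hL0 : 0 < L := by linarith
  obtain ⟨η, hη⟩ : ∃ η, η = 1 / (12 * (2 * L + 4)) := ⟨_, rfl⟩
  have hηp : 0 < η := by rw [hη]; positivity
  have hη1 : 12 * (2 * L + 4) * η ≤ 1 := by
    rw [hη, mul_one_div_cancel (by positivity)]
  obtain ⟨κ', hκ'⟩ : ∃ κ', κ' = min κ (η / L) := ⟨_, rfl⟩
  have hκp : 0 < κ' := by rw [hκ']; exact lt_min hκ (by positivity)
  have hκκ : κ' ≤ κ := by rw [hκ']; exact min_le_left _ _
  have hκη : L * κ' ≤ η := by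
    have : κ' ≤ η / L := by rw [hκ']; exact min_le_right _ _
    rw [le_div_iff₀ hL0] at this; linarith
  have hκη' : κ' ≤ η := by
    have : 1 * κ' ≤ L * κ' := by gcongr
    linarith
  -- finite cover
  obtain ⟨F, hF⟩ : ∃ F : Finset (E n), closedBall (0 : E n) lam ⊆ ⋃ c ∈ F, ball c η := by
    obtain ⟨t, -, ht⟩ := (isCompact_closedBall (0 : E n) lam).elim_nhds_subcover
      (fun c => ball c η) (fun c _ => ball_mem_nhds c hηp)
    exact ⟨t, ht⟩
  obtain ⟨N, hN⟩ : ∃ N : ℕ, N = F.card + 1 := ⟨_, rfl⟩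
  have hN0 : (0 : ℝ) < N := by rw [hN]; positivity
  obtain ⟨C, hC, H⟩ := DN_local n hν (L := L) (lam := lam) (η := η) (κ := κ') (g0 := g0 / N)
    (a := a / N) hL hηp hη1 hκp hκη' (by positivity) (by positivity)
  refine ⟨C ^ N, one_le_pow₀ hC, ?_⟩
  intro Ω u R hu hD p q T t hp hq hT1 hT2 ht
  have hR := hD.R0
  have hC0 : 0 ≤ C := by linarith
  have hκR : 0 < κ' * R := by positivity
  have hκR2 : κ' * R ≤ κ * R := by gcongr
  have hp' : ball p (κ' * R) ⊆ Ω := (ball_subset_ball hκR2).trans hp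
  have hq' : ball q (κ' * R) ⊆ Ω := (ball_subset_ball hκR2).trans hq
  have hpΩ : p ∈ Ω := hp' (mem_ball_self hκR)
  have hqΩ : q ∈ Ω := hq' (mem_ball_self hκR)
  obtain ⟨τ, hτ⟩ : ∃ τ, τ = T / N := ⟨_, rfl⟩
  have hτ1 : g0 / N * R ^ 2 ≤ τ := by
    rw [hτ, div_mul_eq_mul_div]; gcongr
  have hτ2 : τ ≤ a / N * R ^ 2 := by
    rw [hτ, div_mul_eq_mul_div]; gcongr
  have hgp : 0 < g0 / N * R ^ 2 := by positivity
  have ht' : g0 / N * R ^ 2 ≤ t := by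
    refine le_trans ?_ ht
    gcongr
    apply div_le_self hg0.le
    rw [hN]; push_cast; linarith [(Nat.cast_nonneg F.card : (0:ℝ) ≤ F.card)]
  have hτ0 : 0 < τ := by linarith
  -- one step
  have step : ∀ p q t, ball p (κ' * R) ⊆ Ω → ball q (κ' * R) ⊆ Ω → ‖p - q‖ ≤ 4 * η * R →
      g0 / N * R ^ 2 ≤ t → u (p, t) ≤ C * u (q, t + τ) := fun p q t h1 h2 h3 h4 =>
    H Ω u R hu hD p q τ t h1 h2 h3 hτ1 hτ2 h4
  let near : E n → ↥F → Prop := fun z c => ‖z - p - R • (c : E n)‖ < η * R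
  have hopen : ∀ c, IsOpen {z | near z c} := fun c =>
    isOpen_lt (by fun_prop) continuous_const
  have hcov : ∀ z ∈ Ω, ∃ c, near z c := by
    intro z hz
    have h1 : ‖z - p‖ ≤ lam * R := by
      rw [← dist_eq_norm]
      exact (dist_le_diam_of_mem hD.bdd hz hpΩ).trans hD.diam
    have h2 : (R⁻¹ • (z - p)) ∈ closedBall (0 : E n) lam := by
      rw [mem_closedBall, dist_zero_right, norm_smul, Real.norm_of_nonneg (by positivity),
        inv_mul_le_iff₀ hR]
      linarith
    have h3 := hF h2
    simp only [mem_iUnion, exists_prop] at h3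
    obtain ⟨c, hc, h4⟩ := h3
    refine ⟨⟨c, hc⟩, ?_⟩
    rw [mem_ball, dist_eq_norm] at h4
    have e1 : z - p - R • c = R • (R⁻¹ • (z - p) - c) := by
      rw [smul_sub, smul_smul, mul_inv_cancel₀ hR.ne', one_smul]
    show ‖z - p - R • c‖ < η * R
    rw [e1, norm_smul, Real.norm_of_nonneg hR.le]
    have := mul_lt_mul_of_pos_left h4 hR
    linarith
  let G : SimpleGraph ↥F := SimpleGraph.fromRel (fun c c' => ∃ z ∈ Ω, near z c ∧ near z c')
  have hadj : ∀ c c', G.Adj c c' → ∃ z ∈ Ω, near z c ∧ near z c' := by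
    intro c c' h
    rw [SimpleGraph.fromRel_adj] at h
    rcases h.2 with ⟨z, hz, h1, h2⟩ | ⟨z, hz, h1, h2⟩
    · exact ⟨z, hz, h1, h2⟩
    · exact ⟨z, hz, h2, h1⟩
  obtain ⟨c0, hc0⟩ := hcov p hpΩ
  have hreach : ∀ z ∈ Ω, ∃ c, near z c ∧ G.Reachable c0 c := by
    intro z hz
    by_contra hcon
    push Not at hcon
    obtain ⟨c2, hc2⟩ := hcov z hz
    have hU : IsOpen (⋃ c ∈ {c | G.Reachable c0 c}, {z | near z c}) :=
      isOpen_biUnion fun c _ => hopen c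
    have hW : IsOpen (⋃ c ∈ {c | ¬ G.Reachable c0 c}, {z | near z c}) :=
      isOpen_biUnion fun c _ => hopen c
    obtain ⟨w, hw, hw1, hw2⟩ := hD.pre _ _ hU hW (by
      intro x hx
      obtain ⟨c, hc⟩ := hcov x hx
      by_cases hr : G.Reachable c0 c
      · exact Or.inl (mem_biUnion (show c ∈ {c | G.Reachable c0 c} from hr) hc)
      · exact Or.inr (mem_biUnion (show c ∈ {c | ¬ G.Reachable c0 c} from hr) hc))
      ⟨p, hpΩ, mem_biUnion (show c0 ∈ {c | G.Reachable c0 c} from SimpleGraph.Reachable.refl c0) hc0⟩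
      ⟨z, hz, mem_biUnion (show c2 ∈ {c | ¬ G.Reachable c0 c} from hcon c2 hc2) hc2⟩
    simp only [mem_iUnion, exists_prop] at hw1 hw2
    obtain ⟨c, hc, hwc⟩ := hw1
    obtain ⟨c', hc', hwc'⟩ := hw2
    apply hc'
    by_cases hcc : c = c'
    · rw [← hcc]; exact hc
    · refine SimpleGraph.Reachable.trans hc (SimpleGraph.Adj.reachable ?_)
      rw [SimpleGraph.fromRel_adj]
      exact ⟨hcc, Or.inl ⟨w, hw, hwc, hwc'⟩⟩
  have hwalk : ∀ (c c' : ↥F) (w : G.Walk c c') (p1 : E n) (s : ℝ), ball p1 (κ' * R) ⊆ Ω →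
      ‖p1 - p - R • (c : E n)‖ < 2 * η * R → ‖q - p - R • (c' : E n)‖ < 2 * η * R →
      g0 / N * R ^ 2 ≤ s →
      u (p1, s) ≤ C ^ (w.length + 1) * u (q, s + ((w.length + 1 : ℕ) : ℝ) * τ) := by
    intro c c' w
    induction w with
    | nil =>
      intro p1 s h1 h2 h3 h4
      have := step p1 q s h1 hq' (by
        rename_i c
        have := norm_sub_le_norm_sub_add_norm_sub (p1 - p) (R • (c : E n)) (q - p)
        rw [norm_sub_rev (R • (c : E n)), sub_sub_sub_cancel_right] at this
        linarith) h4
      simpa using this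
    | cons hh w ih =>
      intro p1 s h1 h2 h3 h4
      rename_i c1 c2 c3
      obtain ⟨z, hz, hz1, hz2⟩ := hadj _ _ hh
      obtain ⟨z', hz', hzz⟩ := deep_near hD hηp hη1 hκp hκη hz
      have hz1' : ‖z - p - R • (c1 : E n)‖ < η * R := hz1
      have hz2' : ‖z - p - R • (c2 : E n)‖ < η * R := hz2
      have s1 := step p1 z' s h1 hz' (by
        have e1 := norm_sub_le_norm_sub_add_norm_sub (p1 - p) (R • (c1 : E n)) (z - p)
        rw [norm_sub_rev (R • (c1 : E n)), sub_sub_sub_cancel_right] at e1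
        have e2 := norm_sub_le_norm_sub_add_norm_sub p1 z z'
        linarith) h4
      have s2 := ih z' (s + τ) hz' (by
        have e2 := norm_sub_le_norm_sub_add_norm_sub (z' - p) (z - p) (R • (c2 : E n))
        rw [sub_sub_sub_cancel_right, norm_sub_rev z' z] at e2
        linarith) h3 (by linarith)
      have e3 : s + τ + ((w.length + 1 : ℕ) : ℝ) * τ =
        s + (((SimpleGraph.Walk.cons hh w).length + 1 : ℕ) : ℝ) * τ := by
        rw [SimpleGraph.Walk.length_cons]; push_cast; ring
      rw [e3] at s2
      calc u (p1, s) ≤ _ := s1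
        _ ≤ C * (C ^ (w.length + 1) * _) := by gcongr
        _ = _ := by rw [SimpleGraph.Walk.length_cons]; ring
  have hpad : ∀ (j : ℕ) (s : ℝ), g0 / N * R ^ 2 ≤ s → u (q, s) ≤ C ^ j * u (q, s + j * τ) := by
    intro j
    induction j with
    | zero => intro s hs; simp
    | succ j ih =>
      intro s hs
      have s1 := step q q s hq' hq' (by simp; positivity) hs
      have s2 := ih (s + τ) (by linarith)
      have e3 : s + τ + j * τ = s + ((j + 1 : ℕ) : ℝ) * τ := by push_cast; ring
      rw [e3] at s2
      calc u (q, s) ≤ _ := s1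
        _ ≤ C * (C ^ j * _) := by gcongr
        _ = _ := by ring
  obtain ⟨c1, hc1, hr1⟩ := hreach q hqΩ
  obtain ⟨w, hw⟩ := hr1.exists_isPath
  have hlen : w.length < F.card := by
    have := hw.length_lt
    simpa using this
  have hηR : 0 < η * R := by positivity
  have hc0' : ‖p - p - R • (c0 : E n)‖ < η * R := hc0
  have hc1' : ‖q - p - R • (c1 : E n)‖ < η * R := hc1
  have f1 := hwalk c0 c1 w p t hp' (by linarith) (by linarith) ht'
  obtain ⟨j, hj⟩ : ∃ j, w.length + 1 + j = N := ⟨N - (w.length + 1), by omega⟩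
  have hj' : ((w.length + 1 : ℕ) : ℝ) + j = N := by exact_mod_cast hj
  have f2 := hpad j (t + ((w.length + 1 : ℕ) : ℝ) * τ) (by
    have : 0 ≤ ((w.length + 1 : ℕ) : ℝ) * τ := by positivity
    linarith)
  have e4 : t + ((w.length + 1 : ℕ) : ℝ) * τ + j * τ = t + T := by
    have : T = N * τ := by rw [hτ]; field_simp
    rw [this, ← hj']; ring
  rw [e4] at f2
  calc u (p, t) ≤ _ := f1
    _ ≤ C ^ (w.length + 1) * (C ^ j * u (q, t + T)) := by gcongr
    _ = _ := by rw [← hj, pow_add]; ring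
end

open MeasureTheory Set Metric Filter
noncomputable section
set_option maxHeartbeats 1000000
set_option linter.deprecated false
set_option linter.unusedVariables false
variable {n : ℕ}

/-- One vertical Harnack step, in both directions. -/
theorem vstep (n : ℕ) {ν : ℝ} (hν : 0 < ν) {L clo chi : ℝ} (hL : 1 ≤ L) (hclo : 0 < clo)
    (hchi : clo ≤ chi) : ∃ C : ℝ, 1 ≤ C ∧
    ∀ (Ω : Set (E n)) (u : E n × ℝ → ℝ), Sol ν Ω u → ∀ (R : ℝ) (y e : E n) (h : E n → ℝ),
    Chart Ω L R y e h → ∀ (D : ℝ) (p : E n) (T t : ℝ), 0 < D → ‖p - y‖ + 2 * D ≤ R →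
    D ≤ h p → clo * D ^ 2 ≤ T → T ≤ chi * D ^ 2 → clo * D ^ 2 / 3 ≤ t →
    u (p, t) ≤ C * u (p + D • e, t + T) ∧ u (p + D • e, t) ≤ C * u (p, t + T) := by
  have hL0 : 0 < L := by linarith
  have hchi0 : 0 < chi := by linarith
  obtain ⟨C, hC, H⟩ := chain n hν (a := L + chi * L ^ 2)
    (b := clo * L ^ 2 / 3) (by positivity) (by positivity)
  refine ⟨C, hC, ?_⟩
  intro Ω u hu R y e h hch D p T t hD hpR hhp hT1 hT2 ht
  obtain ⟨d, hd⟩ : ∃ d, d = D / L := ⟨_, rfl⟩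
  have hdp : 0 < d := by rw [hd]; positivity
  have hLd : L * d = D := by rw [hd]; field_simp
  have hdD : d ≤ D := by rw [hd]; exact div_le_self hD.le hL
  have hb : clo * L ^ 2 / 3 * d ^ 2 = clo * D ^ 2 / 3 := by rw [hd]; field_simp
  have haa : (L + chi * L ^ 2) * d ^ 2 = L * d ^ 2 + chi * D ^ 2 := by rw [hd]; field_simp
  have ha1 : (L + chi * L ^ 2) * d = D + chi * L * D := by rw [hd]; field_simp
  have hq1 : 0 ≤ L * d ^ 2 := by positivity
  have hq2 : 0 ≤ chi * L * D := by positivity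
  have hg : 0 < clo * D ^ 2 := by positivity
  have hes : ‖D • e‖ = D := norm_smul_unit hch.ne hD.le
  have H1 : ∀ θ ∈ Icc (0 : ℝ) 1, ball (p + θ • (D • e)) d ⊆ Ω := by
    intro θ hθ
    have e0 : θ • (D • e) = (θ * D) • e := by rw [smul_smul]
    have hθσ : 0 ≤ θ * D := mul_nonneg hθ.1 hD.le
    have hθσ1 : θ * D ≤ 1 * D := mul_le_mul_of_nonneg_right hθ.2 hD.le
    apply hch.depth
    · rw [e0]
      have := norm_add_le (p - y) ((θ * D) • e)
      rw [norm_smul_unit hch.ne hθσ] at this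
      have e2 : p + (θ * D) • e - y = p - y + (θ * D) • e := by abel
      rw [e2]; linarith
    · rw [e0, hch.shift, hLd]; linarith
  constructor
  · exact H Ω u hu p (p + D • e) d T t hdp (by
      rw [add_sub_cancel_left, hes, ha1]; linarith) (by rw [hb]; linarith) (by rw [haa]; linarith)
      (by rw [hb]; linarith) (by rw [add_sub_cancel_left]; exact H1)
  · exact H Ω u hu (p + D • e) p d T t hdp (by
      rw [sub_add_cancel_left, norm_neg, hes, ha1]; linarith) (by rw [hb]; linarith)
      (by rw [haa]; linarith) (by rw [hb]; linarith) (by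
        intro θ hθ
        have e1 : p + D • e + θ • (p - (p + D • e)) = p + (1 - θ) • (D • e) := by module
        rw [e1]
        exact H1 (1 - θ) ⟨by linarith [hθ.2], by linarith [hθ.1]⟩)

/-- Dyadic Harnack chains going away from / towards the boundary. -/
theorem dyadic (n : ℕ) {ν : ℝ} (hν : 0 < ν) {L clo chi : ℝ} (hL : 1 ≤ L) (hclo : 0 < clo)
    (hchi : clo ≤ chi) : ∃ γ : ℕ,
    ∀ (Ω : Set (E n)) (u : E n × ℝ → ℝ), Sol ν Ω u → ∀ (R : ℝ) (y e : E n) (h : E n → ℝ),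
    Chart Ω L R y e h → ∀ (d : ℝ) (z : E n) (c : ℝ), 0 < d → d ≤ h z → clo ≤ c → c ≤ chi →
    ∀ (J : ℕ), ‖z - y‖ + 2 * 2 ^ J * d ≤ R →
    (∀ t, clo * d ^ 2 ≤ t →
      u (z, t) ≤ (2 ^ J) ^ γ * u (z + ((2 ^ J - 1) * d) • e, t + c * d ^ 2 * (4 ^ J - 1) / 3)) ∧
    (∀ t, clo * 4 ^ J * d ^ 2 ≤ t →
      u (z + ((2 ^ J - 1) * d) • e, t) ≤ (2 ^ J) ^ γ * u (z, t + c * d ^ 2 * (4 ^ J - 1) / 3)) := by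
  obtain ⟨C, hC, H⟩ := vstep n hν hL hclo hchi
  obtain ⟨γ, hγ⟩ := pow_unbounded_of_one_lt C (one_lt_two)
  refine ⟨γ, ?_⟩
  intro Ω u hu R y e h hch d z c hd hhz hc1 hc2 J
  have hC0 : 0 ≤ C := by linarith
  have hzΩ : ∀ J : ℕ, ‖z - y‖ + 2 * 2 ^ J * d ≤ R → z + (((2 : ℝ) ^ J - 1) * d) • e ∈ Ω := by
    intro J hJ
    have h2J : (1 : ℝ) ≤ 2 ^ J := one_le_pow₀ (by norm_num)
    have hJd : 0 ≤ ((2 : ℝ) ^ J - 1) * d := mul_nonneg (by linarith) hd.le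
    rw [hch.mem, hch.shift]
    · linarith
    · have := norm_add_le (z - y) ((((2 : ℝ) ^ J - 1) * d) • e)
      rw [norm_smul_unit hch.ne hJd] at this
      have e2 : z + (((2 : ℝ) ^ J - 1) * d) • e - y = z - y + (((2 : ℝ) ^ J - 1) * d) • e := by abel
      have : 0 < (2 : ℝ) ^ J * d := by positivity
      rw [e2]; linarith
  have hc0 : 0 < c := by linarith
  induction J with
  | zero => intro _; constructor <;> intro t ht <;> simp
  | succ J ih =>
    intro hJ
    have h2J : (1 : ℝ) ≤ 2 ^ J := one_le_pow₀ (by norm_num)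
    have h4J : (4 : ℝ) ^ J = (2 ^ J) ^ 2 := by rw [← pow_mul, mul_comm, pow_mul]; norm_num
    have h2d : 0 < (2 : ℝ) ^ J * d := by positivity
    have hJ' : ‖z - y‖ + 2 * 2 ^ J * d ≤ R := by rw [pow_succ] at hJ; linarith
    obtain ⟨ih1, ih2⟩ := ih hJ'
    have hJd : 0 ≤ ((2 : ℝ) ^ J - 1) * d := mul_nonneg (by linarith) hd.le
    obtain ⟨p, hp⟩ : ∃ p, p = z + (((2 : ℝ) ^ J - 1) * d) • e := ⟨_, rfl⟩
    have hp2 : z + (((2 : ℝ) ^ (J + 1) - 1) * d) • e = p + (2 ^ J * d) • e := by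
      rw [hp, pow_succ]; module
    have hpn : ‖p - y‖ + 2 * (2 ^ J * d) ≤ R := by
      have := norm_add_le (z - y) ((((2 : ℝ) ^ J - 1) * d) • e)
      rw [norm_smul_unit hch.ne hJd] at this
      have e2 : p - y = z - y + (((2 : ℝ) ^ J - 1) * d) • e := by rw [hp]; abel
      rw [pow_succ] at hJ
      rw [e2]; linarith
    have hhp : 2 ^ J * d ≤ h p := by rw [hp, hch.shift]; linarith
    have hd2 : 0 < d ^ 2 := by positivity
    have h4d : 0 < (2 ^ J * d) ^ 2 := by positivity
    have hT := H Ω u hu R y e h hch (2 ^ J * d) p (c * (2 ^ J * d) ^ 2)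
    have hT1 : clo * (2 ^ J * d) ^ 2 ≤ c * (2 ^ J * d) ^ 2 := by gcongr
    have hT2 : c * (2 ^ J * d) ^ 2 ≤ chi * (2 ^ J * d) ^ 2 := by gcongr
    have hcl4 : 0 < clo * (2 ^ J * d) ^ 2 := by positivity
    have hfac : (2 : ℝ) ^ J * d * (2 ^ J * d) = (2 ^ J * d) ^ 2 := by ring
    have hγJ : ((2 : ℝ) ^ (J + 1)) ^ γ = (2 ^ J) ^ γ * 2 ^ γ := by rw [pow_succ, mul_pow]
    rw [hp2]
    rw [← hp] at ih1 ih2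
    have hz0 : 0 ≤ c * d ^ 2 * (4 ^ J - 1) := by
      apply mul_nonneg (by positivity)
      rw [h4J]
      have := one_le_pow₀ h2J (n := 2)
      linarith
    have e5 : ∀ t, t + c * d ^ 2 * (4 ^ J - 1) / 3 + c * (2 ^ J * d) ^ 2 =
        t + c * d ^ 2 * (4 ^ (J + 1) - 1) / 3 := by
      intro t; rw [pow_succ (4 : ℝ) J, h4J]; ring
    have e6 : ∀ t, t + c * (2 ^ J * d) ^ 2 + c * d ^ 2 * (4 ^ J - 1) / 3 =
        t + c * d ^ 2 * (4 ^ (J + 1) - 1) / 3 := by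
      intro t; rw [pow_succ (4 : ℝ) J, h4J]; ring
    constructor
    · intro t ht
      have s1 := ih1 t ht
      have ht3 : clo * (2 ^ J * d) ^ 2 / 3 ≤ t + c * d ^ 2 * (4 ^ J - 1) / 3 := by
        have e7 : clo * d ^ 2 * ((2 ^ J) ^ 2 - 1) ≤ c * d ^ 2 * ((2 ^ J) ^ 2 - 1) := by
          gcongr
          have := one_le_pow₀ h2J (n := 2)
          linarith
        have : 0 < clo * d ^ 2 := by positivity
        rw [h4J]
        linarith
      have s2 := (hT (t + c * d ^ 2 * (4 ^ J - 1) / 3) h2d hpn hhp hT1 hT2 ht3).1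
      rw [e5] at s2
      have hpos : 0 ≤ u (p + (2 ^ J * d) • e, t + c * d ^ 2 * (4 ^ (J + 1) - 1) / 3) := by
        apply hu.nonneg
        refine ⟨?_, ?_⟩
        · rw [← hp2]; exact hzΩ (J + 1) hJ
        · show (0:ℝ) < _
          rw [← e5]
          have : 0 < c * (2 ^ J * d) ^ 2 := by positivity
          have : 0 < clo * d ^ 2 := by positivity
          linarith
      calc u (z, t) ≤ _ := s1
        _ ≤ (2 ^ J) ^ γ * (C * _) := mul_le_mul_of_nonneg_left s2 (by positivity)
        _ ≤ (2 ^ J) ^ γ * (2 ^ γ * _) := by gcongr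
        _ = _ := by rw [hγJ]; ring
    · intro t ht
      have ht' : 4 * (clo * (2 ^ J * d) ^ 2) ≤ t := by
        rw [pow_succ (4 : ℝ) J, h4J] at ht; linarith
      have s1 := (hT t h2d hpn hhp hT1 hT2 (by linarith)).2
      have s2 := ih2 (t + c * (2 ^ J * d) ^ 2) (by rw [h4J]; linarith)
      rw [e6] at s2
      have hpos : 0 ≤ u (p, t + c * (2 ^ J * d) ^ 2) := by
        apply hu.nonneg
        refine ⟨?_, ?_⟩
        · rw [hp]; exact hzΩ J hJ'
        · show (0:ℝ) < _
          linarith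
      calc u (p + (2 ^ J * d) • e, t) ≤ _ := s1
        _ ≤ 2 ^ γ * u (p, t + c * (2 ^ J * d) ^ 2) := by gcongr
        _ ≤ 2 ^ γ * _ := mul_le_mul_of_nonneg_left s2 (by positivity)
        _ = _ := by
          rw [hγJ]
          generalize u (z, _) = v
          generalize ((2 : ℝ) ^ J) ^ γ = v1
          generalize (2 : ℝ) ^ γ = v2
          ring

/-- Polynomial bound of interior values by a deep value. -/
theorem up_bound (n : ℕ) {ν : ℝ} (hν : 0 < ν) {L lam κ g0 a : ℝ} (hL : 1 ≤ L)
    (hκ : 0 < κ) (hg0 : 0 < g0) (ha : 0 ≤ a) :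
    ∃ (C : ℝ) (γ : ℕ), 1 ≤ C ∧ ∀ (Ω : Set (E n)) (u : E n × ℝ → ℝ) (R : ℝ), Sol ν Ω u →
    Dom Ω L R lam → ∀ (x x0 : E n) (w T t : ℝ), x ∈ Ω → 0 < w → w ≤ R →
    w ≤ infDist x (frontier Ω) → ball x0 (κ * R) ⊆ Ω →
    g0 * R ^ 2 ≤ T → T ≤ a * R ^ 2 → g0 * R ^ 2 ≤ t → u (x, t) ≤ C * (R / w) ^ γ * u (x0, t + T) := by
  have hL0 : 0 < L := by linarith
  obtain ⟨γ, Hd⟩ := dyadic n hν (L := L) hL hg0 le_rfl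
  obtain ⟨C, hC, H⟩ := DN n hν (L := L) (lam := lam) (κ := min κ (1 / (6 * L))) (g0 := g0 / 2)
    (a := a) hL (by positivity) (by positivity) ha
  have hκ1 : min κ (1 / (6 * L)) ≤ κ := min_le_left _ _
  have hκ2 : min κ (1 / (6 * L)) ≤ 1 / (6 * L) := min_le_right _ _
  have hκ3 : 0 < min κ (1 / (6 * L)) := by positivity
  obtain ⟨k, hk⟩ : ∃ k, k = min κ (1 / (6 * L)) := ⟨_, rfl⟩
  rw [← hk] at H hκ1 hκ2 hκ3
  have hkL : L * k ≤ 1 / 6 := by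
    rw [le_div_iff₀ (by positivity)] at hκ2; linarith
  have hk6 : k ≤ 1 / 6 := by
    have : 1 * k ≤ L * k := by gcongr
    linarith
  refine ⟨C, γ, hC, ?_⟩
  intro Ω u R hu hD x x0 w T t hx hw hwR hwd hx0 hT1 hT2 ht
  have hR := hD.R0
  have hgR : 0 < g0 * R ^ 2 := by positivity
  have hx0' : ball x0 (k * R) ⊆ Ω := (ball_subset_ball (by gcongr)).trans hx0
  have hx0Ω : x0 ∈ Ω := hx0' (mem_ball_self (by positivity))
  have hun : 0 ≤ u (x0, t + T) := hu.nonneg _ ⟨hx0Ω, show (0:ℝ) < t + T by linarith⟩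
  have hC0 : 0 ≤ C := by linarith
  by_cases hd : R / 3 ≤ infDist x (frontier Ω)
  · have hxk : ball x (k * R) ⊆ Ω := by
      refine (ball_subset_ball ?_).trans (ball_infDist_subset hD.op hx)
      have : k * R ≤ 1 / 6 * R := by gcongr
      linarith
    refine (H Ω u R hu hD x x0 T t hxk hx0' (by linarith) hT2 (by linarith)).trans ?_
    have h1 : 1 ≤ (R / w) ^ γ := one_le_pow₀ (by rw [le_div_iff₀ hw]; linarith)
    apply mul_le_mul_of_nonneg_right _ hun
    have : C * 1 ≤ C * (R / w) ^ γ := by gcongr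
    linarith
  push Not at hd
  obtain ⟨d, hdd⟩ : ∃ d, d = infDist x (frontier Ω) := ⟨_, rfl⟩
  rw [← hdd] at hd hwd
  obtain ⟨y, hy, hxy⟩ := hD.near x
  rw [← hdd] at hxy
  obtain ⟨e, h, hc⟩ := hD.chart y hy
  have hd0 : 0 < d := by linarith
  have hhx : d ≤ h x := hc.h_ge (by linarith) (by rw [hdd]; exact ball_infDist_subset hD.op hx) hd0
  obtain ⟨J, hJ1, hJ2⟩ := exists_nat_pow_near (x := R / 3 / d) (y := (2 : ℝ))
    (by rw [le_div_iff₀ hd0]; linarith) one_lt_two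
  rw [le_div_iff₀ hd0] at hJ1
  rw [div_lt_iff₀ hd0, pow_succ] at hJ2
  have h2J : (1 : ℝ) ≤ 2 ^ J := one_le_pow₀ (by norm_num)
  have hJd : 0 ≤ ((2 : ℝ) ^ J - 1) * d := mul_nonneg (by linarith) hd0.le
  have s1 := (Hd Ω u hu R y e h hc d x g0 hd0 hhx le_rfl le_rfl J (by linarith)).1 t (by
    refine le_trans ?_ ht
    gcongr; linarith)
  obtain ⟨T1, hT1e⟩ : ∃ T1, T1 = g0 * d ^ 2 * (4 ^ J - 1) / 3 := ⟨_, rfl⟩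
  have h4J : (4 : ℝ) ^ J = (2 ^ J) ^ 2 := by rw [← pow_mul, mul_comm, pow_mul]; norm_num
  have hT10 : 0 ≤ T1 := by
    rw [hT1e, h4J]
    have := one_le_pow₀ h2J (n := 2)
    have : 0 ≤ ((2:ℝ) ^ J) ^ 2 - 1 := by linarith
    positivity
  have hT11 : T1 ≤ g0 * R ^ 2 / 2 := by
    have e1 : (2 ^ J * d) ^ 2 ≤ (R / 3) ^ 2 := by gcongr
    have e2 : g0 * (2 ^ J * d) ^ 2 ≤ g0 * (R / 3) ^ 2 := by gcongr
    have : 0 < g0 * d ^ 2 := by positivity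
    rw [hT1e, h4J]
    linarith
  rw [← hT1e] at s1
  obtain ⟨x', hx'⟩ : ∃ x', x' = x + (((2 : ℝ) ^ J - 1) * d) • e := ⟨_, rfl⟩
  rw [← hx'] at s1
  have hkR : k * R ≤ 1 / 6 * R := by gcongr
  have hx'k : ball x' (k * R) ⊆ Ω := by
    apply hc.depth
    · have := norm_add_le (x - y) ((((2 : ℝ) ^ J - 1) * d) • e)
      rw [norm_smul_unit hc.ne hJd] at this
      have e2 : x' - y = x - y + (((2 : ℝ) ^ J - 1) * d) • e := by rw [hx']; abel
      rw [e2]; linarith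
    · rw [hx', hc.shift]
      have : L * k * R ≤ 1 / 6 * R := by gcongr
      linarith
  have s2 := H Ω u R hu hD x' x0 (T - T1) (t + T1) hx'k hx0' (by linarith) (by linarith)
    (by linarith)
  have e3 : t + T1 + (T - T1) = t + T := by ring
  rw [e3] at s2
  have h2R : (2 : ℝ) ^ J ≤ R / w := by
    rw [le_div_iff₀ hw]
    have : (2 : ℝ) ^ J * w ≤ 2 ^ J * d := by gcongr
    linarith
  calc u (x, t) ≤ _ := s1
    _ ≤ (2 ^ J) ^ γ * (C * u (x0, t + T)) := by gcongr
    _ ≤ (R / w) ^ γ * (C * u (x0, t + T)) := by gcongr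
    _ = _ := by ring
end

open MeasureTheory Set Metric Filter
noncomputable section
set_option maxHeartbeats 1000000
set_option linter.deprecated false
set_option linter.unusedVariables false
variable {n : ℕ}

/-- Comparison with a strict supersolution. -/
theorem comparison {ν : ℝ} (hν : 0 < ν) {Ω : Set (E n)} {u ψ : E n × ℝ → ℝ} (hu : Sol ν Ω u)
    {z : E n} {P τ0 τ1 : ℝ} (hτ0 : 0 < τ0)
    (hψc : ContinuousOn ψ ((closure Ω ∩ closedBall z P) ×ˢ Icc τ0 τ1))
    (hψL : ∀ X ∈ (Ω ∩ ball z P) ×ˢ Ioc τ0 τ1, SmAt ψ X ∧ ∀ A, Ell ν A → Lop A ψ X < 0)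
    (h0 : ∀ x ∈ Ω, ‖x - z‖ ≤ P → u (x, τ0) ≤ ψ (x, τ0))
    (hlat : ∀ x ∈ Ω, ‖x - z‖ = P → ∀ τ ∈ Icc τ0 τ1, u (x, τ) ≤ ψ (x, τ))
    (hfr : ∀ x ∈ frontier Ω, ‖x - z‖ ≤ P → ∀ τ ∈ Icc τ0 τ1, 0 ≤ ψ (x, τ)) :
    ∀ x ∈ Ω, ‖x - z‖ ≤ P → ∀ τ ∈ Icc τ0 τ1, u (x, τ) ≤ ψ (x, τ) := by
  have hK : IsCompact ((closure Ω ∩ closedBall z P) ×ˢ Icc τ0 τ1) :=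
    ((isCompact_closedBall z P).inter_left isClosed_closure).prod isCompact_Icc
  have hsub : ((closure Ω ∩ closedBall z P) ×ˢ Icc τ0 τ1) ⊆ closure Ω ×ˢ Ioi (0 : ℝ) := by
    rintro ⟨x, τ⟩ ⟨h1, h2⟩
    exact ⟨h1.1, lt_of_lt_of_le hτ0 h2.1⟩
  have hmp := max_principle (w := fun X => u X - ψ X) hν.le hK ((hu.cont.mono hsub).sub hψc) (by
    rintro ⟨x, τ⟩ hX hpos
    have hx1 : x ∈ closure Ω := hX.1.1
    have hx2 : ‖x - z‖ ≤ P := by have := hX.1.2; rwa [mem_closedBall, dist_eq_norm] at this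
    have hτ1 : τ0 ≤ τ := hX.2.1
    have hτ2 : τ ≤ τ1 := hX.2.2
    have hpos' : 0 < u (x, τ) - ψ (x, τ) := hpos
    have hxΩ : x ∈ Ω := by
      by_contra hn
      have hf : x ∈ frontier Ω := by rw [hu.op.frontier_eq]; exact ⟨hx1, hn⟩
      have e1 := hfr x hf hx2 τ ⟨hτ1, hτ2⟩
      have e2 := hu.bd (x, τ) ⟨hf, lt_of_lt_of_le hτ0 hτ1⟩
      linarith
    have hxP : ‖x - z‖ < P := by
      rcases hx2.lt_or_eq with h | h
      · exact h
      · have := hlat x hxΩ h τ ⟨hτ1, hτ2⟩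
        linarith
    have hττ : τ0 < τ := by
      rcases hτ1.lt_or_eq with h | h
      · exact h
      · have := h0 x hxΩ hx2
        rw [h] at this
        linarith
    have hb : x ∈ ball z P := by rw [mem_ball, dist_eq_norm]; exact hxP
    obtain ⟨hψ1, hψ2⟩ := hψL (x, τ) ⟨⟨hxΩ, hb⟩, hττ, hτ2⟩
    obtain ⟨hus, A, hA, hAL⟩ := hu.sub (x, τ) ⟨hxΩ, hτ0.trans hττ⟩
    refine ⟨?_, hus.sub hψ1, A, hA, ?_⟩
    · have ho : IsOpen ((Ω ∩ ball z P) ×ˢ Ioi τ0) := (hu.op.inter isOpen_ball).prod isOpen_Ioi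
      filter_upwards [ho.mem_nhds (show (x, τ) ∈ (Ω ∩ ball z P) ×ˢ Ioi τ0 from ⟨⟨hxΩ, hb⟩, hττ⟩)]
        with Y hY hYτ
      exact ⟨⟨subset_closure hY.1.1, ball_subset_closedBall hY.1.2⟩, le_of_lt hY.2, hYτ.trans hτ2⟩
    · rw [Lop_sub hus hψ1]
      have := hψ2 A hA
      linarith)
  intro x hx hxP τ hτ
  have := hmp (x, τ) ⟨⟨subset_closure hx, by rw [mem_closedBall, dist_eq_norm]; exact hxP⟩, hτ⟩
  have h2 : u (x, τ) - ψ (x, τ) ≤ 0 := this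
  linarith

/-- Time monotonicity of the sup. -/
theorem sup_mono {ν : ℝ} (hν : 0 < ν) {Ω : Set (E n)} {u : E n × ℝ → ℝ} (hu : Sol ν Ω u)
    (hb : Bornology.IsBounded Ω) {B s : ℝ} (hs : 0 < s) (hB0 : 0 ≤ B)
    (hB : ∀ x ∈ Ω, u (x, s) ≤ B) : ∀ x ∈ Ω, ∀ τ, s ≤ τ → u (x, τ) ≤ B := by
  intro x hx τ hτ
  obtain ⟨P, hP⟩ := hb.subset_ball (0 : E n)
  have key : ∀ ε > 0, u (x, τ) ≤ B + ε * (τ - s) := by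
    intro ε hε
    have hder : ∀ t, HasDerivAt (fun t : ℝ => B + ε * (t - s)) ε t := by
      intro t
      simpa using (((hasDerivAt_id t).sub_const s).const_mul ε).const_add B
    refine comparison hν hu (ψ := fun X => B + ε * (X.2 - s)) (z := 0) (P := P) (τ0 := s) (τ1 := τ)
      hs (by fun_prop) ?_ ?_ ?_ ?_ x hx ?_ τ ⟨hτ, le_rfl⟩
    · intro X hX
      have hcd : ContDiffAt ℝ 2 (fun _ : E n => B + ε * (X.2 - s)) X.1 := contDiffAt_const
      refine ⟨⟨hcd, (hder X.2).differentiableAt⟩, ?_⟩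
      intro A hA
      unfold Lop
      have e1 : Dt (fun X : E n × ℝ => B + ε * (X.2 - s)) X = ε := (hder X.2).deriv
      rw [e1]
      simp only [D2_timefun (fun t => B + ε * (t - s)) X, mul_zero, Finset.sum_const_zero]
      linarith
    · intro x hx _
      simpa using hB x hx
    · intro x hx hxP
      have := hP hx
      rw [mem_ball, dist_eq_norm] at this
      linarith
    · intro x hx _ τ' hτ'
      have := mul_nonneg hε.le (sub_nonneg.2 hτ'.1)
      show 0 ≤ B + ε * (τ' - s)
      linarith
    · have := hP hx
      rw [mem_ball, dist_eq_norm] at this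
      exact this.le
  have hlim : Tendsto (fun ε : ℝ => B + ε * (τ - s)) (nhdsWithin 0 (Ioi 0)) (nhds B) := by
    have : Continuous (fun ε : ℝ => B + ε * (τ - s)) := by fun_prop
    have h2 := this.tendsto 0
    simp only [zero_mul, add_zero] at h2
    exact h2.mono_left nhdsWithin_le_nhds
  refine ge_of_tendsto hlim ?_
  filter_upwards [self_mem_nhdsWithin] with ε hε
  exact key ε hε
end

open MeasureTheory Set Metric Filter
noncomputable section
set_option maxHeartbeats 1000000
set_option linter.deprecated false
set_option linter.unusedVariables false
variable {n : ℕ}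

/-- Exterior-ball barrier. -/
theorem ext_barrier {ν : ℝ} (hν : 0 < ν) {q : ℕ} (hq1 : 1 ≤ q) (hq : n / ν + 1 ≤ 2 * (q + 1) * ν)
    (z : E n) (a0 a1 c0 t1 : ℝ) (hc0 : 0 < c0) (X : E n × ℝ) (hs : 0 < ‖X.1 - z‖ ^ 2)
    (ha1 : a1 < 2 * c0 * q * ((‖X.1 - z‖ ^ 2) ^ (q + 1))⁻¹) :
    SmAt (fun Y : E n × ℝ => a0 + a1 * (t1 - Y.2) - c0 * ((‖Y.1 - z‖ ^ 2) ^ q)⁻¹) X ∧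
    ∀ A, Ell ν A →
      Lop A (fun Y : E n × ℝ => a0 + a1 * (t1 - Y.2) - c0 * ((‖Y.1 - z‖ ^ 2) ^ q)⁻¹) X < 0 := by
  let f : ℝ → ℝ → ℝ := fun s t => a0 + a1 * (t1 - t) - c0 * (s ^ q)⁻¹
  obtain ⟨s0, hs0⟩ : ∃ s0, s0 = ‖X.1 - z‖ ^ 2 := ⟨_, rfl⟩
  rw [← hs0] at hs ha1
  have hf1 : ContDiffAt ℝ 2 (fun s => f s X.2) s0 := by
    simp only [f]
    have : ContDiffAt ℝ 2 (fun s : ℝ => (s ^ q)⁻¹) s0 :=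
      (contDiffAt_id.pow q).inv (pow_ne_zero _ hs.ne')
    exact contDiffAt_const.sub (contDiffAt_const.mul this)
  have hd : ∀ (j : ℕ) (s : ℝ), 0 < s → HasDerivAt (fun s : ℝ => (s ^ j)⁻¹) (-(j * (s ^ (j + 1))⁻¹)) s := by
    intro j s hs
    have := (hasDerivAt_pow j s).inv (pow_ne_zero _ hs.ne')
    refine this.congr_deriv ?_
    rcases j with _ | j
    · simp
    · simp only [Nat.add_sub_cancel]
      field_simp
      ring
  have hd1 : ∀ s, 0 < s → deriv (fun s => f s X.2) s = c0 * q * (s ^ (q + 1))⁻¹ := by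
    intro s hs
    have := (((hd q s hs).const_mul c0).const_sub (a0 + a1 * (t1 - X.2))).deriv
    refine this.trans ?_
    ring
  have hd2 : deriv (deriv (fun s => f s X.2)) s0 = - (c0 * q * (q + 1) * (s0 ^ (q + 2))⁻¹) := by
    have : deriv (fun s => f s X.2) =ᶠ[nhds s0] fun s => c0 * q * (s ^ (q + 1))⁻¹ := by
      filter_upwards [lt_mem_nhds hs] with s hs using hd1 s hs
    rw [this.deriv_eq, ((hd (q + 1) s0 hs).const_mul (c0 * q)).deriv]
    push_cast; ring
  have hdt : HasDerivAt (fun t => f (‖X.1 - z‖ ^ 2) t) (-a1) X.2 := by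
    have := ((((hasDerivAt_id X.2).const_sub t1).const_mul a1).const_add a0).sub_const
      (c0 * ((‖X.1 - z‖ ^ 2) ^ q)⁻¹)
    refine this.congr_deriv ?_
    ring
  rw [hs0] at hf1
  refine ⟨smAt_radial (f := f) z X hf1 hdt.differentiableAt, ?_⟩
  intro A hA
  have hL := Lop_radial (f := f) A z X hf1
  have hgoal : Lop A (fun Y : E n × ℝ => a0 + a1 * (t1 - Y.2) - c0 * ((‖Y.1 - z‖ ^ 2) ^ q)⁻¹) X = _ := hL
  rw [hgoal, hdt.deriv, ← hs0, hd2, hd1 s0 hs]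
  have h1 : ν * s0 ≤ ∑ i, ∑ j, A i j * (X.1 - z) i * (X.1 - z) j := by rw [hs0]; exact hA.quad_ge (X.1 - z)
  have h2 : ∑ i, A i i ≤ n / ν := by have := hA.trace_le; rwa [← div_eq_mul_inv] at this
  obtain ⟨Q, hQ⟩ : ∃ Q, Q = ∑ i, ∑ j, A i j * (X.1 - z) i * (X.1 - z) j := ⟨_, rfl⟩
  obtain ⟨tr, htr⟩ : ∃ tr, tr = ∑ i, A i i := ⟨_, rfl⟩
  rw [← hQ] at h1 ⊢
  rw [← htr] at h2 ⊢
  obtain ⟨G, hG⟩ : ∃ G, G = (s0 ^ (q + 1))⁻¹ := ⟨_, rfl⟩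
  have hG0 : 0 < G := by rw [hG]; positivity
  have hG2 : (s0 ^ (q + 2))⁻¹ * s0 = G := by rw [hG, pow_succ _ (q + 1)]; field_simp
  have hq0 : (1 : ℝ) ≤ q := by exact_mod_cast hq1
  have e1 : c0 * q * (q + 1) * (s0 ^ (q + 2))⁻¹ * (ν * s0) ≤ c0 * q * (q + 1) * (s0 ^ (q + 2))⁻¹ * Q := by
    gcongr
  have e2 : c0 * q * (q + 1) * (s0 ^ (q + 2))⁻¹ * (ν * s0) = c0 * q * G * ((q + 1) * ν) := by
    rw [← hG2]; ring
  have e3 : c0 * q * G * tr ≤ c0 * q * G * (n / ν) := by gcongr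
  have e4 : c0 * q * G * (n / ν + 1) ≤ c0 * q * G * (2 * (q + 1) * ν) := by gcongr
  rw [← hG] at ha1 ⊢
  linarith

/-- Decay step near the lateral boundary. -/
theorem strip_step (n : ℕ) {ν : ℝ} (hν : 0 < ν) {L : ℝ} (hL : 1 ≤ L) :
    ∃ θ A : ℝ, 0 < θ ∧ θ < 1 ∧ 0 < A ∧ ∀ (Ω : Set (E n)) (u : E n × ℝ → ℝ), Sol ν Ω u →
    ∀ (R : ℝ) (y e : E n) (h : E n → ℝ), Chart Ω L R y e h →
    ∀ (w : ℝ) (x0 : E n) (t1 m0 S : ℝ), 0 < w → 2 * w ≤ R → x0 ∈ Ω → ‖x0 - y‖ < w →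
    A * w ^ 2 < t1 → 0 ≤ m0 → 0 ≤ S →
    (∀ x ∈ Ω, ‖x - x0‖ < 6 * w → ∀ τ ∈ Icc (t1 - A * w ^ 2) t1, u (x, τ) ≤ m0 + S) →
    u (x0, t1) ≤ m0 + θ * S := by
  have hL0 : 0 < L := by linarith
  obtain ⟨q, hq⟩ := exists_nat_gt ((n / ν + 1) / (2 * ν) + 1)
  have hnn : 0 ≤ (n / ν + 1) / (2 * ν) := by positivity
  have hq1r : (1 : ℝ) ≤ q := by linarith
  have hq1 : 1 ≤ q := by exact_mod_cast hq1r
  have hqν : n / ν + 1 ≤ 2 * (q + 1) * ν := by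
    have : (n / ν + 1) / (2 * ν) ≤ q := by linarith
    rw [div_le_iff₀ (by positivity)] at this
    linarith
  obtain ⟨β, hβ⟩ : ∃ β, β = ((L ^ 2) ^ q)⁻¹ := ⟨_, rfl⟩
  have hβ0 : 0 < β := by rw [hβ]; positivity
  have hLq : β * (L ^ 2) ^ q = 1 := by rw [hβ]; field_simp
  obtain ⟨g4, hg4⟩ : ∃ g4 : ℝ, g4 = ((4 : ℝ) ^ q)⁻¹ := ⟨_, rfl⟩
  obtain ⟨g16, hg16⟩ : ∃ g16 : ℝ, g16 = ((16 : ℝ) ^ q)⁻¹ := ⟨_, rfl⟩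
  have hg40 : 0 < g4 := by rw [hg4]; positivity
  have hg160 : 0 < g16 := by rw [hg16]; positivity
  have hg41 : g4 < 1 := by
    rw [hg4]; exact inv_lt_one_of_one_lt₀ (one_lt_pow₀ (by norm_num) (by omega))
  have hgg : g16 < g4 := by
    have : g16 = g4 * g4 := by rw [hg16, hg4, ← mul_inv, ← mul_pow]; norm_num
    rw [this]
    have := mul_lt_mul_of_pos_left hg41 hg40
    linarith
  have hβ1 : β ≤ 1 := by
    rw [hβ]; exact inv_le_one_of_one_le₀ (one_le_pow₀ (one_le_pow₀ hL))
  obtain ⟨k, hk⟩ : ∃ k, k = q * g16 / 16 := ⟨_, rfl⟩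
  have hk0 : 0 < k := by rw [hk]; positivity
  have hprod : 0 < β * (g4 - g16) := mul_pos hβ0 (by linarith)
  refine ⟨1 - β * (g4 - g16), (L ^ 2) ^ q / k, ?_, by linarith, by positivity, ?_⟩
  · have : β * (g4 - g16) ≤ 1 * (g4 - g16) := mul_le_mul_of_nonneg_right hβ1 (by linarith)
    linarith
  intro Ω u hu R y e h hch w x0 t1 m0 S hw hwR hx0 hx0y hAt hm0 hS hbd
  rcases hS.eq_or_lt with hS0 | hSp
  · have hAw0 : 0 < (L ^ 2) ^ q / k * w ^ 2 := by positivity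
    have := hbd x0 hx0 (by simp; positivity) t1 ⟨by linarith, le_rfl⟩
    rw [← hS0] at this ⊢; linarith
  obtain ⟨A, hA⟩ : ∃ A, A = (L ^ 2) ^ q / k := ⟨_, rfl⟩
  have hA0 : 0 < A := by rw [hA]; positivity
  have hkA : k * A = (L ^ 2) ^ q := by rw [hA]; field_simp
  rw [← hA] at hAt hbd
  have hw2 : 0 < w ^ 2 := by positivity
  have hAw : 0 < A * w ^ 2 := by positivity
  obtain ⟨z, hz⟩ : ∃ z, z = y + (-w) • e := ⟨_, rfl⟩
  have hzy : ‖y - z‖ = w := by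
    rw [hz, sub_add_cancel_left, neg_smul, neg_neg, norm_smul_unit hch.ne hw.le]
  obtain ⟨c0, hc0⟩ : ∃ c0, c0 = S * β * (w ^ 2) ^ q := ⟨_, rfl⟩
  have hc0p : 0 < c0 := by rw [hc0]; positivity
  obtain ⟨a0, ha0⟩ : ∃ a0, a0 = m0 + S * (1 + β * g16) := ⟨_, rfl⟩
  obtain ⟨a1, ha1⟩ : ∃ a1, a1 = S * β * k / w ^ 2 := ⟨_, rfl⟩
  have ha10 : 0 < a1 := by rw [ha1]; positivity
  have hcl : ∀ x ∈ closure Ω, w / L ≤ ‖x - z‖ := by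
    intro x hx
    have hcl : IsClosed {x : E n | w / L ≤ ‖x - z‖} := isClosed_le continuous_const (by fun_prop)
    have : Ω ⊆ {x : E n | w / L ≤ ‖x - z‖} := fun x hx => by
      show w / L ≤ ‖x - z‖
      rw [hz]; exact hch.ext hw hwR hx
    exact closure_minimal this hcl hx
  have hwL : 0 < w / L := by positivity
  -- upper bound of the power on the closure
  have hup : ∀ x ∈ closure Ω, c0 * ((‖x - z‖ ^ 2) ^ q)⁻¹ ≤ S := by
    intro x hx
    have h1 := hcl x hx
    have h2 : ((w / L) ^ 2) ^ q ≤ (‖x - z‖ ^ 2) ^ q := by gcongr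
    have h3 : 0 < ((w / L) ^ 2) ^ q := by positivity
    rw [← div_eq_mul_inv, div_le_iff₀ (by linarith), hc0]
    have h4 : S * ((w / L) ^ 2) ^ q ≤ S * (‖x - z‖ ^ 2) ^ q := by gcongr
    have h5 : S * β * (w ^ 2) ^ q = S * ((w / L) ^ 2) ^ q := by
      rw [hβ, div_pow, div_pow]; field_simp
    linarith
  have h16 : ∀ x : E n, ‖x - z‖ = 4 * w → c0 * ((‖x - z‖ ^ 2) ^ q)⁻¹ = S * β * g16 := by
    intro x hx
    rw [hx, hc0, hg16, mul_pow, mul_pow]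
    norm_num
    field_simp
  have hcmp := comparison hν hu (ψ := fun Y => a0 + a1 * (t1 - Y.2) - c0 * ((‖Y.1 - z‖ ^ 2) ^ q)⁻¹)
    (z := z) (P := 4 * w) (τ0 := t1 - A * w ^ 2) (τ1 := t1) (by linarith) ?_ ?_ ?_ ?_ ?_
    x0 hx0 ?_ t1 ⟨?_, le_rfl⟩
  · simp only [sub_self, mul_zero, add_zero] at hcmp
    refine hcmp.trans ?_
    have h1 : ‖x0 - z‖ ≤ 2 * w := by
      have := norm_sub_le_norm_sub_add_norm_sub x0 y z
      linarith
    have h0 : 0 < ‖x0 - z‖ := lt_of_lt_of_le hwL (hcl x0 (subset_closure hx0))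
    have h2 : S * β * g4 ≤ c0 * ((‖x0 - z‖ ^ 2) ^ q)⁻¹ := by
      have h3 : (‖x0 - z‖ ^ 2) ^ q ≤ ((2 * w) ^ 2) ^ q := by gcongr
      have h4 : (((2 * w) ^ 2) ^ q)⁻¹ ≤ ((‖x0 - z‖ ^ 2) ^ q)⁻¹ := by gcongr
      have h5 : c0 * (((2 * w) ^ 2) ^ q)⁻¹ = S * β * g4 := by
        rw [hc0, hg4, mul_pow, mul_pow]
        norm_num
        field_simp
      rw [← h5]; gcongr
    rw [ha0]; linarith
  · have hc1 : ContinuousOn (fun Y : E n × ℝ => ((‖Y.1 - z‖ ^ 2) ^ q)⁻¹)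
        ((closure Ω ∩ closedBall z (4 * w)) ×ˢ Icc (t1 - A * w ^ 2) t1) := by
      apply ContinuousOn.inv₀ (by fun_prop)
      intro Y hY
      have := hcl Y.1 hY.1.1
      have : 0 < ‖Y.1 - z‖ := by linarith
      positivity
    have hc2 : Continuous (fun Y : E n × ℝ => a0 + a1 * (t1 - Y.2)) := by fun_prop
    exact hc2.continuousOn.sub (continuousOn_const.mul hc1)
  · rintro X ⟨⟨hX1, hX2⟩, hX3⟩
    rw [mem_ball, dist_eq_norm] at hX2
    have h0 : 0 < ‖X.1 - z‖ := lt_of_lt_of_le hwL (hcl X.1 (subset_closure hX1))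
    apply ext_barrier hν hq1 hqν z a0 a1 c0 t1 hc0p X (by positivity)
    have h3 : (‖X.1 - z‖ ^ 2) ^ (q + 1) ≤ ((4 * w) ^ 2) ^ (q + 1) := by gcongr
    have h4 : (((4 * w) ^ 2) ^ (q + 1))⁻¹ ≤ ((‖X.1 - z‖ ^ 2) ^ (q + 1))⁻¹ := by gcongr
    have h5 : 2 * c0 * q * (((4 * w) ^ 2) ^ (q + 1))⁻¹ = 2 * a1 := by
      rw [hc0, ha1, hk, hg16, mul_pow, mul_pow, pow_succ _ q, pow_succ _ q]
      norm_num
      field_simp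
    have h6 : 2 * c0 * q * (((4 * w) ^ 2) ^ (q + 1))⁻¹ ≤ 2 * c0 * q * ((‖X.1 - z‖ ^ 2) ^ (q + 1))⁻¹ := by
      gcongr
    linarith
  · intro x hx hxP
    have h1 := hbd x hx (by
      have e1 := norm_sub_le_norm_sub_add_norm_sub x z y
      have e2 := norm_sub_le_norm_sub_add_norm_sub x y x0
      rw [norm_sub_rev z y] at e1
      rw [norm_sub_rev y x0] at e2
      linarith) (t1 - A * w ^ 2) ⟨le_rfl, by linarith⟩
    have h2 := hup x (subset_closure hx)
    have h3 : a1 * (t1 - (t1 - A * w ^ 2)) = S := by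
      have : a1 * (t1 - (t1 - A * w ^ 2)) = S * β * (k * A) := by rw [ha1]; field_simp; ring
      rw [this, hkA, mul_assoc, hLq, mul_one]
    show u (x, t1 - A * w ^ 2) ≤ a0 + a1 * (t1 - (t1 - A * w ^ 2)) - _
    have h4 : 0 ≤ S * β * g16 := by positivity
    rw [h3, ha0]; linarith
  · intro x hx hxP τ hτ
    have h1 := hbd x hx (by
      have e1 := norm_sub_le_norm_sub_add_norm_sub x z y
      have e2 := norm_sub_le_norm_sub_add_norm_sub x y x0
      rw [norm_sub_rev z y] at e1
      rw [norm_sub_rev y x0] at e2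
      linarith) τ hτ
    show u (x, τ) ≤ a0 + a1 * (t1 - τ) - c0 * ((‖x - z‖ ^ 2) ^ q)⁻¹
    rw [h16 x hxP, ha0]
    have h4 : 0 ≤ a1 * (t1 - τ) := mul_nonneg ha10.le (by linarith [hτ.2])
    linarith
  · intro x hx hxP τ hτ
    have h2 := hup x (frontier_subset_closure hx)
    have h4 : 0 ≤ a1 * (t1 - τ) := mul_nonneg ha10.le (by linarith [hτ.2])
    have h5 : 0 ≤ S * β * g16 := by positivity
    show 0 ≤ a0 + a1 * (t1 - τ) - c0 * ((‖x - z‖ ^ 2) ^ q)⁻¹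
    rw [ha0]; linarith
  · have := norm_sub_le_norm_sub_add_norm_sub x0 y z
    linarith
  · have : 0 < A * w ^ 2 := by positivity
    linarith
end

open MeasureTheory Set Metric Filter
noncomputable section
set_option maxHeartbeats 1000000
set_option linter.deprecated false
set_option linter.unusedVariables false
variable {n : ℕ}

theorem strip_iter (n : ℕ) {ν : ℝ} (hν : 0 < ν) {L : ℝ} (hL : 1 ≤ L) :
    ∃ θ A : ℝ, 0 < θ ∧ θ < 1 ∧ 0 < A ∧ ∀ (Ω : Set (E n)) (u : E n × ℝ → ℝ) (R lam : ℝ), Sol ν Ω u →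
    Dom Ω L R lam → ∀ (w : ℝ) (y0 : E n) (P s0 s1 D U : ℝ), 0 < w → 2 * w ≤ R → 0 < s0 → 0 ≤ D → 0 ≤ U →
    (∀ x ∈ Ω, ‖x - y0‖ < P → ∀ τ ∈ Icc s0 s1, u (x, τ) ≤ D + U) →
    (∀ x ∈ Ω, ‖x - y0‖ < P → w ≤ infDist x (frontier Ω) → ∀ τ ∈ Icc s0 s1, u (x, τ) ≤ D) →
    ∀ (J : ℕ), ∀ x ∈ Ω, ‖x - y0‖ + 6 * w * J < P → ∀ τ, s0 + J * A * w ^ 2 ≤ τ → τ ≤ s1 →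
      u (x, τ) ≤ D + θ ^ J * U := by
  obtain ⟨θ, A, hθ0, hθ1, hA, H⟩ := strip_step n hν hL
  refine ⟨θ, A, hθ0, hθ1, hA, ?_⟩
  intro Ω u R lam hu hD w y0 P s0 s1 D U hw hwR hs0 hD0 hU0 hbd hdeep J
  induction J with
  | zero =>
    intro x hx hxP τ h1 h2
    rw [pow_zero, one_mul]
    refine hbd x hx ?_ τ ⟨?_, h2⟩
    · simpa using hxP
    · simpa using h1
  | succ J ih =>
    intro x hx hxP τ h1 h2
    push_cast at hxP h1
    have hAw : 0 < A * w ^ 2 := by positivity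
    have hJA : 0 ≤ J * A * w ^ 2 := by positivity
    have hJw : 0 ≤ 6 * w * J := by positivity
    have hpU : 0 ≤ θ ^ J * U := by positivity
    by_cases hd : w ≤ infDist x (frontier Ω)
    · have := hdeep x hx (by linarith) hd τ ⟨by linarith, h2⟩
      have hp : 0 ≤ θ ^ (J + 1) * U := by positivity
      linarith
    · push Not at hd
      obtain ⟨y, hy, hxy⟩ := hD.near x
      obtain ⟨e, h, hch⟩ := hD.chart y hy
      have := H Ω u hu R y e h hch w x τ D (θ ^ J * U) hw hwR hx (by rw [hxy]; exact hd)
        (by linarith) hD0 hpU (by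
          intro x' hx' hxx τ' hτ'
          refine ih x' hx' ?_ τ' ?_ (hτ'.2.trans h2)
          · have := norm_sub_le_norm_sub_add_norm_sub x' x y0
            linarith
          · have := hτ'.1
            linarith)
      rw [pow_succ θ J]
      linarith

theorem Dom.norm_le {Ω : Set (E n)} {L R lam : ℝ} (H : Dom Ω L R lam) {x y : E n} (hx : x ∈ closure Ω)
    (hy : y ∈ closure Ω) : ‖x - y‖ ≤ Metric.diam Ω := by
  rw [← dist_eq_norm, ← Metric.diam_closure]
  exact Metric.dist_le_diam_of_mem H.bdd.closure hx hy

theorem carleson (n : ℕ) {ν : ℝ} (hν : 0 < ν) {L lam κ g0 a : ℝ} (hL : 1 ≤ L) (hκ : 0 < κ)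
    (hg0 : 0 < g0) (ha : 0 ≤ a) : ∃ N : ℝ, 1 ≤ N ∧ ∀ (Ω : Set (E n)) (u : E n × ℝ → ℝ) (R : ℝ),
    Sol ν Ω u → Dom Ω L R lam → ∀ (x0 x : E n) (τ g : ℝ), ball x0 (κ * R) ⊆ Ω → x ∈ Ω →
    R ^ 2 / 2 ≤ τ → g0 * R ^ 2 ≤ g → g ≤ a * R ^ 2 → u (x, τ) ≤ N * u (x0, τ + g) := by
  obtain ⟨θ, A, hθ0, hθ1, hA, HS⟩ := strip_iter n hν hL
  obtain ⟨C, γ, hC, HU⟩ := up_bound n hν (L := L) (lam := lam) (κ := κ) (g0 := min g0 (1 / 4))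
    (a := a + 1) hL hκ (by positivity) (by linarith)
  obtain ⟨J, hJ⟩ := exists_pow_lt_of_lt_one (show (0 : ℝ) < (2 ^ γ)⁻¹ / 2 by positivity) hθ1
  obtain ⟨η, hη⟩ : ∃ η, η = θ ^ J := ⟨_, rfl⟩
  rw [← hη] at hJ
  have hη0 : 0 < η := by rw [hη]; positivity
  have hηγ : η * 2 ^ γ ≤ 1 / 2 := by
    have : η * 2 ^ γ ≤ ((2 ^ γ)⁻¹ / 2) * 2 ^ γ := by gcongr
    refine this.trans (le_of_eq ?_)
    field_simp
  have hη1 : η < 1 := by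
    have h1 : (1 : ℝ) ≤ 2 ^ γ := one_le_pow₀ (by norm_num)
    have h2 : η * 1 ≤ η * 2 ^ γ := by gcongr
    linarith
  obtain ⟨ε, hε0, hε1, hε2⟩ : ∃ ε : ℝ, 0 < ε ∧ ε ≤ 1 / 2 ∧ J * A * ε ^ 2 ≤ 3 / 32 := by
    refine ⟨min (1 / 2) (3 / 32 / (J * A + 1)), by positivity, min_le_left _ _, ?_⟩
    obtain ⟨ε, hε⟩ : ∃ ε : ℝ, ε = min (1 / 2) (3 / 32 / (J * A + 1)) := ⟨_, rfl⟩
    rw [← hε]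
    have h0 : 0 < ε := by rw [hε]; positivity
    have h1 : ε ≤ 1 / 2 := by rw [hε]; exact min_le_left _ _
    have h2 : ε ≤ 3 / 32 / (J * A + 1) := by rw [hε]; exact min_le_right _ _
    rw [le_div_iff₀ (by positivity)] at h2
    have h3 : ε ^ 2 ≤ ε := by rw [pow_two]; have := mul_le_mul_of_nonneg_left h1 h0.le; linarith
    have h4 : J * A * ε ^ 2 ≤ J * A * ε := by gcongr
    linarith
  obtain ⟨D0, hD0⟩ : ∃ D0, D0 = C * (1 / ε) ^ γ := ⟨_, rfl⟩
  have hD0p : 0 < D0 := by rw [hD0]; positivity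
  have hD01 : 1 ≤ D0 := by
    rw [hD0]
    have : 1 ≤ 1 / ε := by rw [le_div_iff₀ hε0]; linarith
    exact one_le_mul_of_one_le_of_one_le hC (one_le_pow₀ this)
  refine ⟨2 * D0, by linarith, ?_⟩
  intro Ω u R hu hD x0 x τ g hx0 hx hτ hg hga
  have hR := hD.R0
  have hR2 : 0 < R ^ 2 := by positivity
  have hx0Ω : x0 ∈ Ω := hx0 (mem_ball_self (by positivity))
  have hτ0 : 0 < τ := by linarith
  have hg00 : 0 < g := lt_of_lt_of_le (by positivity) hg
  obtain ⟨V, hV⟩ : ∃ V, V = u (x0, τ + g) := ⟨_, rfl⟩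
  have hV0 : 0 ≤ V := by rw [hV]; exact hu.nonneg (x0, τ + g) ⟨hx0Ω, by simp; linarith⟩
  rw [← hV]
  obtain ⟨σ, hσ⟩ : ∃ σ : ℕ → ℝ, σ = fun k => τ - R ^ 2 / 8 * (1 - (1 / 4) ^ k) := ⟨_, rfl⟩
  have hp4 : ∀ k : ℕ, (0 : ℝ) < (1 / 4) ^ k ∧ ((1 : ℝ) / 4) ^ k ≤ 1 := fun k =>
    ⟨by positivity, pow_le_one₀ (by norm_num) (by norm_num)⟩
  have hσle : ∀ k, σ k ≤ τ := by
    intro k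
    rw [hσ]
    have := hp4 k
    have : 0 ≤ R ^ 2 / 8 * (1 - (1 / 4) ^ k) := mul_nonneg (by positivity) (by linarith)
    show τ - _ ≤ τ
    linarith
  have hσge : ∀ k, R ^ 2 * (3 / 8) ≤ σ k := by
    intro k
    rw [hσ]
    have := hp4 k
    have : R ^ 2 / 8 * (1 - (1 / 4) ^ k) ≤ R ^ 2 / 8 * 1 := by gcongr; linarith
    show _ ≤ τ - _
    linarith
  obtain ⟨W, hW⟩ : ∃ W : ℕ → ℝ, W = fun k => ε * R * (1 / 2) ^ k := ⟨_, rfl⟩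
  have hp2 : ∀ k : ℕ, (0 : ℝ) < (1 / 2) ^ k ∧ ((1 : ℝ) / 2) ^ k ≤ 1 := fun k =>
    ⟨by positivity, pow_le_one₀ (by norm_num) (by norm_num)⟩
  have hW0 : ∀ k, 0 < W k := by intro k; rw [hW]; positivity
  have hWR : ∀ k, 2 * W k ≤ R := by
    intro k
    rw [hW]
    have : ε * R * (1 / 2) ^ k ≤ (1 / 2) * R * 1 := by
      gcongr
      exact (hp2 k).2
    show 2 * (ε * R * (1 / 2) ^ k) ≤ R
    linarith
  have hstep : ∀ k, σ (k + 1) + J * A * W k ^ 2 ≤ σ k := by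
    intro k
    rw [hσ, hW]
    show τ - R ^ 2 / 8 * (1 - (1 / 4) ^ (k + 1)) + J * A * (ε * R * (1 / 2) ^ k) ^ 2 ≤ τ - R ^ 2 / 8 * (1 - (1 / 4) ^ k)
    have e1 : ((1 / 2 : ℝ) ^ k) ^ 2 = (1 / 4) ^ k := by
      rw [← pow_mul, mul_comm, pow_mul]; norm_num
    have e2 : J * A * (ε * R * (1 / 2) ^ k) ^ 2 = J * A * ε ^ 2 * (R ^ 2 * (1 / 4) ^ k) := by
      rw [← e1]; ring
    have e3 : J * A * ε ^ 2 * (R ^ 2 * (1 / 4) ^ k) ≤ 3 / 32 * (R ^ 2 * (1 / 4) ^ k) := by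
      gcongr
    rw [e2, pow_succ (1 / 4 : ℝ) k]
    linarith
  obtain ⟨Dk, hDk⟩ : ∃ Dk : ℕ → ℝ, Dk = fun k => D0 * V * (2 ^ γ) ^ k := ⟨_, rfl⟩
  have hDk0 : ∀ k, 0 ≤ Dk k := by intro k; rw [hDk]; positivity
  have hDks : ∀ k, Dk (k + 1) = 2 ^ γ * Dk k := by
    intro k; rw [hDk]; show D0 * V * (2 ^ γ) ^ (k + 1) = 2 ^ γ * (D0 * V * (2 ^ γ) ^ k); ring
  have hup : ∀ k, ∀ x ∈ Ω, W k ≤ infDist x (frontier Ω) → ∀ s, σ (k + 1) ≤ s → s ≤ τ → u (x, s) ≤ Dk k := by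
    intro k x hx hxW s hs1 hs2
    have h1 := hσge (k + 1)
    have m1 : min g0 (1 / 4) * R ^ 2 ≤ g0 * R ^ 2 := by gcongr; exact min_le_left _ _
    have m2 : min g0 (1 / 4) * R ^ 2 ≤ 1 / 4 * R ^ 2 := by gcongr; exact min_le_right _ _
    have h2 : τ - R ^ 2 / 8 ≤ s := by
      refine le_trans ?_ hs1
      rw [hσ]
      have := hp4 (k + 1)
      have : R ^ 2 / 8 * (1 - (1 / 4) ^ (k + 1)) ≤ R ^ 2 / 8 * 1 := by gcongr; linarith
      show _ ≤ τ - R ^ 2 / 8 * (1 - (1 / 4) ^ (k + 1))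
      linarith
    have := HU Ω u R hu hD x x0 (W k) (τ + g - s) s hx (hW0 k) (by have := hWR k; have := hW0 k; linarith) hxW
      hx0 (by linarith) (by linarith) (by linarith)
    rw [show s + (τ + g - s) = τ + g by ring, ← hV] at this
    refine this.trans (le_of_eq ?_)
    have e1 : R / W k = 1 / ε * 2 ^ k := by
      rw [hW]
      show R / (ε * R * (1 / 2) ^ k) = _
      rw [one_div_pow]
      field_simp
    rw [e1, hDk, hD0]
    show _ = C * (1 / ε) ^ γ * V * (2 ^ γ) ^ k
    rw [mul_pow, ← pow_mul, ← pow_mul, mul_comm k γ]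
    ring
  -- compactness bound
  obtain ⟨B, hB0, hB⟩ : ∃ B : ℝ, 0 ≤ B ∧ ∀ x ∈ Ω, ∀ s, R ^ 2 * (3 / 8) ≤ s → s ≤ τ → u (x, s) ≤ B := by
    have hK : IsCompact (closure Ω ×ˢ Icc (R ^ 2 * (3 / 8)) τ) :=
      (Metric.isCompact_of_isClosed_isBounded isClosed_closure hD.bdd.closure).prod isCompact_Icc
    obtain ⟨B, hB⟩ := hK.bddAbove_image (f := u) (hu.cont.mono (by
      rintro ⟨x, s⟩ ⟨h1, h2⟩
      exact ⟨h1, lt_of_lt_of_le (by positivity) h2.1⟩))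
    refine ⟨max B 0, le_max_right _ _, fun x hx s h1 h2 => le_max_of_le_left ?_⟩
    exact hB ⟨(x, s), ⟨subset_closure hx, h1, h2⟩, rfl⟩
  have key : ∀ j k : ℕ, ∀ x ∈ Ω, ∀ s, σ k ≤ s → s ≤ τ → u (x, s) ≤ 2 * Dk k + η ^ j * B := by
    intro j
    induction j with
    | zero =>
      intro k x hx s h1 h2
      have := hB x hx s ((hσge k).trans h1) h2
      have := hDk0 k
      rw [pow_zero]
      linarith
    | succ j ih =>
      intro k x hx s h1 h2
      have hηB : 0 ≤ η ^ j * B := by positivity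
      have := HS Ω u R lam hu hD (W k) x0 (Metric.diam Ω + 6 * W k * J + 1) (σ (k + 1)) τ (Dk k)
        (2 * Dk (k + 1) + η ^ j * B) (hW0 k) (hWR k) (lt_of_lt_of_le (by positivity) (hσge (k + 1)))
        (hDk0 k) (by have := hDk0 (k + 1); linarith)
        (fun x hx _ s hs => by
          have := ih (k + 1) x hx s hs.1 hs.2
          have := hDk0 k
          linarith)
        (fun x hx _ hw s hs => hup k x hx hw s hs.1 hs.2) J x hx
        (by have := hD.norm_le (subset_closure hx) (subset_closure hx0Ω); linarith) s
        ((hstep k).trans h1) h2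
      rw [← hη, hDks] at this
      have e1 : η * 2 ^ γ * Dk k ≤ 1 / 2 * Dk k := mul_le_mul_of_nonneg_right hηγ (hDk0 k)
      rw [pow_succ η j]
      linarith
  have hfin : ∀ j : ℕ, u (x, τ) ≤ 2 * D0 * V + η ^ j * B := by
    intro j
    have := key j 0 x hx τ (hσle 0) le_rfl
    rw [hDk] at this
    simpa [mul_assoc] using this
  have hlim : Tendsto (fun j : ℕ => 2 * D0 * V + η ^ j * B) atTop (nhds (2 * D0 * V + 0 * B)) :=
    ((tendsto_pow_atTop_nhds_zero_of_lt_one hη0.le hη1).mul_const B).const_add _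
  rw [zero_mul, add_zero] at hlim
  exact ge_of_tendsto' hlim hfin
end

open MeasureTheory Set Metric Filter
noncomputable section
set_option maxHeartbeats 1000000
set_option linter.deprecated false
set_option linter.unusedVariables false
variable {n : ℕ}

/-- Lateral barrier. -/
theorem lat_barrier {ν : ℝ} (hν : 0 < ν) (p : ℕ) {lm : ℝ}
    (hlm : lm = 4 * (p + 2) * (p + 1) * (n / ν) + 2 * (p + 2) * (n / ν) + 1)
    (z : E n) (M B0 b t0 : ℝ) (hB0 : 0 < B0) (hb : 0 < b) (X : E n × ℝ) :
    SmAt (fun Y : E n × ℝ => M + B0 * (1 + b * ‖Y.1 - z‖ ^ 2) ^ (p + 2) * Real.exp (lm * b * (Y.2 - t0))) X ∧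
    ∀ A, Ell ν A →
      Lop A (fun Y : E n × ℝ => M + B0 * (1 + b * ‖Y.1 - z‖ ^ 2) ^ (p + 2) * Real.exp (lm * b * (Y.2 - t0))) X < 0 := by
  let f : ℝ → ℝ → ℝ := fun s t => M + B0 * (1 + b * s) ^ (p + 2) * Real.exp (lm * b * (t - t0))
  obtain ⟨s0, hs0⟩ : ∃ s0, s0 = ‖X.1 - z‖ ^ 2 := ⟨_, rfl⟩
  have hs : 0 ≤ s0 := by rw [hs0]; positivity
  obtain ⟨G0, hG0⟩ : ∃ G0, G0 = Real.exp (lm * b * (X.2 - t0)) := ⟨_, rfl⟩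
  have hG0p : 0 < G0 := by rw [hG0]; positivity
  have hf1 : ContDiffAt ℝ 2 (fun s => f s X.2) s0 := by
    simp only [f]
    fun_prop
  have hd : ∀ (j : ℕ) (s : ℝ), HasDerivAt (fun s : ℝ => (1 + b * s) ^ (j + 1)) ((j + 1) * b * (1 + b * s) ^ j) s := by
    intro j s
    have := (((hasDerivAt_id s).const_mul b).const_add 1).pow (j + 1)
    refine this.congr_deriv ?_
    simp only [id, Nat.add_sub_cancel]
    push_cast
    ring
  have hd1 : deriv (fun s => f s X.2) = fun s => B0 * (p + 2) * b * (1 + b * s) ^ (p + 1) * G0 := by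
    funext s
    have := ((((hd (p + 1) s).const_mul B0).mul_const G0).const_add M).deriv
    rw [hG0] at this ⊢
    refine this.trans ?_
    push_cast
    ring
  have hd2 : deriv (deriv (fun s => f s X.2)) s0 = B0 * (p + 2) * (p + 1) * b ^ 2 * (1 + b * s0) ^ p * G0 := by
    rw [hd1, (((hd p s0).const_mul (B0 * (p + 2) * b)).mul_const G0).deriv]
    ring
  have hdt : HasDerivAt (fun t => f (‖X.1 - z‖ ^ 2) t) (B0 * (1 + b * s0) ^ (p + 2) * (lm * b) * G0) X.2 := by
    have := (((((hasDerivAt_id X.2).sub_const t0).const_mul (lm * b)).exp).const_mul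
      (B0 * (1 + b * ‖X.1 - z‖ ^ 2) ^ (p + 2))).const_add M
    refine this.congr_deriv ?_
    rw [hG0, hs0]
    simp only [id]
    ring
  rw [hs0] at hf1
  refine ⟨smAt_radial (f := f) z X hf1 hdt.differentiableAt, ?_⟩
  intro A hA
  have hL := Lop_radial (f := f) A z X hf1
  have hgoal : Lop A (fun Y : E n × ℝ => M + B0 * (1 + b * ‖Y.1 - z‖ ^ 2) ^ (p + 2) * Real.exp (lm * b * (Y.2 - t0))) X = _ := hL
  rw [hgoal, hdt.deriv, ← hs0, hd2, hd1]
  have h1 : ∑ i, ∑ j, A i j * (X.1 - z) i * (X.1 - z) j ≤ n / ν * s0 := by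
    rw [hs0, div_eq_mul_inv]; exact hA.quad_le hν (X.1 - z)
  have h2 : ∑ i, A i i ≤ n / ν := by have := hA.trace_le; rwa [← div_eq_mul_inv] at this
  obtain ⟨Q, hQ⟩ : ∃ Q, Q = ∑ i, ∑ j, A i j * (X.1 - z) i * (X.1 - z) j := ⟨_, rfl⟩
  obtain ⟨tr, htr⟩ : ∃ tr, tr = ∑ i, A i i := ⟨_, rfl⟩
  rw [← hQ] at h1 ⊢
  rw [← htr] at h2 ⊢
  obtain ⟨c, hc⟩ : ∃ c : ℝ, c = n / ν := ⟨_, rfl⟩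
  have hc0 : 0 ≤ c := by rw [hc]; positivity
  rw [← hc] at h1 h2 hlm
  obtain ⟨G, hG⟩ : ∃ G, G = 1 + b * s0 := ⟨_, rfl⟩
  have hbs : 0 ≤ b * s0 := by positivity
  have hG1 : 1 ≤ G := by rw [hG]; linarith
  have hGp : 0 < G := by linarith
  show 4 * (B0 * (p + 2) * (p + 1) * b ^ 2 * (1 + b * s0) ^ p * G0) * Q +
    2 * (B0 * (p + 2) * b * (1 + b * s0) ^ (p + 1) * G0) * tr - B0 * (1 + b * s0) ^ (p + 2) * (lm * b) * G0 < 0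
  rw [← hG]
  have e1 : b * Q ≤ c * G := by
    have := mul_le_mul_of_nonneg_left h1 hb.le
    have h3 : c * (b * s0) ≤ c * G := by gcongr; rw [hG]; linarith
    linarith
  have k0 : 0 < B0 * b * G0 * G ^ p := by positivity
  have e2 : 4 * (p + 2) * (p + 1) * (b * Q) ≤ 4 * (p + 2) * (p + 1) * (c * G) := by gcongr
  have e3 : 2 * (p + 2) * G * tr ≤ 2 * (p + 2) * G * c := by gcongr
  have e4 : lm * G * 1 ≤ lm * G * G := by
    have : 0 < lm := by rw [hlm]; positivity
    gcongr
  have e5 : 4 * (p + 2) * (p + 1) * (b * Q) + 2 * (p + 2) * G * tr - lm * G * G < 0 := by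
    rw [hlm] at e4 ⊢
    linarith
  have e6 := mul_neg_of_pos_of_neg k0 e5
  refine lt_of_eq_of_lt ?_ e6
  rw [pow_succ G p, pow_succ G (p + 1), pow_succ G p]
  ring

theorem lateral {ν : ℝ} (hν : 0 < ν) (p : ℕ) {lm : ℝ}
    (hlm : lm = 4 * (p + 2) * (p + 1) * (n / ν) + 2 * (p + 2) * (n / ν) + 1)
    {Ω : Set (E n)} {u : E n × ℝ → ℝ} (hu : Sol ν Ω u) {z : E n} {r K τ0 M U : ℝ} (hr : 0 < r) (hK : 2 ≤ K)
    (hτ0 : 0 < τ0) (hM : 0 ≤ M) (hU : 0 ≤ U)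
    (h0 : ∀ x ∈ Ω, ‖x - z‖ ≤ K * r / 2 → u (x, τ0) ≤ M)
    (h1 : ∀ x ∈ Ω, ‖x - z‖ ≤ K * r / 2 → ∀ τ ∈ Icc τ0 (τ0 + 2 * r ^ 2), u (x, τ) ≤ U) :
    ∀ x ∈ Ω, ‖x - z‖ ≤ r → u (x, τ0 + 2 * r ^ 2) ≤ M + U * (8 / K ^ 2) ^ (p + 2) * Real.exp (2 * lm) := by
  intro x hx hxr
  have hr2 : 0 < r ^ 2 := by positivity
  have hxP : ‖x - z‖ ≤ K * r / 2 := by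
    have : 2 * r ≤ K * r := by gcongr
    linarith
  rcases hU.eq_or_lt with hU0 | hUp
  · have := h1 x hx hxP (τ0 + 2 * r ^ 2) ⟨by linarith, le_rfl⟩
    rw [← hU0] at this ⊢
    simp only [zero_mul, add_zero]
    linarith
  have hK0 : 0 < K := by linarith
  have hlm0 : 0 < lm := by rw [hlm]; positivity
  obtain ⟨F, hF⟩ : ∃ F, F = (1 + K ^ 2 / 4) ^ (p + 2) := ⟨_, rfl⟩
  have hFp : 0 < F := by rw [hF]; positivity
  have hψ : ∀ X : E n × ℝ, _ := lat_barrier hν p hlm z M (U / F) ((r ^ 2)⁻¹) τ0 (by positivity) (by positivity)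
  have hnn : ∀ (x : E n) (τ : ℝ), 0 ≤ U / F * (1 + (r ^ 2)⁻¹ * ‖x - z‖ ^ 2) ^ (p + 2) * Real.exp (lm * (r ^ 2)⁻¹ * (τ - τ0)) := by
    intro x τ; positivity
  have hcmp := comparison hν hu
    (ψ := fun Y => M + U / F * (1 + (r ^ 2)⁻¹ * ‖Y.1 - z‖ ^ 2) ^ (p + 2) * Real.exp (lm * (r ^ 2)⁻¹ * (Y.2 - τ0)))
    (z := z) (P := K * r / 2) (τ0 := τ0) (τ1 := τ0 + 2 * r ^ 2) hτ0 ?_ ?_ ?_ ?_ ?_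
    x hx hxP (τ0 + 2 * r ^ 2) ⟨by linarith, le_rfl⟩
  · refine hcmp.trans ?_
    show M + U / F * (1 + (r ^ 2)⁻¹ * ‖x - z‖ ^ 2) ^ (p + 2) * Real.exp (lm * (r ^ 2)⁻¹ * (τ0 + 2 * r ^ 2 - τ0)) ≤ _
    rw [show lm * (r ^ 2)⁻¹ * (τ0 + 2 * r ^ 2 - τ0) = 2 * lm by field_simp; ring]
    have e1 : (r ^ 2)⁻¹ * ‖x - z‖ ^ 2 ≤ 1 := by
      rw [inv_mul_le_iff₀ hr2, mul_one]; gcongr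
    have e2 : U / F * (1 + (r ^ 2)⁻¹ * ‖x - z‖ ^ 2) ^ (p + 2) ≤ U * (8 / K ^ 2) ^ (p + 2) := by
      have e3 : (1 + (r ^ 2)⁻¹ * ‖x - z‖ ^ 2) ^ (p + 2) ≤ 2 ^ (p + 2) := by gcongr; linarith
      have e4 : (2 : ℝ) ^ (p + 2) ≤ (8 / K ^ 2) ^ (p + 2) * F := by
        rw [hF, ← mul_pow]
        gcongr
        rw [mul_add, mul_one, show 8 / K ^ 2 * (K ^ 2 / 4) = 2 by field_simp; norm_num]
        have : 0 < 8 / K ^ 2 := by positivity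
        linarith
      calc U / F * (1 + (r ^ 2)⁻¹ * ‖x - z‖ ^ 2) ^ (p + 2) ≤ U / F * ((8 / K ^ 2) ^ (p + 2) * F) := by
            gcongr; exact e3.trans e4
        _ = _ := by field_simp
    gcongr
  · apply Continuous.continuousOn
    fun_prop
  · intro X hX
    exact hψ X
  · intro x hx hxP
    have := h0 x hx hxP
    have := hnn x τ0
    show u (x, τ0) ≤ M + U / F * (1 + (r ^ 2)⁻¹ * ‖x - z‖ ^ 2) ^ (p + 2) * Real.exp (lm * (r ^ 2)⁻¹ * (τ0 - τ0))
    linarith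
  · intro x hx hxP τ hτ
    have e1 := h1 x hx hxP.le τ hτ
    show u (x, τ) ≤ M + U / F * (1 + (r ^ 2)⁻¹ * ‖x - z‖ ^ 2) ^ (p + 2) * Real.exp (lm * (r ^ 2)⁻¹ * (τ - τ0))
    have e2 : (1 + (r ^ 2)⁻¹ * ‖x - z‖ ^ 2) ^ (p + 2) = F := by
      rw [hxP, hF]; congr 1; field_simp; ring
    have e3 : 1 ≤ Real.exp (lm * (r ^ 2)⁻¹ * (τ - τ0)) :=
      Real.one_le_exp (mul_nonneg (by positivity) (by linarith [hτ.1]))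
    rw [e2, div_mul_cancel₀ _ hFp.ne']
    have := mul_le_mul_of_nonneg_left e3 hU
    linarith
  · intro x hx hxP τ hτ
    have := hnn x τ
    show 0 ≤ M + U / F * (1 + (r ^ 2)⁻¹ * ‖x - z‖ ^ 2) ^ (p + 2) * Real.exp (lm * (r ^ 2)⁻¹ * (τ - τ0))
    linarith
end

open MeasureTheory Set Metric Filter
noncomputable section
set_option maxHeartbeats 1000000
set_option linter.deprecated false
set_option linter.unusedVariables false
variable {n : ℕ}

/-- Boundary estimate at scale `r`. -/
def BE (Ω : Set (E n)) (L R : ℝ) (u : E n × ℝ → ℝ) (N r : ℝ) : Prop :=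
  ∀ (y e : E n) (h : E n → ℝ), Chart Ω L R y e h → ∀ s, R ^ 2 - 4 * r ^ 2 ≤ s → ∀ x ∈ Ω, ‖x - y‖ < r →
    u (x, s) ≤ N * u (y + r • e, s - r ^ 2)

theorem Chart.h_up {Ω : Set (E n)} {L R : ℝ} {y e : E n} {h : E n → ℝ} (H : Chart Ω L R y e h) (r : ℝ) :
    h (y + r • e) = r := by rw [H.shift, H.base, zero_add]

theorem Chart.n_up {Ω : Set (E n)} {L R : ℝ} {y e : E n} {h : E n → ℝ} (H : Chart Ω L R y e h) {r : ℝ}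
    (hr : 0 ≤ r) : ‖y + r • e - y‖ = r := by rw [add_sub_cancel_left, norm_smul_unit H.ne hr]

theorem Chart.m_up {Ω : Set (E n)} {L R : ℝ} {y e : E n} {h : E n → ℝ} (H : Chart Ω L R y e h) {r : ℝ}
    (hr : 0 < r) (hrR : r < R) : y + r • e ∈ Ω := by
  rw [H.mem _ (by rw [H.n_up hr.le]; exact hrR), H.h_up]; exact hr

theorem be_base (n : ℕ) {ν : ℝ} (hν : 0 < ν) {L lam c : ℝ} (hL : 1 ≤ L) (hc : 0 < c) :
    ∃ N : ℝ, 1 ≤ N ∧ ∀ (Ω : Set (E n)) (u : E n × ℝ → ℝ) (R : ℝ), Sol ν Ω u → Dom Ω L R lam →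
    ∀ r, c * R ≤ r → r ≤ R / 4 → BE Ω L R u N r := by
  have hL0 : 0 < L := by linarith
  obtain ⟨N, hN, H⟩ := carleson n hν (L := L) (lam := lam) (κ := c / L) (g0 := 1 / 8) (a := 1 / 8) hL
    (by positivity) (by norm_num) (by norm_num)
  refine ⟨N, hN, ?_⟩
  intro Ω u R hu hD r hr1 hr2 y e h hch s hs x hx hxy
  have hR := hD.R0
  have hr : 0 < r := lt_of_lt_of_le (by positivity) hr1
  have hR2 : 0 < R ^ 2 := by positivity
  have hrr : r ^ 2 ≤ (R / 4) ^ 2 := by gcongr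
  have hrr' : r ^ 2 ≤ R ^ 2 / 16 := by rw [div_pow] at hrr; linarith
  have hcL : c / L * R ≤ r := by
    refine le_trans ?_ hr1
    gcongr
    exact div_le_self hc.le hL
  have hball : ball (y + r • e) (c / L * R) ⊆ Ω := by
    apply hch.depth
    · rw [hch.n_up hr.le]; linarith
    · rw [hch.h_up, ← mul_assoc, mul_div_cancel₀ _ hL0.ne']; exact hr1
  have hin : y + r • e ∈ Ω := hch.m_up hr (by linarith)
  have hr20 : 0 < r ^ 2 := by positivity
  have hnn : 0 ≤ u (y + r • e, s - r ^ 2) := hu.nonneg (y + r • e, s - r ^ 2) ⟨hin, by simp; linarith⟩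
  refine sup_mono hν hu hD.bdd (s := s - r ^ 2 - R ^ 2 / 8) (by linarith) (by positivity) ?_ x hx s (by linarith)
  intro x' hx'
  have := H Ω u R hu hD (y + r • e) x' (s - r ^ 2 - R ^ 2 / 8) (R ^ 2 / 8) hball hx' (by linarith) (by linarith)
    (by linarith)
  rwa [sub_add_cancel] at this

theorem be_step (n : ℕ) {ν : ℝ} (hν : 0 < ν) {L lam : ℝ} (hL : 1 ≤ L) :
    ∃ C K : ℝ, 1 ≤ C ∧ 2 ≤ K ∧ ∀ (Ω : Set (E n)) (u : E n × ℝ → ℝ) (R : ℝ), Sol ν Ω u → Dom Ω L R lam →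
    ∀ N r, 0 < r → 2 * C ≤ N → (4 * L + 8) * (K * r) ≤ R → BE Ω L R u N (K * r) → BE Ω L R u N r := by
  obtain ⟨γ, HD⟩ := dyadic n hν (clo := 3) (chi := 6) hL (by norm_num) (by norm_num)
  obtain ⟨θ, A, hθ0, hθ1, hA, HS⟩ := strip_iter n hν hL
  obtain ⟨lm, hlm⟩ : ∃ lm : ℝ, lm = 4 * (γ + 2) * (γ + 1) * (n / ν) + 2 * (γ + 2) * (n / ν) + 1 := ⟨_, rfl⟩
  obtain ⟨Z, hZ⟩ : ∃ Z : ℝ, Z = 8 ^ (γ + 2) * Real.exp (2 * lm) := ⟨_, rfl⟩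
  have hZ0 : 0 < Z := by rw [hZ]; positivity
  obtain ⟨J', hJ'⟩ := pow_unbounded_of_one_lt (4 * Z + 2) (one_lt_two)
  obtain ⟨K, hK⟩ : ∃ K : ℝ, K = 2 ^ J' := ⟨_, rfl⟩
  rw [← hK] at hJ'
  have hK2 : 2 ≤ K := by linarith
  have hK0 : 0 < K := by linarith
  have hKZ : K ^ γ * ((8 / K ^ 2) ^ (γ + 2) * Real.exp (2 * lm)) ≤ 1 / 4 := by
    have e1 : K ^ γ * ((8 / K ^ 2) ^ (γ + 2) * Real.exp (2 * lm)) = Z / (K ^ γ * K ^ 4) := by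
      rw [hZ, div_pow, ← pow_mul, show 2 * (γ + 2) = γ + γ + 4 by ring, pow_add K, pow_add K]
      field_simp
    rw [e1, div_le_iff₀ (by positivity)]
    have e2 : 1 ≤ K ^ γ := one_le_pow₀ (by linarith)
    have e3 : 1 ≤ K ^ 3 := one_le_pow₀ (by linarith)
    have e4 : 1 * (1 * K) ≤ K ^ γ * (K ^ 3 * K) := by gcongr
    have e5 : K ^ γ * (K ^ 3 * K) = K ^ γ * K ^ 4 := by ring
    linarith
  obtain ⟨J, hJ⟩ := exists_pow_lt_of_lt_one (show (0 : ℝ) < (K ^ γ)⁻¹ / 4 by positivity) hθ1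
  obtain ⟨η, hη⟩ : ∃ η, η = θ ^ J := ⟨_, rfl⟩
  rw [← hη] at hJ
  have hη0 : 0 < η := by rw [hη]; positivity
  have hηγ : K ^ γ * η ≤ 1 / 4 := by
    have : K ^ γ * η ≤ K ^ γ * ((K ^ γ)⁻¹ / 4) := by gcongr
    refine this.trans (le_of_eq ?_)
    field_simp
  obtain ⟨ε, hε0, hε1, hε2, hε3⟩ : ∃ ε : ℝ, 0 < ε ∧ ε ≤ 1 ∧ 6 * ε * J < 1 ∧ J * A * ε ^ 2 ≤ 1 := by
    obtain ⟨q, hq⟩ : ∃ q : ℝ, q = 6 * J + J * A + 1 := ⟨_, rfl⟩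
    have hJA : 0 ≤ J * A := by positivity
    have hJ0 : (0 : ℝ) ≤ J := by positivity
    have hq0 : 0 < q := by rw [hq]; positivity
    have hε : 0 < q⁻¹ := by positivity
    have h1 : q⁻¹ * q = 1 := inv_mul_cancel₀ hq0.ne'
    obtain ⟨ε, hεd⟩ : ∃ ε : ℝ, ε = q⁻¹ := ⟨_, rfl⟩
    rw [← hεd] at hε h1
    rw [hq] at h1
    have i1 : 0 ≤ ε * J := by positivity
    have i2 : 0 ≤ ε * (J * A) := by positivity
    have i3 : ε ≤ 1 := by linarith
    refine ⟨ε, hε, i3, by linarith, ?_⟩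
    have : (ε * (J * A)) * ε ≤ (ε * (J * A)) * 1 := by gcongr
    linarith
  obtain ⟨C, hC, HL⟩ := LH n hν (L := L) (ε := ε / K) (g0 := 1 / K ^ 2) (a := 2) hL (by positivity)
    (by rw [div_le_one hK0]; linarith) (by positivity) (by norm_num)
  refine ⟨C, K, hC, hK2, ?_⟩
  intro Ω u R hu hD N r hr hN hrR hBE y e h hch s hs x hx hxy
  have hR := hD.R0
  have hN0 : 0 < N := by linarith
  have hr2 : 0 < r ^ 2 := by positivity
  have hKr : 0 < K * r := by positivity
  have hKr2 : 2 * r ≤ K * r := by gcongr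
  have hKR : 12 * (K * r) ≤ R := by
    have : 4 * 1 * (K * r) ≤ 4 * L * (K * r) := by gcongr
    linarith
  have hLR : (2 * L + 4) * (K * r) ≤ R := by
    have : 0 < (2 * L + 4) * (K * r) := by positivity
    linarith
  have hKR2 : 144 * (K ^ 2 * r ^ 2) ≤ R ^ 2 := by
    have : (12 * (K * r)) ^ 2 ≤ R ^ 2 := by gcongr
    have e : (12 * (K * r)) ^ 2 = 144 * (K ^ 2 * r ^ 2) := by ring
    linarith
  have hK4 : 4 ≤ K ^ 2 := by
    have : (2 : ℝ) ^ 2 ≤ K ^ 2 := by gcongr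
    linarith
  have hKr4 : 4 * r ^ 2 ≤ K ^ 2 * r ^ 2 := by gcongr
  have hsq : (K * r) ^ 2 = K ^ 2 * r ^ 2 := by ring
  have hqΩ : y + r • e ∈ Ω := hch.m_up hr (by linarith)
  obtain ⟨H, hH⟩ : ∃ H, H = u (y + r • e, s - r ^ 2) := ⟨_, rfl⟩
  have hH0 : 0 ≤ H := by
    rw [hH]; exact hu.nonneg (y + r • e, s - r ^ 2) ⟨hqΩ, by simp; linarith⟩
  -- the crude bound
  have hU : ∀ x ∈ Ω, ‖x - y‖ < K * r → ∀ s' ∈ Icc (s - 3 * r ^ 2) s, u (x, s') ≤ N * K ^ γ * H := by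
    intro x hx hxy s' hs'
    have h1 := hBE y e h hch s' (by rw [hsq]; linarith [hs'.1]) x hx hxy
    have hden : 0 < r ^ 2 * (K ^ 2 - 1) := mul_pos hr2 (by linarith)
    have hden3 : r ^ 2 * 3 ≤ r ^ 2 * (K ^ 2 - 1) := by gcongr; linarith
    obtain ⟨q, hq⟩ : ∃ q, q = (s - s') / (r ^ 2 * (K ^ 2 - 1)) := ⟨_, rfl⟩
    have hq' : q * (r ^ 2 * (K ^ 2 - 1)) = s - s' := by rw [hq]; exact div_mul_cancel₀ _ hden.ne'
    have hq0 : 0 ≤ q := by rw [hq]; exact div_nonneg (by linarith [hs'.2]) hden.le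
    have hq1 : q ≤ 1 := by rw [hq, div_le_one hden]; linarith [hs'.1]
    have h2 := (HD Ω u hu R y e h hch r (y + r • e) (3 + 3 * q) hr (by rw [hch.h_up]) (by linarith)
      (by linarith) J' (by rw [hch.n_up hr.le, ← hK]; linarith)).2 (s' - (K * r) ^ 2) (by
        have : (4 : ℝ) ^ J' = K ^ 2 := by rw [hK, ← pow_mul, mul_comm, pow_mul]; norm_num
        rw [this, hsq]; linarith [hs'.1])
    have h4 : (4 : ℝ) ^ J' = K ^ 2 := by rw [hK, ← pow_mul, mul_comm, pow_mul]; norm_num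
    rw [h4, ← hK] at h2
    have h5 : y + r • e + ((K - 1) * r) • e = y + (K * r) • e := by
      rw [add_assoc, ← add_smul]; congr 2; ring
    have h6 : s' - (K * r) ^ 2 + (3 + 3 * q) * r ^ 2 * (K ^ 2 - 1) / 3 = s - r ^ 2 := by
      rw [hsq]; linarith
    rw [h5, h6, ← hH] at h2
    have h3 := mul_le_mul_of_nonneg_left h2 hN0.le
    linarith
  -- the interior bound
  have hI : ∀ x ∈ Ω, ‖x - y‖ < K * r → ε * r ≤ infDist x (frontier Ω) →
      ∀ s' ∈ Icc (s - 3 * r ^ 2) (s - 2 * r ^ 2), u (x, s') ≤ C * H := by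
    intro x hx hxy hd s' hs'
    have hεr : 0 < ε * r := by positivity
    have hεr1 : ε * r ≤ 1 * r := by gcongr
    have hb : ball x (ε * r) ⊆ Ω := (ball_subset_ball hd).trans (ball_infDist_subset hD.op hx)
    have hhx := hch.h_ge (by linarith) hb hεr
    have e1 : ε / K * (K * r) = ε * r := by field_simp
    have e2 : 1 / K ^ 2 * (K * r) ^ 2 = r ^ 2 := by field_simp
    have := HL Ω u hu R y e h hch (K * r) x (y + r • e) (s - r ^ 2 - s') s' hKr hLR hxy.le
      (by rw [hch.n_up hr.le]; linarith) (by rw [e1]; exact hhx) (by rw [e1, hch.h_up]; linarith)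
      (by rw [e2]; linarith [hs'.2]) (by rw [hsq]; linarith [hs'.1]) (by rw [e2]; linarith [hs'.1])
    rwa [add_sub_cancel, ← hH] at this
  have hKγ : 0 < K ^ γ := by positivity
  have hU0 : 0 ≤ N * K ^ γ * H := by positivity
  have hCH : 0 ≤ C * H := mul_nonneg (by linarith) hH0
  have hεr : 0 < ε * r := by positivity
  have hεr1 : ε * r ≤ 1 * r := by gcongr
  have hM : ∀ x ∈ Ω, ‖x - y‖ ≤ K * r / 2 → u (x, s - 2 * r ^ 2) ≤ C * H + η * (N * K ^ γ * H) := by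
    intro x hx hxy
    rw [hη]
    refine HS Ω u R lam hu hD (ε * r) y (K * r) (s - 3 * r ^ 2) (s - 2 * r ^ 2) (C * H) (N * K ^ γ * H) hεr
      (by linarith) (by linarith) hCH hU0 ?_ hI J x hx ?_ (s - 2 * r ^ 2) ?_ le_rfl
    · intro x hx hxy τ hτ
      have := hU x hx hxy τ ⟨hτ.1, by linarith [hτ.2]⟩
      linarith
    · have : 6 * ε * J * r < 1 * r := by gcongr
      linarith
    · have : J * A * ε ^ 2 * r ^ 2 ≤ 1 * r ^ 2 := by gcongr
      rw [mul_pow]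
      linarith
  have hfin := lateral hν γ hlm hu (z := y) (r := r) (K := K) (τ0 := s - 2 * r ^ 2)
    (M := C * H + η * (N * K ^ γ * H)) (U := N * K ^ γ * H) hr hK2 (by linarith) (by positivity) hU0 hM
    (fun x hx hxy τ hτ => hU x hx (by linarith) τ ⟨by linarith [hτ.1], by linarith [hτ.2]⟩) x hx hxy.le
  rw [sub_add_cancel] at hfin
  refine hfin.trans ?_
  rw [← hH]
  have hNH : 0 ≤ N * H := by positivity
  have f1 := mul_le_mul_of_nonneg_left hηγ hNH
  have f2 := mul_le_mul_of_nonneg_left hKZ hNH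
  have f3 := mul_le_mul_of_nonneg_right hN hH0
  obtain ⟨X1, hX1⟩ : ∃ X1, X1 = (8 / K ^ 2) ^ (γ + 2) := ⟨_, rfl⟩
  obtain ⟨X2, hX2⟩ : ∃ X2, X2 = Real.exp (2 * lm) := ⟨_, rfl⟩
  rw [← hX1, ← hX2] at f2 ⊢
  linarith

theorem be_all (n : ℕ) {ν : ℝ} (hν : 0 < ν) {L lam : ℝ} (hL : 1 ≤ L) :
    ∃ N : ℝ, 1 ≤ N ∧ ∀ (Ω : Set (E n)) (u : E n × ℝ → ℝ) (R : ℝ), Sol ν Ω u → Dom Ω L R lam →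
    ∀ r, 0 < r → (4 * L + 8) * r ≤ R → BE Ω L R u N r := by
  obtain ⟨C, K, hC, hK, HS⟩ := be_step n hν (lam := lam) hL
  have hK0 : 0 < K := by linarith
  obtain ⟨N0, hN0, HB⟩ := be_base n hν (L := L) (lam := lam) (c := ((4 * L + 8) * K)⁻¹) hL (by positivity)
  refine ⟨max N0 (2 * C), le_max_of_le_left hN0, ?_⟩
  obtain ⟨N, hN⟩ : ∃ N, N = max N0 (2 * C) := ⟨_, rfl⟩
  rw [← hN]
  intro Ω u R hu hD
  have hR := hD.R0
  have base : ∀ r, R ≤ (4 * L + 8) * K * r → (4 * L + 8) * r ≤ R → BE Ω L R u N r := by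
    intro r h1 h2 y e h hch s hs x hx hxy
    have hr : 0 < r := lt_of_le_of_lt (norm_nonneg _) hxy
    have h3 : 0 < L * r := by positivity
    have hrR : r ≤ R / 4 := by linarith
    have := HB Ω u R hu hD r (by rw [inv_mul_le_iff₀ (by positivity)]; exact h1) hrR y e h hch s hs x hx hxy
    refine this.trans ?_
    have hrr : r ^ 2 ≤ (R / 4) ^ 2 := by gcongr
    have hR2 : 0 < R ^ 2 := by positivity
    rw [div_pow] at hrr
    have hnn : 0 ≤ u (y + r • e, s - r ^ 2) := hu.nonneg (y + r • e, s - r ^ 2)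
      ⟨hch.m_up hr (by linarith), by simp; linarith⟩
    have : N0 ≤ N := by rw [hN]; exact le_max_left _ _
    gcongr
  have ind : ∀ (j : ℕ) (r : ℝ), 0 < r → (4 * L + 8) * r ≤ R → R ≤ (4 * L + 8) * K ^ (j + 1) * r → BE Ω L R u N r := by
    intro j
    induction j with
    | zero =>
      intro r hr h1 h2
      rw [zero_add, pow_one] at h2
      exact base r h2 h1
    | succ j ih =>
      intro r hr h1 h2
      by_cases h3 : R ≤ (4 * L + 8) * K * r
      · exact base r h3 h1
      · push Not at h3
        have h4 : (4 * L + 8) * (K * r) ≤ R := by linarith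
        refine HS Ω u R hu hD N r hr (by rw [hN]; exact le_max_right _ _) h4 ?_
        refine ih (K * r) (by positivity) h4 (h2.trans (le_of_eq ?_))
        rw [pow_succ K (j + 1)]; ring
  intro r hr h1
  obtain ⟨j, hj⟩ := pow_unbounded_of_one_lt (R / ((4 * L + 8) * r)) (show 1 < K by linarith)
  refine ind j r hr h1 ?_
  rw [div_lt_iff₀ (by positivity)] at hj
  have : K ^ j * 1 ≤ K ^ j * K := by gcongr; linarith
  rw [pow_succ K j]
  have h5 : 0 < (4 * L + 8) * r := by positivity
  have := mul_le_mul_of_nonneg_right this h5.le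
  linarith
end

open MeasureTheory Set Metric Filter
noncomputable section
set_option maxHeartbeats 1000000
set_option linter.deprecated false
set_option linter.unusedVariables false
variable {n : ℕ}

theorem core (n : ℕ) {ν : ℝ} (hν : 0 < ν) {L lam μ : ℝ} (hL : 1 ≤ L) (hμ : 0 < μ) (hμ1 : μ ≤ 1) :
    ∃ N : ℝ, 0 < N ∧ ∀ (Ω : Set (E n)) (u : E n × ℝ → ℝ) (R : ℝ), Sol ν Ω u → Dom Ω L R lam →
    ∀ x ∈ Ω, ∀ t r : ℝ, μ * r < infDist x (frontier Ω) → R ^ 2 < t → 0 < r → r ≤ R / 2 →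
      u (x, t + r ^ 2) ≤ N * u (x, t - r ^ 2) := by
  have hL0 : 0 < L := by linarith
  obtain ⟨N1, hN1, HB⟩ := be_all n hν (lam := lam) hL
  obtain ⟨C, hC, HL⟩ := LH n hν (L := L) (ε := μ / 2) (g0 := 1 / 2) (a := 1) hL (by positivity)
    (by linarith) (by norm_num) (by norm_num)
  obtain ⟨N2, hN2, HC⟩ := carleson n hν (L := L) (lam := lam) (κ := μ / (8 * L + 16)) (g0 := 1 / 8) (a := 1 / 8) hL
    (by positivity) (by norm_num) (by norm_num)
  refine ⟨N1 * C + N2, by positivity, ?_⟩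
  intro Ω u R hu hD x hx t r hd ht hr hrR
  have hR := hD.R0
  have hR2 : 0 < R ^ 2 := by positivity
  have hr2 : 0 < r ^ 2 := by positivity
  have hrr : r ^ 2 ≤ (R / 2) ^ 2 := by gcongr
  rw [div_pow] at hrr
  have hnn : 0 ≤ u (x, t - r ^ 2) := hu.nonneg (x, t - r ^ 2) ⟨hx, by simp; linarith⟩
  obtain ⟨y, hy, hxy⟩ := hD.near x
  obtain ⟨e, h, hch⟩ := hD.chart y hy
  have hball := ball_infDist_subset hD.op hx
  obtain ⟨d, hdd⟩ : ∃ d, d = infDist x (frontier Ω) := ⟨_, rfl⟩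
  rw [← hdd] at hd hxy hball
  have hd0 : 0 < d := lt_trans (by positivity) hd
  obtain ⟨q, hq⟩ : ∃ q, q = max r d := ⟨_, rfl⟩
  have hq1 : r ≤ q := by rw [hq]; exact le_max_left _ _
  have hq2 : d ≤ q := by rw [hq]; exact le_max_right _ _
  have hq0 : 0 < q := by linarith
  have hqd : μ * q ≤ d := by
    rw [hq]
    rcases max_choice r d with h | h
    · rw [h]; exact hd.le
    · rw [h]; have : μ * d ≤ 1 * d := by gcongr
      linarith
  have p1 : 0 ≤ N1 * C * u (x, t - r ^ 2) := by positivity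
  have p2 : 0 ≤ N2 * u (x, t - r ^ 2) := by positivity
  by_cases hcase : (4 * L + 8) * (2 * q) ≤ R
  · have hLq : 0 < L * q := by positivity
    have h12 : 12 * (2 * q) ≤ R := by
      have : 4 * 1 * (2 * q) ≤ 4 * L * (2 * q) := by gcongr
      linarith
    have h12s : (12 * (2 * q)) ^ 2 ≤ R ^ 2 := by gcongr
    have e0 : (12 * (2 * q)) ^ 2 = 144 * (2 * q) ^ 2 := by ring
    have e1 : (2 * q) ^ 2 = 4 * q ^ 2 := by ring
    have hrq : r ^ 2 ≤ q ^ 2 := by gcongr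
    have hqq : 0 < q ^ 2 := by positivity
    have h1 := HB Ω u R hu hD (2 * q) (by positivity) hcase y e h hch (t + r ^ 2) (by linarith) x hx
      (by rw [hxy]; linarith)
    have hhx := hch.h_ge (by rw [hxy]; linarith) hball hd0
    have h2 := HL Ω u hu R y e h hch (2 * q) (y + (2 * q) • e) x ((2 * q) ^ 2 - 2 * r ^ 2)
      (t + r ^ 2 - (2 * q) ^ 2) (by positivity) (by linarith) (by rw [hch.n_up (by positivity)])
      (by rw [hxy]; linarith)
      (by rw [hch.h_up]; have : μ * q ≤ 1 * q := by gcongr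
          linarith) (by linarith) (by linarith) (by linarith) (by linarith)
    rw [show t + r ^ 2 - (2 * q) ^ 2 + ((2 * q) ^ 2 - 2 * r ^ 2) = t - r ^ 2 by ring] at h2
    have h3 := mul_le_mul_of_nonneg_left h2 (show 0 ≤ N1 by linarith)
    linarith
  · push Not at hcase
    have hκ : μ / (8 * L + 16) * R ≤ d := by
      refine le_trans ?_ hqd
      rw [div_mul_eq_mul_div, div_le_iff₀ (by positivity)]
      have := mul_le_mul_of_nonneg_left hcase.le hμ.le
      linarith
    have := sup_mono hν hu hD.bdd (s := t - r ^ 2 - R ^ 2 / 8) (B := N2 * u (x, t - r ^ 2)) (by linarith)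
      p2 (by
        intro x' hx'
        have := HC Ω u R hu hD x x' (t - r ^ 2 - R ^ 2 / 8) (R ^ 2 / 8)
          ((ball_subset_ball hκ).trans hball) hx' (by linarith) (by linarith) (by linarith)
        rwa [sub_add_cancel] at this) x hx (t + r ^ 2) (by linarith)
    linarith

end

/-- **Theorem 2.3** (backward Harnack inequality): let `u ≥ 0` solve `Lu = 0` in
`Q = Ω × (0,∞)` over a bounded Lipschitz domain `Ω`, vanishing continuously on
`∂Ω × (0,∞)`, and let `diam Ω ≤ λ r₀`, `diam Ω ≤ λ δ`. Then
`u(x, t + r²) ≤ N u(x, t - r²)` with `N = N(n, ν, m, λ, μ)` whenever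
`dist(x, ∂Ω) > μr`, `t > δ²` and `0 < r ≤ min(r₀, δ)/2`. -/
theorem backward_harnack (n : ℕ) (hn : 0 < n) (ν : ℝ) (hν : ν ∈ Ioc (0 : ℝ) 1)
    (m lam μ : ℝ) (hlam : 1 ≤ lam) (hμ : 0 < μ) :
    ∃ N : ℝ, 0 < N ∧
      ∀ (r₀ : ℝ) (Ω : Set (E n)), IsLipschitzDomain hn Ω m r₀ →
        Bornology.IsBounded Ω →
      ∀ (a : E n × ℝ → Fin n → Fin n → ℝ), IsParabolicCoeff ν a (closure (Cyl Ω)) →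
      ∀ u : E n × ℝ → ℝ, SolvesL a u (Cyl Ω) → (∀ X ∈ Cyl Ω, 0 ≤ u X) →
        ContinuousOn u (closure (Cyl Ω)) →
        (∀ Z ∈ frontier Ω ×ˢ Ioi (0 : ℝ), u Z = 0) →
      ∀ δ : ℝ, 0 < δ → Metric.diam Ω ≤ lam * r₀ → Metric.diam Ω ≤ lam * δ →
      ∀ x ∈ Ω, ∀ t r : ℝ,
        μ * r < infDist x (frontier Ω) → δ ^ 2 < t →
        0 < r → r ≤ min r₀ δ / 2 →
        u (x, t + r ^ 2) ≤ N * u (x, t - r ^ 2) := by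
  by_cases hm : 0 < m
  swap
  · refine ⟨1, one_pos, ?_⟩
    intro r₀ Ω hΩ
    exact absurd hΩ.2.2.2.1 hm
  obtain ⟨N, hN, H⟩ := core n hν.1 (L := 1 + m) (lam := lam) (μ := min μ 1) (by linarith) (by positivity)
    (min_le_right _ _)
  refine ⟨N, hN, ?_⟩
  intro r₀ Ω hΩ hb a ha u hsol hnn hcont hbd δ hδ hd1 hd2 x hx t r hμr ht hr hrR
  have hr0 : 0 < r₀ := hΩ.2.2.2.2.1
  have hR : 0 < min r₀ δ := lt_min hr0 hδ
  have hcyl : ∀ X ∈ Ω ×ˢ Ioi (0 : ℝ), X ∈ Cyl Ω := fun X hX => hX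
  have hS : Sol ν Ω u := by
    refine ⟨hΩ.1, hcont.mono ?_, hnn, hbd, ?_, ?_⟩
    · have : closure (Cyl Ω) = closure Ω ×ˢ Ici 0 := by
        rw [Cyl, CylFrom, closure_prod_eq, closure_Ioi]
      rw [this]
      exact Set.prod_mono le_rfl Ioi_subset_Ici_self
    · intro X hX
      exact ⟨hsol.1 X hX, a X, ha.2 X (subset_closure hX), (hsol.2 X hX).le⟩
    · intro X hX
      exact ⟨hsol.1 X hX, a X, ha.2 X (subset_closure hX), (hsol.2 X hX).ge⟩
  have hD : Dom Ω (1 + m) (min r₀ δ) lam := by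
    refine ⟨by linarith, hR, hΩ.1, hb, hΩ.2.2.1.isPreconnected, frontier_nonempty hn hb hΩ.2.1, ?_, ?_⟩
    · rcases min_choice r₀ δ with h | h
      · rw [h]; exact hd1
      · rw [h]; exact hd2
    · intro y hy
      exact chart_of_lipschitz hΩ hR (min_le_left _ _) hy
  refine H Ω u (min r₀ δ) hS hD x hx t r (lt_of_le_of_lt ?_ hμr) (lt_of_le_of_lt ?_ ht) hr hrR
  · gcongr; exact min_le_left _ _
  · gcongr; exact min_le_right _ _
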